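/- Let n > q ≥ 2 and 0 ≤ k ≤ q+1. Let Π be a smooth Nambu structure of order q on an open neighborhood U of 0 in ℝⁿ with Π(0) = 0 and with linear part Π_{k,q} at 0. Then Π can be smoothly normalized up to a flat term along its singular locus: there exist an open neighborhood W ⊆ U of 0 and a C^∞ diffeomorphism φ from W onto an open neighborhood of 0 in ℝⁿ with φ(0) = 0 such that φ_*Π − Π_{k,q} is flat along the set {y ∈ φ(W) : y₁ = ⋯ = y_{q+1} = 0}. -/

import Mathlib

open scoped ContDiff

namespace NambuLin

/-- Index set for the standard basis of the `q`-th exterior power of `ℝⁿ`: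
increasing multi-indices, encoded as `q`-element subsets of `Fin n`. -/
abbrev Idx (n q : ℕ) := {s : Finset (Fin n) // s.card = q}

/-- A `q`-vector of `ℝⁿ`, given by its coordinates in the standard basis
`{e_{i₁} ∧ ⋯ ∧ e_{i_q}}` of `⋀^q(ℝⁿ)`. -/
abbrev MultiVec (n q : ℕ) := Idx n q → ℝ

/-- The Jacobian matrix of a map `φ : ℝⁿ → ℝⁿ` at a point `x`. -/
noncomputable def jac {n : ℕ} (φ : (Fin n → ℝ) → (Fin n → ℝ)) (x : Fin n → ℝ) :
    Matrix (Fin n) (Fin n) ℝ :=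
  Matrix.of fun i j => fderiv ℝ φ x (Pi.single j 1) i

/-- The `q`-th exterior power `⋀^q A` of a matrix `A`, acting on `q`-vectors in
coordinates: `((⋀^q A) w)_J = ∑_I det(A[J,I]) w_I`. -/
noncomputable def extPow (n q : ℕ) (A : Matrix (Fin n) (Fin n) ℝ) (w : MultiVec n q) :
    MultiVec n q :=
  fun J => ∑ I : Idx n q,
    (A.submatrix (J.1.orderEmbOfFin J.2) (I.1.orderEmbOfFin I.2)).det * w I

/-- The constant `q`-vector `e₁ ∧ ⋯ ∧ e_q` in coordinates. -/
def stdVec (n q : ℕ) : MultiVec n q :=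
  fun J => if (J : Finset (Fin n)) = Finset.univ.filter (fun i : Fin n => (i : ℕ) < q) then 1 else 0

/-- `φ` is a `C^∞` diffeomorphism from the open set `W` onto the open set `φ '' W`. -/
def IsSmoothDiffeoOn {n : ℕ} (φ : (Fin n → ℝ) → (Fin n → ℝ)) (W : Set (Fin n → ℝ)) : Prop :=
  IsOpen W ∧ IsOpen (φ '' W) ∧ ContDiffOn ℝ ∞ φ W ∧
    ∃ ψ : (Fin n → ℝ) → (Fin n → ℝ), ContDiffOn ℝ ∞ ψ (φ '' W) ∧
      (∀ x ∈ W, ψ (φ x) = x) ∧ (∀ y ∈ φ '' W, φ (ψ y) = y)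

/-- `P` is a (smooth) Nambu structure of order `q` on `U`: it is a smooth `q`-vector
field, and around every point where it does not vanish there is a local `C^∞`
coordinate system in which it becomes the constant `q`-vector `e₁ ∧ ⋯ ∧ e_q`. -/
def IsNambu (n q : ℕ) (P : (Fin n → ℝ) → MultiVec n q) (U : Set (Fin n → ℝ)) : Prop :=
  ContDiffOn ℝ ∞ P U ∧
    ∀ p ∈ U, P p ≠ 0 →
      ∃ W, p ∈ W ∧ W ⊆ U ∧ ∃ φ, IsSmoothDiffeoOn φ W ∧
        ∀ x ∈ W, extPow n q (jac φ x) (P x) = stdVec n q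

/-- The signs `ε_j` (`= 1` for the first `k` indices, `= -1` afterwards;
`0`-based indexing, so `ε_j = 1` iff `j < k`). -/
def eps {n : ℕ} (k : ℕ) (j : Fin n) : ℝ := if (j : ℕ) < k then 1 else -1

/-- The set of indices `{1, …, q+1}` (in `0`-based form: `{0,…,q}`). -/
def topIdx (n q : ℕ) : Finset (Fin n) := Finset.univ.filter (fun i : Fin n => (i : ℕ) < q + 1)

/-- The nondegenerate Type 1 linear Nambu structure `Π_{k,q}` of order `q` and
signature `(k, q+1-k)`:
`Π_{k,q}(x) = ∑_{j=1}^{q+1} (−1)^{j−1} ε_j x_j e₁ ∧ ⋯ ∧ ê_j ∧ ⋯ ∧ e_{q+1}`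
(here written with `0`-based indices `j`, whence the sign `(−1)^j`). -/
def modelPi (n q k : ℕ) (x : Fin n → ℝ) : MultiVec n q :=
  fun J => ∑ j : Fin n,
    if ((j : ℕ) < q + 1 ∧ (J : Finset (Fin n)) = (topIdx n q).erase j)
    then (-1 : ℝ) ^ (j : ℕ) * eps k j * x j else 0

end NambuLin

namespace NambuLin

section EvAlgebra

/-- Evaluation of a `q`-vector on `q` covectors. -/
noncomputable def ev {n q : ℕ} {R : Type*} [CommRing R] (w : Idx n q → R) :
    (Fin n → R) [⋀^Fin q]→ₗ[R] R :=
  ∑ I : Idx n q, w I • (Matrix.detRowAlternating (n := Fin q) (R := R)).compLinearMap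
    (LinearMap.funLeft R R (I.1.orderEmbOfFin I.2))

variable {n q : ℕ} {R : Type*} [CommRing R]

theorem ev_apply (w : Idx n q → R) (α : Fin q → Fin n → R) :
    ev w α = ∑ I : Idx n q, (Matrix.of fun a b => α a (I.1.orderEmbOfFin I.2 b)).det * w I := by
  have key : ∀ (s : Finset (Idx n q)) (F : Idx n q → (Fin n → R) [⋀^Fin q]→ₗ[R] R),
      (∑ I ∈ s, F I) α = ∑ I ∈ s, F I α := by
    intro s F
    induction s using Finset.cons_induction with
    | empty => simp
    | cons a s ha ih => rw [Finset.sum_cons, Finset.sum_cons, AlternatingMap.add_apply, ih]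
  rw [ev, key]
  refine Finset.sum_congr rfl fun I _ => ?_
  rw [AlternatingMap.smul_apply, smul_eq_mul, mul_comm]; rfl

theorem extPow_apply (A : Matrix (Fin n) (Fin n) ℝ) (w : MultiVec n q) (J : Idx n q) :
    extPow n q A w J = ev w (fun a => A (J.1.orderEmbOfFin J.2 a)) := by
  rw [ev_apply]; rfl

theorem det_delta_emb (I J : Idx n q) :
    (Matrix.of fun a b => (Pi.single (J.1.orderEmbOfFin J.2 a) (1 : R) : Fin n → R)
      (I.1.orderEmbOfFin I.2 b)).det = if I = J then 1 else 0 := by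
  split_ifs with h
  · subst h
    convert Matrix.det_one (n := Fin q) (R := R) using 2
    ext a b
    simp only [Matrix.of_apply, Pi.single_apply, Matrix.one_apply, EmbeddingLike.apply_eq_iff_eq,
      eq_comm]
  · have hne : ¬ (J.1 ⊆ I.1) := by
      intro hs
      apply h
      apply Subtype.ext
      exact (Finset.eq_of_subset_of_card_le hs (by rw [I.2, J.2])).symm
    obtain ⟨x, hx, hxI⟩ := Finset.not_subset.1 hne
    obtain ⟨a, rfl⟩ : ∃ a, J.1.orderEmbOfFin J.2 a = x := by
      have : x ∈ Set.range (J.1.orderEmbOfFin J.2) := by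
        rw [Finset.range_orderEmbOfFin]; exact hx
      exact this
    apply Matrix.det_eq_zero_of_row_eq_zero a
    intro b
    simp only [Matrix.of_apply, Pi.single_apply]
    rw [if_neg]
    intro hb
    apply hxI
    rw [← hb]
    exact Finset.orderEmbOfFin_mem _ _ _

theorem ev_single (w : Idx n q → R) (J : Idx n q) :
    ev w (fun a => Pi.single (J.1.orderEmbOfFin J.2 a) (1 : R)) = w J := by
  rw [ev_apply]
  simp [det_delta_emb]

/-- An index outside: if all components containing index `k` vanish, evaluation vanishes. -/
theorem ev_single_zero (w : Idx n q → R) (k : Fin n) (hw : ∀ I : Idx n q, k ∈ I.1 → w I = 0)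
    (α : Fin q → Fin n → R) (a : Fin q) (c : R) (ha : α a = Pi.single k c) : ev w α = 0 := by
  rw [ev_apply]
  refine Finset.sum_eq_zero fun I _ => ?_
  by_cases hk : k ∈ I.1
  · rw [hw I hk, mul_zero]
  · rw [Matrix.det_eq_zero_of_row_eq_zero a, zero_mul]
    intro b
    simp only [Matrix.of_apply, ha, Pi.single_apply]
    rw [if_neg]
    intro hb
    exact hk (hb ▸ Finset.orderEmbOfFin_mem _ _ _)

theorem alt_ext {f g : (Fin n → R) [⋀^Fin q]→ₗ[R] R}
    (h : ∀ J : Idx n q, f (fun a => Pi.single (J.1.orderEmbOfFin J.2 a) (1 : R)) =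
      g (fun a => Pi.single (J.1.orderEmbOfFin J.2 a) (1 : R))) : f = g := by
  refine Module.Basis.ext_alternating (Pi.basisFun R (Fin n)) fun v hv => ?_
  let J : Idx n q := ⟨Finset.univ.image v, by
    rw [Finset.card_image_of_injective _ hv, Finset.card_univ, Fintype.card_fin]⟩
  have hmem : ∀ a, v a ∈ Set.range (J.1.orderEmbOfFin J.2) := by
    intro a
    rw [Finset.range_orderEmbOfFin]
    simp [J]
  choose σ hσ using hmem
  have hσi : Function.Injective σ := by
    intro a b hab
    apply hv
    rw [← hσ a, ← hσ b, hab]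
  let τ : Equiv.Perm (Fin q) := Equiv.ofBijective σ (Finite.injective_iff_bijective.1 hσi)
  have key : (fun i => Pi.basisFun R (Fin n) (v i)) =
      (fun a => Pi.single (J.1.orderEmbOfFin J.2 a) (1 : R)) ∘ τ := by
    funext i
    simp [τ, hσ]
  rw [key, AlternatingMap.map_perm, AlternatingMap.map_perm, h]

/-- Functoriality (Cauchy–Binet). -/
theorem ev_extPow (A : Matrix (Fin n) (Fin n) ℝ) (w : MultiVec n q) (α : Fin q → Fin n → ℝ) :
    ev (extPow n q A w) α = ev w (fun a => Matrix.vecMul (α a) A) := by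
  have : ev (extPow n q A w) = (ev w).compLinearMap (Matrix.vecMulLinear A) := by
    apply alt_ext
    intro J
    rw [ev_single, extPow_apply, AlternatingMap.compLinearMap_apply]
    congr 1
    funext a
    simp
    rfl
  rw [this]; rfl

theorem extPow_mul (A B : Matrix (Fin n) (Fin n) ℝ) (w : MultiVec n q) :
    extPow n q (A * B) w = extPow n q A (extPow n q B w) := by
  funext J
  rw [extPow_apply, extPow_apply, ev_extPow]
  rfl

theorem extPow_one (w : MultiVec n q) : extPow n q 1 w = w := by
  funext J
  rw [extPow_apply]
  conv_rhs => rw [← ev_single w J]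
  congr 1
  funext a j
  simp [Matrix.one_apply, Pi.single_apply, eq_comm]

/-- Ring homs commute with `ev`. -/
theorem map_ev {S : Type*} [CommRing S] (f : R →+* S) (w : Idx n q → R) (α : Fin q → Fin n → R) :
    f (ev w α) = ev (fun I => f (w I)) (fun a k => f (α a k)) := by
  rw [ev_apply, ev_apply, map_sum]
  refine Finset.sum_congr rfl fun I _ => ?_
  rw [map_mul, RingHom.map_det]
  rfl

/-- `f`-component. -/
noncomputable def ff (w : Idx n q → R) (A : Fin (q + 1) → Fin n → R) (j : Fin (q + 1)) : R :=
  (-1) ^ (j : ℕ) * ev w (j.removeNth A)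

/-- `X`-component. -/
noncomputable def XX (w : Idx n q → R) (A : Fin (q + 1) → Fin n → R) (i j : Fin (q + 1))
    (α : Fin n → R) : R :=
  -((-1) ^ (j : ℕ) * ev w (j.removeNth (Function.update A i α)))

theorem XX_antisymm (w : Idx n q → R) (A : Fin (q + 1) → Fin n → R) {i j : Fin (q + 1)}
    (hij : i ≠ j) (α : Fin n → R) : XX w A i j α = - XX w A j i α := by
  have h := AlternatingMap.neg_one_pow_smul_map_removeNth_add_eq_zero_of_eq (ev w)
    (v := Function.update (Function.update A i α) j α) (i := i) (j := j)
    (by simp [Function.update_of_ne hij]) hij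
  have h1 : i.removeNth (Function.update (Function.update A i α) j α) =
      i.removeNth (Function.update A j α) := by
    rw [Function.update_comm hij, Fin.removeNth_update]
  rw [h1, Fin.removeNth_update] at h
  simp only [XX]
  rw [zsmul_eq_mul, zsmul_eq_mul] at h
  push_cast at h
  linear_combination -h

theorem XX_self_left (w : Idx n q → R) (A : Fin (q + 1) → Fin n → R) (i j : Fin (q + 1)) :
    XX w A i j (A i) = - ff w A j := by
  simp [XX, ff]

theorem XX_self_right (w : Idx n q → R) (A : Fin (q + 1) → Fin n → R) {i j : Fin (q + 1)}
    (hij : i ≠ j) : XX w A i j (A j) = ff w A i := by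
  rw [XX_antisymm w A hij, XX_self_left, neg_neg]

theorem XX_other (w : Idx n q → R) (A : Fin (q + 1) → Fin n → R) {i j k : Fin (q + 1)}
    (hij : i ≠ j) (hik : k ≠ i) (hjk : k ≠ j) : XX w A i j (A k) = 0 := by
  obtain ⟨i', rfl⟩ := Fin.exists_succAbove_eq hij
  obtain ⟨k', rfl⟩ := Fin.exists_succAbove_eq hjk
  rw [XX, (ev w).map_eq_zero_of_eq (i := i') (j := k'), mul_zero, neg_zero]
  · simp [Fin.removeNth, Function.update_of_ne hik]
  · rintro rfl; exact hik rfl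

theorem XX_add (w : Idx n q → R) (A : Fin (q + 1) → Fin n → R) {i j : Fin (q + 1)} (hij : i ≠ j)
    (α β : Fin n → R) : XX w A i j (α + β) = XX w A i j α + XX w A i j β := by
  obtain ⟨i', rfl⟩ := Fin.exists_succAbove_eq hij
  simp only [XX, Fin.removeNth_update_succAbove, AlternatingMap.map_update_add]
  ring

theorem XX_smul (w : Idx n q → R) (A : Fin (q + 1) → Fin n → R) {i j : Fin (q + 1)} (hij : i ≠ j)
    (c : R) (α : Fin n → R) : XX w A i j (c • α) = c * XX w A i j α := by
  obtain ⟨i', rfl⟩ := Fin.exists_succAbove_eq hij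
  simp only [XX, Fin.removeNth_update_succAbove, AlternatingMap.map_update_smul, smul_eq_mul]
  ring

/-- `XX` as a linear map in the covector slot. -/
noncomputable def XXlin (w : Idx n q → R) (A : Fin (q + 1) → Fin n → R) {i j : Fin (q + 1)}
    (hij : i ≠ j) : (Fin n → R) →ₗ[R] R where
  toFun := XX w A i j
  map_add' := XX_add w A hij
  map_smul' c α := by rw [XX_smul w A hij]; rfl

theorem XX_expand (w : Idx n q → R) (A : Fin (q + 1) → Fin n → R) {i j : Fin (q + 1)} (hij : i ≠ j)
    (α : Fin n → R) : XX w A i j α = ∑ k, α k * XX w A i j (Pi.single k 1) := by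
  have h : XXlin w A hij α = _ := (XXlin w A hij).pi_apply_eq_sum_univ α
  simp only [smul_eq_mul] at h
  refine h.trans (Finset.sum_congr rfl fun k _ => ?_)
  congr 1
  show XX _ _ _ _ _ = _
  congr 1
  funext l
  simp [Pi.single_apply, eq_comm]

/-- The `q+1`-form `v ∧ w`. -/
theorem Om_expand (w : Idx n q → R) (A : Fin (q + 1) → Fin n → R) (i : Fin (q + 1))
    (β v : Fin n → R) :
    ∑ s : Fin (q + 1), (-1) ^ (s : ℕ) * ((Function.update A i β s) ⬝ᵥ v) *
      ev w (s.removeNth (Function.update A i β)) =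
    ff w A i * (β ⬝ᵥ v) - ∑ l ∈ Finset.univ.erase i, XX w A i l β * (A l ⬝ᵥ v) := by
  rw [← Finset.add_sum_erase _ _ (Finset.mem_univ i), sub_eq_add_neg, ← Finset.sum_neg_distrib]
  congr 1
  · simp [ff]; ring
  · refine Finset.sum_congr rfl fun l hl => ?_
    rw [Function.update_of_ne (Finset.ne_of_mem_erase hl)]
    simp only [XX]; ring

end EvAlgebra

end NambuLin

namespace NambuLin

section SmoothRing

/-- The algebra of globally smooth functions. -/
def Sm (n : ℕ) : Subalgebra ℝ ((Fin n → ℝ) → ℝ) where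
  carrier := {F | ContDiff ℝ ∞ F}
  mul_mem' {a b} ha hb := by
    have ha' : ContDiff ℝ ∞ a := ha
    have hb' : ContDiff ℝ ∞ b := hb
    exact ha'.mul hb'
  add_mem' {a b} ha hb := by
    have ha' : ContDiff ℝ ∞ a := ha
    have hb' : ContDiff ℝ ∞ b := hb
    exact ha'.add hb'
  algebraMap_mem' r := by
    show ContDiff ℝ ∞ (fun _ : Fin n → ℝ => r)
    exact contDiff_const

variable {n : ℕ}

instance : CoeFun (Sm n) (fun _ => (Fin n → ℝ) → ℝ) := ⟨fun F => F.1⟩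

theorem Sm.smooth (F : Sm n) : ContDiff ℝ ∞ (F : (Fin n → ℝ) → ℝ) := by
  have h := F.2
  exact h

/-- Constructor. -/
def mkSm (f : (Fin n → ℝ) → ℝ) (hf : ContDiff ℝ ∞ f) : Sm n := ⟨f, by exact hf⟩

@[simp] theorem mkSm_apply (f : (Fin n → ℝ) → ℝ) (hf : ContDiff ℝ ∞ f) (z : Fin n → ℝ) :
    mkSm f hf z = f z := rfl

theorem Sm.ext' {F G : Sm n} (h : ∀ z, F z = G z) : F = G := Subtype.ext (funext h)

theorem Sm.diff (F : Sm n) (z : Fin n → ℝ) : DifferentiableAt ℝ (F : (Fin n → ℝ) → ℝ) z :=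
  ((Sm.smooth F).differentiable (by simp)) z

/-- Evaluation at a point. -/
def evz (z : Fin n → ℝ) : Sm n →ₐ[ℝ] ℝ where
  toFun F := F z
  map_one' := rfl
  map_mul' _ _ := rfl
  map_zero' := rfl
  map_add' _ _ := rfl
  commutes' _ := rfl

@[simp] theorem evz_apply (z : Fin n → ℝ) (F : Sm n) : evz z F = F z := rfl
@[simp] theorem Sm.add_ap (z : Fin n → ℝ) (F G : Sm n) : (F + G) z = F z + G z := rfl
@[simp] theorem Sm.mul_ap (z : Fin n → ℝ) (F G : Sm n) : (F * G) z = F z * G z := rfl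
@[simp] theorem Sm.sub_ap (z : Fin n → ℝ) (F G : Sm n) : (F - G) z = F z - G z := rfl
@[simp] theorem Sm.neg_ap (z : Fin n → ℝ) (F : Sm n) : (-F) z = -F z := rfl
@[simp] theorem Sm.zero_ap (z : Fin n → ℝ) : (0 : Sm n) z = 0 := rfl
@[simp] theorem Sm.one_ap (z : Fin n → ℝ) : (1 : Sm n) z = 1 := rfl
@[simp] theorem Sm.smul_ap (z : Fin n → ℝ) (c : ℝ) (F : Sm n) : (c • F) z = c * F z := rfl
@[simp] theorem Sm.algebraMap_ap (z : Fin n → ℝ) (c : ℝ) : (algebraMap ℝ (Sm n) c) z = c := rfl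
@[simp] theorem Sm.sum_ap {ι : Type*} (z : Fin n → ℝ) (s : Finset ι) (F : ι → Sm n) :
    (∑ i ∈ s, F i) z = ∑ i ∈ s, F i z := map_sum (evz z) F s

/-- Partial derivative. -/
noncomputable def pd (i : Fin n) : Sm n →ₗ[ℝ] Sm n where
  toFun F := mkSm (fun z => fderiv ℝ (F : (Fin n → ℝ) → ℝ) z (Pi.single i 1))
    (((Sm.smooth F).fderiv_right (m := ∞) (by simp)).clm_apply contDiff_const)
  map_add' F G := Sm.ext' fun z => by
    show fderiv ℝ (F.1 + G.1) z _ = _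
    rw [fderiv_add (Sm.diff F z) (Sm.diff G z)]; rfl
  map_smul' c F := Sm.ext' fun z => by
    show fderiv ℝ (c • F.1) z _ = _
    rw [fderiv_const_smul (Sm.diff F z)]; rfl

theorem pd_apply (i : Fin n) (F : Sm n) (z : Fin n → ℝ) :
    pd i F z = fderiv ℝ (F : (Fin n → ℝ) → ℝ) z (Pi.single i 1) := rfl

theorem pd_mul (i : Fin n) (F G : Sm n) : pd i (F * G) = pd i F * G + F * pd i G :=
  Sm.ext' fun z => by
    show fderiv ℝ (F.1 * G.1) z _ = _
    rw [fderiv_mul (Sm.diff F z) (Sm.diff G z)]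
    simp [pd_apply]
    ring

theorem pd_algebraMap (i : Fin n) (c : ℝ) : pd i (algebraMap ℝ (Sm n) c) = 0 :=
  Sm.ext' fun z => by
    show fderiv ℝ (fun _ => c) z _ = _
    simp

theorem pd_one (i : Fin n) : pd i (1 : Sm n) = 0 := by
  rw [← (algebraMap ℝ (Sm n)).map_one]; exact pd_algebraMap i 1

theorem pd_comm (i j : Fin n) (F : Sm n) : pd i (pd j F) = pd j (pd i F) :=
  Sm.ext' fun z => by
    have h2 : ∀ (a b : Fin n), pd a (pd b F) z =
        fderiv ℝ (fderiv ℝ F.1) z (Pi.single a 1) (Pi.single b 1) := by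
      intro a b
      show fderiv ℝ (fun y => fderiv ℝ F.1 y (Pi.single b 1)) z (Pi.single a 1) = _
      have hd : DifferentiableAt ℝ (fderiv ℝ F.1) z :=
        (((Sm.smooth F).fderiv_right (m := ∞) (by simp)).differentiable (by simp)) z
      rw [fderiv_clm_apply hd (differentiableAt_const _)]
      simp
    rw [h2, h2]
    have hs : IsSymmSndFDerivAt ℝ F.1 z :=
      ((Sm.smooth F).contDiffAt).isSymmSndFDerivAt (by simp; exact WithTop.coe_le_coe.2 le_top)
    exact hs _ _

theorem pd_congr {F G : Sm n} {z : Fin n → ℝ} (i : Fin n)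
    (h : (F : (Fin n → ℝ) → ℝ) =ᶠ[nhds z] G) : pd i F z = pd i G z := by
  rw [pd_apply, pd_apply, h.fderiv_eq]

theorem fderiv_eq_sum_pd (F : Sm n) (z v : Fin n → ℝ) :
    fderiv ℝ (F : (Fin n → ℝ) → ℝ) z v = ∑ i, v i * pd i F z := by
  refine (LinearMap.pi_apply_eq_sum_univ (fderiv ℝ (F : (Fin n → ℝ) → ℝ) z).toLinearMap v).trans ?_
  refine Finset.sum_congr rfl fun i _ => ?_
  rw [smul_eq_mul, pd_apply]
  congr 1
  show fderiv ℝ (F : (Fin n → ℝ) → ℝ) z _ = _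
  congr 1
  funext j
  simp [Pi.single_apply, eq_comm]

/-- Coordinate function. -/
noncomputable def co (i : Fin n) : Sm n := mkSm (fun z => z i) (contDiff_apply ℝ ℝ i)

@[simp] theorem co_apply (i : Fin n) (z : Fin n → ℝ) : co i z = z i := rfl

theorem pd_co (i j : Fin n) : pd i (co j) = if i = j then 1 else 0 :=
  Sm.ext' fun z => by
    rw [pd_apply]
    show fderiv ℝ (fun z : Fin n → ℝ => z j) z _ = _
    rw [show (fun z : Fin n → ℝ => z j) = (ContinuousLinearMap.proj (R := ℝ) (φ := fun _ : Fin n => ℝ) j) from rfl, ContinuousLinearMap.fderiv]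
    split_ifs with h
    · subst h; simp
    · simp [Ne.symm h]

theorem pd_sum {ι : Type*} (i : Fin n) (s : Finset ι) (F : ι → Sm n) :
    pd i (∑ j ∈ s, F j) = ∑ j ∈ s, pd i (F j) := map_sum _ _ _

/-- Every function smooth near a point agrees near it with a globally smooth one. -/
theorem globalize {f : (Fin n → ℝ) → ℝ} {p : Fin n → ℝ} (hf : ∀ᶠ z in nhds p, ContDiffAt ℝ ∞ f z) :
    ∃ F : Sm n, (F : (Fin n → ℝ) → ℝ) =ᶠ[nhds p] f := by
  obtain ⟨u, hu, hfu⟩ : ∃ u ∈ nhds p, ∀ z ∈ u, ContDiffAt ℝ ∞ f z := by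
    exact ⟨_, hf, fun z hz => hz⟩
  obtain ⟨ε, hε, hb⟩ := Metric.nhds_basis_closedBall.mem_iff.1 hu
  let b : ContDiffBump p := ⟨ε / 2, ε, by positivity, by linarith⟩
  refine ⟨mkSm (fun z => b z * f z) ?_, ?_⟩
  · refine contDiff_iff_contDiffAt.2 fun z => ?_
    by_cases hz : z ∈ Metric.closedBall p ε
    · exact b.contDiffAt.mul (hfu z (hb hz))
    · have : (fun z => b z * f z) =ᶠ[nhds z] fun _ => 0 := by
        have ho : (Metric.closedBall p ε)ᶜ ∈ nhds z := Metric.isClosed_closedBall.isOpen_compl.mem_nhds hz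
        filter_upwards [ho] with y hy
        have : b y = 0 := b.zero_of_le_dist (by
          simp only [Set.mem_compl_iff, Metric.mem_closedBall, not_le] at hy
          exact hy.le)
        rw [this, zero_mul]
      exact contDiffAt_const.congr_of_eventuallyEq this
  · filter_upwards [b.eventuallyEq_one] with z hz
    show b z * f z = f z
    rw [hz]; simp

end SmoothRing

end NambuLin

namespace NambuLin

section Decomposable

variable {n q : ℕ}

theorem ev_stdVec (hqn : q ≤ n) (α : Fin q → Fin n → ℝ) :
    ev (stdVec n q) α = (Matrix.of fun a c : Fin q => α a (Fin.castLE hqn c)).det := by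
  let I0 : Idx n q := ⟨Finset.univ.filter (fun i : Fin n => (i : ℕ) < q), by
    rw [show (Finset.univ.filter (fun i : Fin n => (i : ℕ) < q)) =
      Finset.univ.image (Fin.castLE hqn) from ?_]
    · rw [Finset.card_image_of_injective _ (Fin.castLE_injective hqn)]; simp
    · ext i
      simp only [Finset.mem_filter, Finset.mem_univ, true_and, Finset.mem_image]
      constructor
      · intro h; exact ⟨⟨i, h⟩, rfl⟩
      · rintro ⟨a, rfl⟩; simp⟩
  have hE : (Fin.castLE hqn : Fin q → Fin n) = I0.1.orderEmbOfFin I0.2 := by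
    apply Finset.orderEmbOfFin_unique
    · intro x; simp [I0]
    · exact Fin.strictMono_castLE hqn
  rw [ev_apply, Finset.sum_eq_single I0]
  · simp only [stdVec, I0, if_true, mul_one]
    rw [hE]
  · intro I _ hI
    rw [stdVec, if_neg, mul_zero]
    intro h; exact hI (Subtype.ext h)
  · simp

/-- `w` is the wedge of the vectors `b`. -/
def Dec (w : MultiVec n q) (b : Fin q → Fin n → ℝ) : Prop :=
  ∀ α : Fin q → Fin n → ℝ, ev w α = (Matrix.of fun a c : Fin q => α a ⬝ᵥ b c).det

theorem dec_of_chart (hqn : q ≤ n) (w : MultiVec n q) (A : Matrix (Fin n) (Fin n) ℝ)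
    (hA : IsUnit A.det) (h : extPow n q A w = stdVec n q) :
    Dec w (fun c k => A⁻¹ k (Fin.castLE hqn c)) := by
  intro α
  have h1 := ev_extPow A w (fun a => Matrix.vecMul (α a) A⁻¹)
  simp only [Matrix.vecMul_vecMul, Matrix.nonsing_inv_mul _ hA, Matrix.vecMul_one] at h1
  rw [← h1, h, ev_stdVec hqn]
  rfl

variable {w : MultiVec n q} {b : Fin q → Fin n → ℝ}

theorem Dec.null (h : Dec w b) (β : Fin n → ℝ) (hβ : ∀ c, β ⬝ᵥ b c = 0)
    (γ : Fin q → Fin n → ℝ) (s : Fin q) : ev w (Function.update γ s β) = 0 := by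
  rw [h]
  apply Matrix.det_eq_zero_of_row_eq_zero s
  intro c
  simp [hβ]

theorem Dec.null_XX (h : Dec w b) (β : Fin n → ℝ) (hβ : ∀ c, β ⬝ᵥ b c = 0)
    (A : Fin (q + 1) → Fin n → ℝ) {i j : Fin (q + 1)} (hij : i ≠ j) : XX w A i j β = 0 := by
  obtain ⟨i', rfl⟩ := Fin.exists_succAbove_eq hij
  simp only [XX, Fin.removeNth_update_succAbove]
  rw [h.null β hβ]; simp

theorem Dec.om (h : Dec w b) (K : Fin (q + 1) → Fin n → ℝ) (c : Fin q) :
    ∑ s : Fin (q + 1), (-1) ^ (s : ℕ) * (K s ⬝ᵥ b c) * ev w (s.removeNth K) = 0 := by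
  let M : Matrix (Fin (q + 1)) (Fin (q + 1)) ℝ :=
    Matrix.of fun s t => Fin.cases (K s ⬝ᵥ b c) (fun t' => K s ⬝ᵥ b t') t
  have hM : M.det = 0 := Matrix.det_zero_of_column_eq (i := 0) (j := c.succ)
    (Fin.succ_ne_zero c).symm (fun s => rfl)
  rw [← hM, Matrix.det_succ_column_zero]
  refine Finset.sum_congr rfl fun s _ => ?_
  congr 1
  rw [h]
  rfl

theorem Dec.ff_om (h : Dec w b) (K : Fin (q + 1) → Fin n → ℝ) (c : Fin q) :
    (fun k => ∑ s : Fin (q + 1), ff w K s * K s k) ⬝ᵥ b c = 0 := by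
  rw [← h.om K c]
  simp only [dotProduct, Finset.sum_mul, Finset.mul_sum]
  rw [Finset.sum_comm]
  refine Finset.sum_congr rfl fun s _ => Finset.sum_congr rfl fun k _ => ?_
  simp only [ff]; ring

/-- The identity (D3). -/
theorem Dec.d3 (h : Dec w b) (A : Fin (q + 1) → Fin n → ℝ) (i : Fin (q + 1)) (β : Fin n → ℝ)
    (γ : Fin q → Fin n → ℝ) (s : Fin q) :
    ff w A i * ev w (Function.update γ s β) =
      ∑ l ∈ Finset.univ.erase i, XX w A i l β * ev w (Function.update γ s (A l)) := by
  have hn : ∀ c, (ff w A i • β - ∑ l ∈ Finset.univ.erase i, XX w A i l β • A l) ⬝ᵥ b c = 0 := by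
    intro c
    have h1 := Om_expand w A i β (b c)
    rw [h.om] at h1
    rw [sub_dotProduct, smul_dotProduct, sum_dotProduct]
    simp only [smul_dotProduct, smul_eq_mul]
    exact h1.symm
  have h2 := h.null _ hn γ s
  rw [AlternatingMap.map_update_sub, AlternatingMap.map_update_smul, AlternatingMap.map_update_sum]
    at h2
  simp only [AlternatingMap.map_update_smul, smul_eq_mul] at h2
  linarith

/-- Plücker relations. -/
theorem Dec.pl (h : Dec w b) (A : Fin (q + 1) → Fin n → ℝ) {i j k : Fin (q + 1)} (hij : i ≠ j)
    (hik : i ≠ k) (hjk : j ≠ k) (β : Fin n → ℝ) :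
    ff w A i * XX w A j k β = ff w A j * XX w A i k β - ff w A k * XX w A i j β := by
  have h1 : ∀ β, XX w A j k β = -((-1) ^ (k : ℕ) *
      ev w (k.removeNth (Function.update A j β))) := fun β => rfl
  obtain ⟨j', hj'⟩ := Fin.exists_succAbove_eq hjk
  have h2 : ∀ β, k.removeNth (Function.update A j β) = Function.update (k.removeNth A) j' β := by
    intro β; rw [← hj', Fin.removeNth_update_succAbove]
  have h3 := h.d3 A i β (k.removeNth A) j'
  have h4 : ff w A i * XX w A j k β = ∑ l ∈ Finset.univ.erase i, XX w A i l β * XX w A j k (A l) := by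
    have : ∀ l, XX w A j k (A l) =
        -((-1) ^ (k : ℕ) * ev w (Function.update (k.removeNth A) j' (A l))) := by
      intro l; rw [h1, h2]
    simp only [this]
    rw [h1, h2]
    calc _ = -((-1) ^ (k : ℕ)) * (ff w A i * ev w (Function.update (k.removeNth A) j' β)) := by ring
      _ = _ := by
        rw [h3, Finset.mul_sum]
        refine Finset.sum_congr rfl fun l _ => ?_
        ring
  rw [h4, ← Finset.add_sum_erase _ _ (Finset.mem_erase.2 ⟨hij.symm, Finset.mem_univ j⟩),
    ← Finset.add_sum_erase _ _ (Finset.mem_erase.2 ⟨hjk.symm, Finset.mem_erase.2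
      ⟨hik.symm, Finset.mem_univ k⟩⟩), XX_self_left, XX_self_right _ _ hjk, Finset.sum_eq_zero]
  · ring
  · intro l hl
    simp only [Finset.mem_erase] at hl
    rw [XX_other _ _ hjk hl.2.1 hl.1, mul_zero]

end Decomposable

section GoodStructures

variable {n q : ℕ}

/-- Derivative along a constant vector. -/
noncomputable def dd (v : Fin n → ℝ) : Sm n →ₗ[ℝ] Sm n := ∑ i, v i • pd i

theorem dd_eq (v : Fin n → ℝ) (F : Sm n) : dd v F = ∑ i, v i • pd i F := by
  simp [dd, LinearMap.sum_apply]

theorem dd_apply (v : Fin n → ℝ) (F : Sm n) (z : Fin n → ℝ) :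
    dd v F z = ∑ i, v i * pd i F z := by
  rw [dd_eq]; simp

theorem dd_mul (v : Fin n → ℝ) (F G : Sm n) : dd v (F * G) = dd v F * G + F * dd v G := by
  simp only [dd_eq, pd_mul, smul_add, Finset.sum_add_distrib, Finset.sum_mul, Finset.mul_sum,
    smul_mul_assoc, mul_smul_comm]

theorem dd_comm (u v : Fin n → ℝ) (F : Sm n) : dd u (dd v F) = dd v (dd u F) := by
  simp only [dd_eq, map_sum, map_smul, Finset.smul_sum]
  rw [Finset.sum_comm]
  refine Finset.sum_congr rfl fun i _ => Finset.sum_congr rfl fun j _ => ?_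
  rw [pd_comm, smul_comm]

theorem dd_congr {F G : Sm n} {z : Fin n → ℝ} (v : Fin n → ℝ)
    (h : (F : (Fin n → ℝ) → ℝ) =ᶠ[nhds z] G) : dd v F z = dd v G z := by
  rw [dd_apply, dd_apply]
  exact Finset.sum_congr rfl fun i _ => by rw [pd_congr i h]

/-- gradient of a function. -/
noncomputable def gr (F : Sm n) : Fin n → Sm n := fun k => pd k F

/-- Values of a family. -/
def at' (P : Idx n q → Sm n) (z : Fin n → ℝ) : MultiVec n q := fun I => P I z

/-- `P` is straightened near `z` by a chart. -/
def GoodAt (P : Idx n q → Sm n) (z : Fin n → ℝ) : Prop :=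
  at' P z ≠ 0 → ∃ χ : Fin n → Sm n, IsUnit (Matrix.of fun i j => pd j (χ i) z).det ∧
    ∀ᶠ z' in nhds z, extPow n q (Matrix.of fun i j => pd j (χ i) z') (at' P z') = stdVec n q

theorem ev_z (P : Idx n q → Sm n) (α : Fin q → Fin n → Sm n) (z : Fin n → ℝ) :
    (ev P α) z = ev (at' P z) (fun a k => α a k z) := map_ev (evz z).toRingHom P α

theorem ff_z (P : Idx n q → Sm n) (A : Fin (q + 1) → Fin n → Sm n) (j : Fin (q + 1))
    (z : Fin n → ℝ) : (ff P A j) z = ff (at' P z) (fun a k => A a k z) j := by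
  have : (ff P A j) z = (evz z) (ff P A j) := rfl
  rw [this, ff, map_mul, map_pow, map_neg, map_one, ff]
  congr 1
  exact ev_z P _ z

theorem XX_z (P : Idx n q → Sm n) (A : Fin (q + 1) → Fin n → Sm n) (i j : Fin (q + 1))
    (α : Fin n → Sm n) (z : Fin n → ℝ) :
    (XX P A i j α) z = XX (at' P z) (fun a k => A a k z) i j (fun k => α k z) := by
  have : (XX P A i j α) z = (evz z) (XX P A i j α) := rfl
  rw [this, XX, map_neg, map_mul, map_pow, map_neg, map_one, XX]
  congr 2
  refine (ev_z P _ z).trans ?_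
  congr 1
  funext a k
  simp only [Fin.removeNth, Function.update_apply]
  split_ifs <;> rfl

theorem ev_zero_w {R : Type*} [CommRing R] (α : Fin q → Fin n → R) : ev (0 : Idx n q → R) α = 0 := by
  rw [ev_apply]; simp

theorem d3_at (hqn : q ≤ n) {P : Idx n q → Sm n} {z : Fin n → ℝ} (hP : GoodAt P z)
    (A : Fin (q + 1) → Fin n → Sm n) (i : Fin (q + 1)) (β : Fin n → Sm n)
    (γ : Fin q → Fin n → Sm n) (s : Fin q) :
    (ff P A i * ev P (Function.update γ s β)) z =
      (∑ l ∈ Finset.univ.erase i, XX P A i l β * ev P (Function.update γ s (A l))) z := by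
  have key : ∀ β : Fin n → Sm n, (fun a k => (Function.update γ s β) a k z) =
      Function.update (fun a k => γ a k z) s (fun k => β k z) := by
    intro β; funext a k; simp only [Function.update_apply]; split_ifs <;> rfl
  simp only [Sm.sum_ap, Sm.mul_ap, ff_z, XX_z, ev_z, key]
  by_cases h0 : at' P z = 0
  · simp [h0, ev_zero_w]
  · obtain ⟨χ, hu, hχ⟩ := hP h0
    exact (dec_of_chart hqn _ _ hu hχ.self_of_nhds).d3 _ _ _ _ _

theorem pl_at (hqn : q ≤ n) {P : Idx n q → Sm n} {z : Fin n → ℝ} (hP : GoodAt P z)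
    (A : Fin (q + 1) → Fin n → Sm n) {i j k : Fin (q + 1)} (hij : i ≠ j)
    (hik : i ≠ k) (hjk : j ≠ k) (β : Fin n → Sm n) :
    (ff P A i * XX P A j k β) z = (ff P A j * XX P A i k β - ff P A k * XX P A i j β) z := by
  simp only [Sm.sub_ap, Sm.mul_ap, ff_z, XX_z]
  by_cases h0 : at' P z = 0
  · simp [h0, ff, ev_zero_w]
  · obtain ⟨χ, hu, hχ⟩ := hP h0
    exact (dec_of_chart hqn _ _ hu hχ.self_of_nhds).pl _ hij hik hjk _

/-- Involutivity. -/
theorem inv_at (hqn : q ≤ n) {P : Idx n q → Sm n} {z : Fin n → ℝ} (hP : GoodAt P z)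
    (ρ : Fin (q + 1) → Sm n) (A B : Fin (q + 1) → Fin n → ℝ) {i j k l : Fin (q + 1)} (hij : i ≠ j)
    (hkl : k ≠ l) (X Y : Fin n → ℝ) (hX : X = fun m => XX (at' P z) A i j (Pi.single m 1))
    (hY : Y = fun m => XX (at' P z) B k l (Pi.single m 1)) :
    ∑ s : Fin (q + 1), (dd X (ff P (fun l => gr (ρ l)) s) z * dd Y (ρ s) z -
      dd Y (ff P (fun l => gr (ρ l)) s) z * dd X (ρ s) z) = 0 := by
  by_cases h0 : at' P z = 0
  · have hX0 : X = 0 := by rw [hX]; funext m; simp [h0, XX, ev_zero_w]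
    have hY0 : Y = 0 := by rw [hY]; funext m; simp [h0, XX, ev_zero_w]
    simp [dd_apply, hX0, hY0]
  obtain ⟨χ, hu, hχ⟩ := hP h0
  set J : Matrix (Fin n) (Fin n) (Sm n) := Matrix.of fun i j => pd j (χ i) with hJ
  have hJz : ∀ z', J.map (evz z') = Matrix.of fun i j => pd j (χ i) z' := fun z' => rfl
  set θ : Fin (q + 1) → Sm n := fun s => ff P (fun l => gr (ρ l)) s with hθ
  set om : (Fin n → Sm n) := fun k => ∑ s, θ s * pd k (ρ s) with hom
  set lam : Fin n → Sm n := Matrix.vecMul om J.adjugate with hlam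
  set D : Sm n := J.det with hD
  have hDz : ∀ z', D z' = (Matrix.of fun i j => pd j (χ i) z').det := by
    intro z'
    rw [← hJz]
    exact (evz z').toRingHom.map_det J
  have hid : ∀ k, D * om k = ∑ c, lam c * pd k (χ c) := by
    intro k
    have : Matrix.vecMul lam J = D • om := by
      rw [hlam, Matrix.vecMul_vecMul, Matrix.adjugate_mul, Matrix.vecMul_smul, Matrix.vecMul_one]
    have := congrFun this k
    simp only [Pi.smul_apply, smul_eq_mul] at this
    rw [← this]; rfl
  -- contracted with a constant vector
  have hidv : ∀ v : Fin n → ℝ, D * ∑ s, θ s * dd v (ρ s) = ∑ c, lam c * dd v (χ c) := by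
    intro v
    have e1 : ∑ s, θ s * dd v (ρ s) = ∑ k, v k • om k := by
      simp only [dd_eq, hom, Finset.mul_sum, Finset.smul_sum, mul_smul_comm]
      rw [Finset.sum_comm]
    have e2 : ∑ c, lam c * dd v (χ c) = ∑ k, v k • (D * om k) := by
      simp only [dd_eq, hid, Finset.mul_sum, Finset.smul_sum, mul_smul_comm]
      rw [Finset.sum_comm]
    rw [e1, e2, Finset.mul_sum]
    simp only [mul_smul_comm]
  -- dec
  have hcont : ∀ᶠ z' in nhds z, IsUnit (D z') := by
    have hc : ContinuousAt (D : (Fin n → ℝ) → ℝ) z := (Sm.smooth D).continuous.continuousAt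
    have : D z ≠ 0 := by rw [hDz]; exact hu.ne_zero
    filter_upwards [hc.eventually_ne this] with z' hz'
    exact isUnit_iff_ne_zero.2 hz'
  have hlam0 : ∀ c : Fin q, ∀ᶠ z' in nhds z, lam (Fin.castLE hqn c) z' = 0 := by
    intro c
    filter_upwards [hcont, hχ] with z' hz' hχ'
    rw [hDz] at hz'
    have hdec := dec_of_chart hqn _ _ hz' hχ'
    have h1 := hdec.ff_om (fun l k => pd k (ρ l) z') c
    have h2 : lam (Fin.castLE hqn c) z' =
        ∑ k, om k z' * (Matrix.of fun i j => pd j (χ i) z').adjugate k (Fin.castLE hqn c) := by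
      have : lam (Fin.castLE hqn c) = ∑ k, om k * J.adjugate k (Fin.castLE hqn c) := rfl
      rw [this, Sm.sum_ap]
      refine Finset.sum_congr rfl fun k _ => ?_
      rw [Sm.mul_ap]
      congr 1
      rw [← hJz]
      have := (evz z').toRingHom.map_adjugate J
      exact congrFun (congrFun this k) _
    rw [h2]
    have h3 : ∀ k, om k z' = ∑ s, ff (at' P z') (fun l k => pd k (ρ l) z') s * pd k (ρ s) z' := by
      intro k
      rw [hom]
      simp only [Sm.sum_ap, Sm.mul_ap, hθ, ff_z]
      rfl
    have h4 : ∀ k, (Matrix.of fun i j => pd j (χ i) z').adjugate k (Fin.castLE hqn c) =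
        (Matrix.of fun i j => pd j (χ i) z').det *
          (Matrix.of fun i j => pd j (χ i) z')⁻¹ k (Fin.castLE hqn c) := by
      intro k
      rw [Matrix.inv_def, Matrix.smul_apply, smul_eq_mul, ← mul_assoc, Ring.mul_inverse_cancel _ hz',
        one_mul]
    simp only [h3, h4]
    simp only [dotProduct] at h1
    calc _ = (Matrix.of fun i j => pd j (χ i) z').det * ∑ k, (∑ s, ff (at' P z')
        (fun l k => pd k (ρ l) z') s * pd k (ρ s) z') *
          (Matrix.of fun i j => pd j (χ i) z')⁻¹ k (Fin.castLE hqn c) := by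
          rw [Finset.mul_sum]
          refine Finset.sum_congr rfl fun k _ => ?_
          ring
      _ = 0 := by rw [h1, mul_zero]
  have hdecz := dec_of_chart hqn _ _ hu hχ.self_of_nhds
  -- vectors kill chi_c
  have hvec : ∀ (A : Fin (q + 1) → Fin n → ℝ) (i j : Fin (q + 1)) (hij : i ≠ j) (F : Sm n),
      dd (fun m => XX (at' P z) A i j (Pi.single m 1)) F z =
        XX (at' P z) A i j (fun k => pd k F z) := by
    intro A i j hij F
    rw [dd_apply, XX_expand _ _ hij]
    exact Finset.sum_congr rfl fun k _ => mul_comm _ _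
  have hnullc : ∀ c' : Fin n, q ≤ (c' : ℕ) → ∀ c : Fin q, (fun k => pd k (χ c') z) ⬝ᵥ
      (fun k => (Matrix.of fun i j => pd j (χ i) z)⁻¹ k (Fin.castLE hqn c)) = 0 := by
    intro c' hc' c
    have h1 := Matrix.mul_nonsing_inv _ hu
    have h2 := congrFun (congrFun h1 c') (Fin.castLE hqn c)
    rw [Matrix.one_apply_ne] at h2
    · exact h2
    · intro h
      rw [h] at hc'
      have := c.2
      simp at hc'
      omega
  have hXc : ∀ c : Fin n, q ≤ (c : ℕ) → dd X (χ c) z = 0 := by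
    intro c hc
    rw [hX, hvec _ _ _ hij]
    exact hdecz.null_XX _ (hnullc c hc) _ hij
  have hYc : ∀ c : Fin n, q ≤ (c : ℕ) → dd Y (χ c) z = 0 := by
    intro c hc
    rw [hY, hvec _ _ _ hkl]
    exact hdecz.null_XX _ (hnullc c hc) _ hkl
  have hlamd : ∀ v, ∀ c : Fin n, (c : ℕ) < q → dd v (lam c) z = 0 := by
    intro v c hc
    have : c = Fin.castLE hqn ⟨c, hc⟩ := rfl
    rw [this]
    have h := dd_congr (F := lam (Fin.castLE hqn ⟨c, hc⟩)) (G := 0) v (hlam0 _)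
    rw [h]; simp
  have hsumz : ∀ v, (∀ c : Fin n, q ≤ (c : ℕ) → dd v (χ c) z = 0) →
      (∑ s, θ s * dd v (ρ s)) z = 0 := by
    intro v hv
    have h1 := congrArg (fun F : Sm n => F z) (hidv v)
    simp only [Sm.mul_ap] at h1
    have h2 : (∑ c, lam c * dd v (χ c)) z = 0 := by
      rw [Sm.sum_ap]
      refine Finset.sum_eq_zero fun c _ => ?_
      rw [Sm.mul_ap]
      by_cases hc : (c : ℕ) < q
      · rw [show lam c z = 0 from (hlam0 ⟨c, hc⟩).self_of_nhds, zero_mul]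
      · rw [hv c (not_lt.1 hc), mul_zero]
    rw [h2] at h1
    exact (mul_eq_zero.1 h1).resolve_left hcont.self_of_nhds.ne_zero
  have e1 := congrArg (fun F : Sm n => dd X F z) (hidv Y)
  have e2 := congrArg (fun F : Sm n => dd Y F z) (hidv X)
  simp only [dd_mul, map_sum, Sm.add_ap, Sm.mul_ap, hsumz X hXc, hsumz Y hYc, mul_zero, zero_add,
    Sm.sum_ap, Finset.sum_add_distrib] at e1 e2
  have hr : ∀ u v, (∀ c : Fin n, q ≤ (c : ℕ) → dd v (χ c) z = 0) →
      ∑ c, dd u (lam c) z * dd v (χ c) z = 0 := by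
    intro u v hv
    refine Finset.sum_eq_zero fun c _ => ?_
    by_cases hc : (c : ℕ) < q
    · rw [hlamd u c hc, zero_mul]
    · rw [hv c (not_lt.1 hc), mul_zero]
  rw [hr X Y hYc] at e1
  rw [hr Y X hXc] at e2
  have e3 : ∑ c, lam c z * dd Y (dd X (χ c)) z = ∑ c, lam c z * dd X (dd Y (χ c)) z :=
    Finset.sum_congr rfl fun c _ => by rw [dd_comm]
  have e4 : ∑ s, θ s z * dd Y (dd X (ρ s)) z = ∑ s, θ s z * dd X (dd Y (ρ s)) z :=
    Finset.sum_congr rfl fun c _ => by rw [dd_comm]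
  rw [e3, e4] at e2
  rw [Finset.sum_sub_distrib]
  have e5 : D z * (∑ s, dd X (θ s) z * dd Y (ρ s) z - ∑ s, dd Y (θ s) z * dd X (ρ s) z) = 0 := by
    linear_combination e1 - e2
  exact (mul_eq_zero.1 e5).resolve_left hcont.self_of_nhds.ne_zero

end GoodStructures

end NambuLin

namespace NambuLin

section LeadCalculus

variable {R : Type*} [CommRing R]

/-- `f` has order at least `m` with coefficient `p` in degree `m`. -/
def Lead (m : ℕ) (f : PowerSeries R) (p : R) : Prop :=
  ∃ g, f = PowerSeries.X ^ m * g ∧ PowerSeries.constantCoeff g = p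

theorem lead_iff {m : ℕ} {f : PowerSeries R} {p : R} :
    Lead m f p ↔ PowerSeries.X ^ m ∣ f ∧ PowerSeries.coeff m f = p := by
  constructor
  · rintro ⟨g, rfl, hg⟩
    refine ⟨dvd_mul_right _ _, ?_⟩
    rw [PowerSeries.coeff_X_pow_mul', if_pos le_rfl, Nat.sub_self, ← hg]
    simp
  · rintro ⟨⟨g, rfl⟩, hp⟩
    refine ⟨g, rfl, ?_⟩
    rw [PowerSeries.coeff_X_pow_mul', if_pos le_rfl, Nat.sub_self] at hp
    simpa using hp

theorem Lead.add {m : ℕ} {f g : PowerSeries R} {p r : R} (hf : Lead m f p) (hg : Lead m g r) :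
    Lead m (f + g) (p + r) := by
  obtain ⟨f', rfl, rfl⟩ := hf
  obtain ⟨g', rfl, rfl⟩ := hg
  exact ⟨f' + g', by ring, by simp⟩

theorem Lead.neg {m : ℕ} {f : PowerSeries R} {p : R} (hf : Lead m f p) : Lead m (-f) (-p) := by
  obtain ⟨f', rfl, rfl⟩ := hf
  exact ⟨-f', by ring, by simp⟩

theorem Lead.sub {m : ℕ} {f g : PowerSeries R} {p r : R} (hf : Lead m f p) (hg : Lead m g r) :
    Lead m (f - g) (p - r) := by
  rw [sub_eq_add_neg, sub_eq_add_neg]; exact hf.add hg.neg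

theorem Lead.mul {m l : ℕ} {f g : PowerSeries R} {p r : R} (hf : Lead m f p) (hg : Lead l g r) :
    Lead (m + l) (f * g) (p * r) := by
  obtain ⟨f', rfl, rfl⟩ := hf
  obtain ⟨g', rfl, rfl⟩ := hg
  exact ⟨f' * g', by ring, by simp⟩

theorem lead_zero (m : ℕ) : Lead m (0 : PowerSeries R) 0 := ⟨0, by simp, by simp⟩

theorem lead_one : Lead 0 (1 : PowerSeries R) 1 := ⟨1, by simp, by simp⟩

theorem lead_const (f : PowerSeries R) : Lead 0 f (PowerSeries.constantCoeff f) :=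
  ⟨f, by simp, rfl⟩

theorem Lead.sum {ι : Type*} {m : ℕ} (s : Finset ι) {f : ι → PowerSeries R} {p : ι → R}
    (h : ∀ i ∈ s, Lead m (f i) (p i)) : Lead m (∑ i ∈ s, f i) (∑ i ∈ s, p i) := by
  induction s using Finset.cons_induction with
  | empty => simpa using lead_zero m
  | cons a s ha ih =>
    rw [Finset.sum_cons, Finset.sum_cons]
    exact (h a (by simp)).add (ih fun i hi => h i (by simp [hi]))

theorem Lead.uniq {m : ℕ} {f : PowerSeries R} {p r : R} (h : Lead m f p) (h' : Lead m f r) :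
    p = r := (lead_iff.1 h).2.symm.trans (lead_iff.1 h').2

theorem Lead.dvd {m : ℕ} {f : PowerSeries R} {p : R} (h : Lead m f p) : PowerSeries.X ^ m ∣ f :=
  (lead_iff.1 h).1

theorem Lead.drop {m l : ℕ} {f : PowerSeries R} {p : R} (h : Lead m f p) (hl : l < m) :
    Lead l f 0 := by
  obtain ⟨g, rfl, rfl⟩ := h
  refine ⟨PowerSeries.X ^ (m - l) * g, ?_, ?_⟩
  · rw [← mul_assoc, ← pow_add, Nat.add_sub_cancel' hl.le]
  · rw [map_mul, map_pow, PowerSeries.constantCoeff_X, zero_pow (by omega), zero_mul]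

theorem lead_of_dvd {m l : ℕ} {f : PowerSeries R} (h : PowerSeries.X ^ m ∣ f) (hl : l < m) :
    Lead l f 0 := by
  obtain ⟨g, rfl⟩ := h
  exact Lead.drop ⟨g, rfl, rfl⟩ hl

theorem lead_zero_iff {m : ℕ} {f : PowerSeries R} :
    Lead m f 0 ↔ PowerSeries.X ^ (m + 1) ∣ f := by
  constructor
  · rintro ⟨g, rfl, hg⟩
    obtain ⟨g', rfl⟩ := PowerSeries.X_dvd_iff.2 hg
    exact ⟨g', by ring⟩
  · intro h; exact lead_of_dvd h (by omega)

theorem Lead.dvd_succ {m : ℕ} {f : PowerSeries R} (h : Lead m f 0) :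
    PowerSeries.X ^ (m + 1) ∣ f := lead_zero_iff.1 h

theorem dvd_of_le {m l : ℕ} {f : PowerSeries R} (h : PowerSeries.X ^ m ∣ f) (hl : l ≤ m) :
    PowerSeries.X ^ l ∣ f := (pow_dvd_pow _ hl).trans h

theorem Lead.cancel [IsDomain R] {a m : ℕ} {f g : PowerSeries R} {p : R} (h : Lead a f p)
    (hp : p ≠ 0) (hd : PowerSeries.X ^ (a + m) ∣ f * g) : PowerSeries.X ^ m ∣ g := by
  obtain ⟨f', rfl, rfl⟩ := h
  have h1 : (PowerSeries.X : PowerSeries R) ^ m ∣ f' * g := by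
    rw [pow_add, mul_assoc] at hd
    exact (mul_dvd_mul_iff_left (pow_ne_zero _ PowerSeries.X_ne_zero)).1 hd
  refine Prime.pow_dvd_of_dvd_mul_left PowerSeries.X_prime m ?_ h1
  rw [PowerSeries.X_dvd_iff]
  exact hp

theorem lead_ev {n q : ℕ} {a : ℕ} {c : Fin q → ℕ} {w : Idx n q → PowerSeries R} {w0 : Idx n q → R}
    {α : Fin q → Fin n → PowerSeries R} {α0 : Fin q → Fin n → R}
    (hw : ∀ I, Lead a (w I) (w0 I)) (hα : ∀ s k, Lead (c s) (α s k) (α0 s k)) :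
    Lead (a + ∑ s, c s) (ev w α) (ev w0 α0) := by
  choose w' hw1 hw2 using hw
  choose α' hα1 hα2 using hα
  refine ⟨ev w' α', ?_, ?_⟩
  · have e1 : ∀ β, ev w β = PowerSeries.X ^ a * ev w' β := by
      intro β
      simp only [ev_apply, hw1, Finset.mul_sum]
      refine Finset.sum_congr rfl fun I _ => ?_
      ring
    have e2 : α = fun s => (PowerSeries.X ^ (c s) : PowerSeries R) • α' s := by
      funext s k; rw [hα1]; rfl
    have e3 : ev w' α = (∏ s, (PowerSeries.X : PowerSeries R) ^ c s) * ev w' α' := by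
      rw [e2]
      exact (ev w').map_smul_univ (fun s => (PowerSeries.X : PowerSeries R) ^ c s) α'
    rw [e1, e3, Finset.prod_pow_eq_pow_sum, pow_add, mul_assoc]
  · rw [map_ev]
    simp only [hw2, hα2]

end LeadCalculus

end NambuLin

namespace NambuLin

section Taylor

variable {n N : ℕ} (τ : Fin N → Fin n)

/-- Transversal homogeneous Taylor terms with coefficients in `Sm n`. -/
noncomputable def symR : ℕ → Sm n → MvPolynomial (Fin N) (Sm n)
  | 0, F => MvPolynomial.C F
  | m + 1, F => MvPolynomial.C (algebraMap ℝ (Sm n) (1 / ((m : ℝ) + 1))) *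
      ∑ i, MvPolynomial.X i * symR m (pd (τ i) F)

/-- Taylor term at the point `s`. -/
noncomputable def sy (s : Fin n → ℝ) (m : ℕ) (F : Sm n) : MvPolynomial (Fin N) ℝ :=
  MvPolynomial.map (evz s).toRingHom (symR τ m F)

theorem sy_zero (s : Fin n → ℝ) (F : Sm n) : sy τ s 0 F = MvPolynomial.C (F s) := by
  rw [sy, symR, MvPolynomial.map_C]; rfl

theorem sy_succ (s : Fin n → ℝ) (m : ℕ) (F : Sm n) : sy τ s (m + 1) F =
    MvPolynomial.C (1 / ((m : ℝ) + 1)) * ∑ i, MvPolynomial.X i * sy τ s m (pd (τ i) F) := by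
  rw [sy, symR, map_mul, map_sum, MvPolynomial.map_C]
  congr 1
  refine Finset.sum_congr rfl fun i _ => ?_
  rw [map_mul, MvPolynomial.map_X]; rfl

theorem sy_succ' (s : Fin n → ℝ) (m : ℕ) (F : Sm n) : sy τ s (m + 1) F * ((m : MvPolynomial (Fin N) ℝ) + 1) =
    ∑ i, MvPolynomial.X i * sy τ s m (pd (τ i) F) := by
  rw [sy_succ]
  have h : (MvPolynomial.C (1 / ((m : ℝ) + 1)) : MvPolynomial (Fin N) ℝ) * ((m : MvPolynomial (Fin N) ℝ) + 1) = 1 := by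
    have : ((m : MvPolynomial (Fin N) ℝ) + 1) = MvPolynomial.C ((m : ℝ) + 1) := by simp
    rw [this, ← map_mul]
    have : ((m : ℝ) + 1) ≠ 0 := by positivity
    rw [one_div_mul_cancel this, map_one]
  linear_combination (∑ i, MvPolynomial.X i * sy τ s m (pd (τ i) F)) * h

theorem sy_add (s : Fin n → ℝ) (m : ℕ) : ∀ (F G : Sm n), sy τ s m (F + G) = sy τ s m F + sy τ s m G := by
  induction m with
  | zero => intro F G; simp [sy_zero]
  | succ m ih =>
    intro F G
    simp only [sy_succ, map_add, ih, mul_add, Finset.sum_add_distrib]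

theorem sy_congr (s : Fin n → ℝ) (m : ℕ) : ∀ (F G : Sm n),
    ((F : (Fin n → ℝ) → ℝ) =ᶠ[nhds s] G) → sy τ s m F = sy τ s m G := by
  induction m with
  | zero => intro F G h; rw [sy_zero, sy_zero, h.self_of_nhds]
  | succ m ih =>
    intro F G h
    rw [sy_succ, sy_succ]
    congr 1
    refine Finset.sum_congr rfl fun i _ => ?_
    rw [ih (pd (τ i) F) (pd (τ i) G)]
    filter_upwards [h.eventuallyEq_nhds] with z hz
    exact pd_congr _ hz

/-- Taylor series as a function. -/
noncomputable def Tf (s : Fin n → ℝ) (F : Sm n) : PowerSeries (MvPolynomial (Fin N) ℝ) :=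
  PowerSeries.mk fun m => sy τ s m F

theorem coeff_Tf (s : Fin n → ℝ) (F : Sm n) (m : ℕ) :
    PowerSeries.coeff m (Tf τ s F) = sy τ s m F := PowerSeries.coeff_mk _ _

theorem Tf_add (s : Fin n → ℝ) (F G : Sm n) : Tf τ s (F + G) = Tf τ s F + Tf τ s G := by
  ext1 m; simp only [map_add, coeff_Tf, sy_add]

theorem deriv_Tf (s : Fin n → ℝ) (F : Sm n) :
    PowerSeries.derivative _ (Tf τ s F) =
      ∑ i, PowerSeries.C (MvPolynomial.X i) * Tf τ s (pd (τ i) F) := by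
  ext1 m
  rw [PowerSeries.coeff_derivative, coeff_Tf, sy_succ', map_sum]
  refine Finset.sum_congr rfl fun i _ => ?_
  rw [PowerSeries.coeff_C_mul, coeff_Tf]

theorem Tf_mul_coeff (s : Fin n → ℝ) (m : ℕ) : ∀ F G : Sm n,
    PowerSeries.coeff m (Tf τ s (F * G)) = PowerSeries.coeff m (Tf τ s F * Tf τ s G) := by
  induction m with
  | zero =>
    intro F G
    rw [PowerSeries.coeff_mul]
    simp [coeff_Tf, sy_zero]
  | succ m ih =>
    intro F G
    have h0 : ((m : MvPolynomial (Fin N) ℝ) + 1) ≠ 0 := by exact_mod_cast Nat.succ_ne_zero m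
    apply mul_right_cancel₀ h0
    rw [← PowerSeries.coeff_derivative, ← PowerSeries.coeff_derivative, deriv_Tf, Derivation.leibniz,
      deriv_Tf, deriv_Tf, smul_eq_mul, smul_eq_mul, Finset.mul_sum, Finset.mul_sum,
      ← Finset.sum_add_distrib, map_sum, map_sum]
    refine Finset.sum_congr rfl fun i _ => ?_
    rw [pd_mul, PowerSeries.coeff_C_mul, Tf_add, map_add, ih, ih, ← map_add, ← PowerSeries.coeff_C_mul]
    congr 1
    ring

/-- Taylor series as a ring homomorphism. -/
noncomputable def TT (s : Fin n → ℝ) : Sm n →+* PowerSeries (MvPolynomial (Fin N) ℝ) where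
  toFun := Tf τ s
  map_add' := Tf_add τ s
  map_mul' F G := by ext1 m; exact Tf_mul_coeff τ s m F G
  map_zero' := by
    have := Tf_add τ s 0 0
    simpa using this
  map_one' := by
    ext1 m
    rw [coeff_Tf]
    cases m with
    | zero => simp [sy_zero]
    | succ m =>
      have h : ∀ m, sy τ s m (0 : Sm n) = 0 := by
        intro m
        have := sy_add τ s m 0 0
        simpa using this
      rw [sy_succ]
      simp [pd_one, h, PowerSeries.coeff_one]

theorem coeff_TT (s : Fin n → ℝ) (F : Sm n) (m : ℕ) :
    PowerSeries.coeff m (TT τ s F) = sy τ s m F := coeff_Tf τ s F m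

theorem sy_zero_fun (s : Fin n → ℝ) (m : ℕ) : sy τ s m (0 : Sm n) = 0 := by
  rw [← coeff_TT]; simp

theorem TT_congr {s : Fin n → ℝ} {F G : Sm n} (h : (F : (Fin n → ℝ) → ℝ) =ᶠ[nhds s] G) :
    TT τ s F = TT τ s G := by
  ext1 m; rw [coeff_TT, coeff_TT, sy_congr τ s m F G h]

theorem TT_const {s : Fin n → ℝ} {F : Sm n} (h : ∀ i, pd (τ i) F = 0) :
    TT τ s F = PowerSeries.C (MvPolynomial.C (F s)) := by
  ext1 m
  rw [coeff_TT]
  cases m with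
  | zero => simp [sy_zero]
  | succ m => rw [sy_succ]; simp [h, sy_zero_fun]

theorem TT_smul {s : Fin n → ℝ} (c : ℝ) (F : Sm n) :
    TT τ s (c • F) = PowerSeries.C (MvPolynomial.C c) * TT τ s F := by
  rw [Algebra.smul_def, map_mul, TT_const τ (fun i => pd_algebraMap _ _)]
  rfl

theorem sy_smul {s : Fin n → ℝ} (c : ℝ) (F : Sm n) (m : ℕ) :
    sy τ s m (c • F) = MvPolynomial.C c * sy τ s m F := by
  rw [← coeff_TT, TT_smul, PowerSeries.coeff_C_mul, coeff_TT]

theorem pderiv_sy (s : Fin n → ℝ) (j : Fin N) (m : ℕ) : ∀ F : Sm n,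
    MvPolynomial.pderiv j (sy τ s (m + 1) F) = sy τ s m (pd (τ j) F) := by
  induction m with
  | zero =>
    intro F
    rw [sy_succ]
    simp only [sy_zero, Derivation.leibniz, MvPolynomial.pderiv_C, map_sum, MvPolynomial.pderiv_X,
      smul_eq_mul, mul_zero, zero_add]
    rw [Finset.sum_eq_single j]
    · simp
    · intro i _ hi; simp [Pi.single_apply, hi]
    · simp
  | succ m ih =>
    intro F
    have h0 : (((m + 1 : ℕ) : MvPolynomial (Fin N) ℝ) + 1) ≠ 0 := by exact_mod_cast Nat.succ_ne_zero (m+1)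
    apply mul_right_cancel₀ h0
    have h1 := congrArg (MvPolynomial.pderiv j) (sy_succ' τ s (m + 1) F)
    rw [Derivation.leibniz, map_add, Derivation.map_one_eq_zero, Derivation.map_natCast, map_sum] at h1
    simp only [Derivation.leibniz, MvPolynomial.pderiv_X, ih, smul_eq_mul, Finset.sum_add_distrib] at h1
    have h2 : ∑ i, sy τ s (m + 1) (pd (τ i) F) * (Pi.single (M := fun _ => MvPolynomial (Fin N) ℝ) j 1 i) =
        sy τ s (m + 1) (pd (τ j) F) := by
      rw [Finset.sum_eq_single j]
      · simp
      · intro i _ hi; simp [hi]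
      · simp
    have h3 : ∑ i, MvPolynomial.X i * sy τ s m (pd (τ j) (pd (τ i) F)) =
        sy τ s (m + 1) (pd (τ j) F) * ((m : MvPolynomial (Fin N) ℝ) + 1) := by
      rw [sy_succ']
      exact Finset.sum_congr rfl fun i _ => by rw [pd_comm]
    rw [h3] at h1
    push_cast at h1 ⊢
    linear_combination h1 + h2

theorem sy_homog (s : Fin n → ℝ) (m : ℕ) : ∀ F : Sm n, (sy τ s m F).IsHomogeneous m := by
  induction m with
  | zero => intro F; rw [sy_zero]; exact MvPolynomial.isHomogeneous_C _ _
  | succ m ih =>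
    intro F
    rw [sy_succ]
    have : m + 1 = 0 + (1 + m) := by omega
    rw [this]
    refine (MvPolynomial.isHomogeneous_C _ _).mul ?_
    exact MvPolynomial.IsHomogeneous.sum _ _ _ fun i _ => (MvPolynomial.isHomogeneous_X _ _).mul (ih _)

theorem coeff_symR (s : Fin n → ℝ) (m : ℕ) (F : Sm n) (d : Fin N →₀ ℕ) :
    (sy τ s m F).coeff d = ((symR τ m F).coeff d) s := by
  rw [sy, MvPolynomial.coeff_map]; rfl

theorem coeff_symR_pd (a : Fin n) (m : ℕ) : ∀ (F : Sm n) (d : Fin N →₀ ℕ),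
    (symR τ m (pd a F)).coeff d = pd a ((symR τ m F).coeff d) := by
  induction m with
  | zero =>
    intro F d
    simp only [symR, MvPolynomial.coeff_C]
    split_ifs <;> simp
  | succ m ih =>
    intro F d
    simp only [symR, MvPolynomial.coeff_C_mul, MvPolynomial.coeff_sum, MvPolynomial.coeff_X_mul']
    rw [pd_mul, pd_algebraMap, zero_mul, zero_add, map_sum]
    congr 1
    refine Finset.sum_congr rfl fun i _ => ?_
    split_ifs
    · rw [← ih, pd_comm]
    · simp

theorem lead_pd {s : Fin n → ℝ} {m : ℕ} {F : Sm n} {p : MvPolynomial (Fin N) ℝ} (j : Fin N)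
    (h : Lead (m + 1) (TT τ s F) p) :
    Lead m (TT τ s (pd (τ j) F)) (MvPolynomial.pderiv j p) := by
  rw [lead_iff] at h ⊢
  refine ⟨?_, ?_⟩
  · rw [PowerSeries.X_pow_dvd_iff] at h ⊢
    intro l hl
    rw [coeff_TT, ← pderiv_sy, ← coeff_TT, h.1 (l + 1) (by omega), map_zero]
  · rw [coeff_TT, ← pderiv_sy, ← coeff_TT, h.2]

theorem lead_homog {s : Fin n → ℝ} {m : ℕ} {F : Sm n} {p : MvPolynomial (Fin N) ℝ}
    (h : Lead m (TT τ s F) p) : p.IsHomogeneous m := by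
  rw [lead_iff, coeff_TT] at h
  rw [← h.2]; exact sy_homog τ s m F

/-- lead term of order zero is the value -/
theorem lead_val (s : Fin n → ℝ) (F : Sm n) : Lead 0 (TT τ s F) (MvPolynomial.C (F s)) := by
  rw [lead_iff, coeff_TT, sy_zero]; simp

theorem TT_co_top (hτ : Function.Injective τ) (s : Fin n → ℝ) (j : Fin N) :
    TT τ s (co (τ j)) = PowerSeries.C (MvPolynomial.C (s (τ j))) +
      PowerSeries.X * PowerSeries.C (MvPolynomial.X j) := by
  ext1 m
  rw [coeff_TT]
  cases m with
  | zero => simp [sy_zero]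
  | succ m =>
    rw [sy_succ]
    simp only [pd_co, hτ.eq_iff]
    rw [map_add, PowerSeries.coeff_succ_X_mul, PowerSeries.coeff_C, PowerSeries.coeff_C]
    cases m with
    | zero =>
      rw [Finset.sum_eq_single j]
      · simp [sy_zero]
      · intro i _ hi; simp [hi, sy_zero]
      · simp
    | succ m =>
      have : ∀ i, sy τ s (m + 1) (if i = j then 1 else 0) = 0 := by
        intro i
        rw [← coeff_TT]
        split_ifs
        · simp [PowerSeries.coeff_one]
        · simp
      simp [this]

theorem TT_co_other (s : Fin n → ℝ) (a : Fin n) (ha : ∀ j, τ j ≠ a) :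
    TT τ s (co a) = PowerSeries.C (MvPolynomial.C (s a)) := by
  rw [TT_const]
  · rfl
  · intro i; rw [pd_co, if_neg (ha i)]

/-- the singular set -/
def SS : Set (Fin n → ℝ) := {s | ∀ j, s (τ j) = 0}

/-- Vanishing order at least `m` along `SS ∩ V`. -/
def VO (V : Set (Fin n → ℝ)) (m : ℕ) (F : Sm n) : Prop :=
  ∀ s ∈ V, s ∈ SS τ → PowerSeries.X ^ m ∣ TT τ s F

/-- Derivative in the direction of the singular set does not lower the order. -/
theorem VO.pd_other {V : Set (Fin n → ℝ)} (hV : IsOpen V) {m : ℕ} {F : Sm n} (h : VO τ V m F)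
    (a : Fin n) (ha : ∀ j, τ j ≠ a) : VO τ V m (pd a F) := by
  intro s hs hsS
  rw [PowerSeries.X_pow_dvd_iff]
  intro l hl
  rw [coeff_TT]
  ext d
  rw [coeff_symR, coeff_symR_pd, MvPolynomial.coeff_zero, pd_apply]
  set G := (symR τ l F).coeff d
  have hG : ∀ s ∈ V, s ∈ SS τ → G s = 0 := by
    intro s hs hsS
    have h1 := (PowerSeries.X_pow_dvd_iff.1 (h s hs hsS)) l hl
    rw [coeff_TT] at h1
    rw [← coeff_symR, h1, MvPolynomial.coeff_zero]
  have hline : HasDerivAt (fun t : ℝ => s + t • (Pi.single a (1 : ℝ) : Fin n → ℝ))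
      (Pi.single a (1 : ℝ)) 0 := by
    have h1 := ((hasDerivAt_id (0 : ℝ)).smul_const (Pi.single a (1 : ℝ) : Fin n → ℝ)).const_add s
    simpa using h1
  have h2 : HasDerivAt (fun t : ℝ => G (s + t • (Pi.single a (1 : ℝ) : Fin n → ℝ)))
      (fderiv ℝ (G : (Fin n → ℝ) → ℝ) s (Pi.single a 1)) 0 := by
    have h3 : HasFDerivAt (G : (Fin n → ℝ) → ℝ) (fderiv ℝ (G : (Fin n → ℝ) → ℝ) s)
        (s + (0 : ℝ) • (Pi.single a (1 : ℝ) : Fin n → ℝ)) := by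
      rw [zero_smul, add_zero]; exact (Sm.diff G s).hasFDerivAt
    exact h3.comp_hasDerivAt (0 : ℝ) hline
  have h4 : (fun t : ℝ => G (s + t • (Pi.single a (1 : ℝ) : Fin n → ℝ))) =ᶠ[nhds 0] fun _ => 0 := by
    have hc : ContinuousAt (fun t : ℝ => s + t • (Pi.single a (1 : ℝ) : Fin n → ℝ)) 0 := hline.continuousAt
    have hVn : V ∈ nhds (s + (0 : ℝ) • (Pi.single a (1 : ℝ) : Fin n → ℝ)) := by
      rw [zero_smul, add_zero]; exact hV.mem_nhds hs
    filter_upwards [hc hVn] with t ht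
    apply hG _ ht
    intro j
    have := hsS j
    simp [this, Pi.single_apply, ha j]
  have h5 := h2.congr_of_eventuallyEq h4.symm
  exact h5.unique (hasDerivAt_const _ _)

end Taylor

end NambuLin

namespace NambuLin

section PolyAlgebra

variable {N : ℕ}

/-- Koszul contraction. -/
theorem koszul_gen {A : Type*} [CommRing A] [Algebra ℝ A] (D : Fin N → Derivation ℝ A A) (f : Fin N → A)
    (hD : ∀ i j, D i (f j) = if i = j then 1 else 0) (m : ℝ) (g : Fin N → Fin N → A)
    (hE : ∀ j k, ∑ i, f i * D i (g j k) = algebraMap ℝ A m * g j k)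
    (ha : ∀ j k, g j k = - g k j)
    (hc : ∀ i j k, f i * g j k + f j * g k i + f k * g i j = 0) (j k : Fin N) :
    algebraMap ℝ A (N + m - 2) * g j k = f j * ∑ i, D i (g i k) - f k * ∑ i, D i (g i j) := by
  have h : ∑ i, D i (f i * g j k + f j * g k i + f k * g i j) = 0 := by
    simp [hc]
  simp only [map_add, Derivation.leibniz, hD, smul_eq_mul, Finset.sum_add_distrib, if_true,
    mul_ite, mul_one, mul_zero, Finset.sum_ite_eq', Finset.sum_ite_eq, Finset.mem_univ,
    Finset.sum_const, Finset.card_univ, Fintype.card_fin, nsmul_eq_mul] at h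
  rw [hE] at h
  have h2 : ∑ i, f j * D i (g k i) = - (f j * ∑ i, D i (g i k)) := by
    rw [Finset.mul_sum, ← Finset.sum_neg_distrib]
    refine Finset.sum_congr rfl fun i _ => ?_
    rw [ha k i, map_neg, mul_neg]
  have h3 : ∑ i, f k * D i (g i j) = f k * ∑ i, D i (g i j) := by rw [Finset.mul_sum]
  rw [h2, h3, ha k j] at h
  simp only [map_sub, map_add, map_natCast, map_ofNat]
  linear_combination h

open MvPolynomial

variable (ε : Fin N → ℝ)

/-- The linear forms `ε_i x_i`. -/
noncomputable def fl (i : Fin N) : MvPolynomial (Fin N) ℝ := C (ε i) * X i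

theorem fl_homog (i : Fin N) : (fl ε i).IsHomogeneous 1 := by
  have := (isHomogeneous_C (Fin N) (ε i)).mul (isHomogeneous_X ℝ i)
  simpa [fl] using this

theorem pd_fl (i j : Fin N) : pderiv i (fl ε j) = if i = j then C (ε i) else 0 := by
  simp only [fl, pderiv_C_mul, pderiv_X]
  split_ifs with h
  · subst h; simp [smul_eq_C_mul]
  · simp [Pi.single_apply, Ne.symm h]

theorem homog_of_eq {a b : ℕ} {p : MvPolynomial (Fin N) ℝ} (h : p.IsHomogeneous a) (e : a = b) :
    p.IsHomogeneous b := e ▸ h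

theorem homog_C_mul {a : ℕ} {p : MvPolynomial (Fin N) ℝ} (h : p.IsHomogeneous a) (c : ℝ) :
    (C c * p).IsHomogeneous a := by
  have := (isHomogeneous_C (Fin N) c).mul h
  simpa using this

theorem homog_neg {a : ℕ} {p : MvPolynomial (Fin N) ℝ} (h : p.IsHomogeneous a) :
    (-p).IsHomogeneous a := by
  have := homog_C_mul h (-1)
  simpa using this

theorem homog_sub {a : ℕ} {p r : MvPolynomial (Fin N) ℝ} (h : p.IsHomogeneous a)
    (h' : r.IsHomogeneous a) : (p - r).IsHomogeneous a := by
  rw [sub_eq_add_neg]; exact h.add (homog_neg h')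

theorem pderiv_homog_zero {p : MvPolynomial (Fin N) ℝ} (h : p.IsHomogeneous 0) (i : Fin N) :
    pderiv i p = 0 := by
  rw [← totalDegree_zero_iff_isHomogeneous, totalDegree_eq_zero_iff_eq_C] at h
  rw [h, pderiv_C]

theorem pderiv_comm' (i j : Fin N) (p : MvPolynomial (Fin N) ℝ) :
    pderiv i (pderiv j p) = pderiv j (pderiv i p) := by
  induction p using MvPolynomial.induction_on with
  | C a => simp
  | add p r hp hr => simp [hp, hr]
  | mul_X p l hp =>
    simp only [Derivation.leibniz, smul_eq_mul, map_add, pderiv_X, hp]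
    have h1 : ∀ a b : Fin N, pderiv a (Pi.single (M := fun _ => MvPolynomial (Fin N) ℝ) b 1 l) = 0 := by
      intro a b
      by_cases hb : l = b
      · subst hb; simp
      · simp [hb]
    rw [h1, h1]; ring

theorem euler {m : ℕ} {p : MvPolynomial (Fin N) ℝ} (h : p.IsHomogeneous m) :
    ∑ i, X i * pderiv i p = C (m : ℝ) * p := by
  rw [h.sum_X_mul_pderiv, nsmul_eq_mul]; simp

/-- Koszul with the standard forms. -/
theorem koszul (hε : ∀ i, ε i * ε i = 1) (hN : 3 ≤ N) {m : ℕ} (g : Fin N → Fin N → MvPolynomial (Fin N) ℝ)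
    (hg : ∀ j k, (g j k).IsHomogeneous m) (ha : ∀ j k, g j k = - g k j)
    (hc : ∀ i j k, fl ε i * g j k + fl ε j * g k i + fl ε k * g i j = 0) :
    ∃ γ : Fin N → MvPolynomial (Fin N) ℝ, (∀ k, (γ k).IsHomogeneous (m - 1)) ∧
      (m = 0 → ∀ k, γ k = 0) ∧ ∀ j k, g j k = fl ε j * γ k - fl ε k * γ j := by
  have hc0 : ((N : ℝ) + m - 2) ≠ 0 := by
    have : (3 : ℝ) ≤ N := by exact_mod_cast hN
    have : (0 : ℝ) ≤ m := by positivity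
    linarith
  refine ⟨fun k => C (((N : ℝ) + m - 2)⁻¹) * ∑ i, C (ε i) * pderiv i (g i k), ?_, ?_, ?_⟩
  · intro k
    refine homog_C_mul (IsHomogeneous.sum _ _ _ fun i _ => homog_C_mul (hg i k).pderiv _) _
  · rintro rfl k
    simp [pderiv_homog_zero (hg _ _)]
  · intro j k
    have h := koszul_gen (fun i => C (ε i) • (pderiv i : Derivation ℝ (MvPolynomial (Fin N) ℝ) (MvPolynomial (Fin N) ℝ)))
      (fl ε) (by
        intro i j
        rw [Derivation.smul_apply, pd_fl, smul_eq_mul]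
        split_ifs
        · rw [← map_mul, hε, map_one]
        · simp) (m : ℝ) g (by
        intro j k
        have := euler (hg j k)
        rw [show algebraMap ℝ (MvPolynomial (Fin N) ℝ) m = C (m : ℝ) from rfl, ← this]
        refine Finset.sum_congr rfl fun i _ => ?_
        rw [Derivation.smul_apply, smul_eq_mul, fl]
        have : (C (ε i) : MvPolynomial (Fin N) ℝ) * C (ε i) = 1 := by rw [← map_mul, hε, map_one]
        linear_combination (X i * pderiv i (g j k)) * this) ha hc j k
    simp only [Derivation.smul_apply, smul_eq_mul] at h
    have hcc : (C (((N : ℝ) + m - 2)⁻¹) : MvPolynomial (Fin N) ℝ) * C ((N : ℝ) + m - 2) = 1 := by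
      rw [← map_mul, inv_mul_cancel₀ hc0, map_one]
    rw [show algebraMap ℝ (MvPolynomial (Fin N) ℝ) ((N : ℝ) + m - 2) = C ((N : ℝ) + m - 2) from rfl] at h
    linear_combination (-g j k) * hcc + (C (((N : ℝ) + m - 2)⁻¹) : MvPolynomial (Fin N) ℝ) * h

/-- Poincaré lemma. -/
theorem poincare {d : ℕ} (b : Fin N → MvPolynomial (Fin N) ℝ) (hb : ∀ i, (b i).IsHomogeneous d)
    (hcl : ∀ i j, pderiv i (b j) = pderiv j (b i)) :
    ∃ G : MvPolynomial (Fin N) ℝ, G.IsHomogeneous (d + 1) ∧ ∀ i, b i = pderiv i G := by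
  have hc0 : ((d : ℝ) + 1) ≠ 0 := by positivity
  refine ⟨C ((d : ℝ) + 1)⁻¹ * ∑ j, X j * b j, ?_, ?_⟩
  · refine homog_C_mul (IsHomogeneous.sum _ _ _ fun j _ => ?_) _
    exact homog_of_eq ((isHomogeneous_X ℝ j).mul (hb j)) (by omega)
  · intro i
    rw [pderiv_C_mul, map_sum]
    simp only [Derivation.leibniz, pderiv_X, smul_eq_mul, Finset.sum_add_distrib]
    have h1 : ∑ j, X j * pderiv i (b j) = C (d : ℝ) * b i := by
      rw [← euler (hb i)]
      exact Finset.sum_congr rfl fun j _ => by rw [hcl]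
    have h2 : ∑ j, b j * (Pi.single (M := fun _ => MvPolynomial (Fin N) ℝ) i 1 j) = b i := by
      rw [Finset.sum_eq_single i]
      · simp
      · intro j _ hj; simp [hj]
      · simp
    rw [h1, h2]
    have hcc : (C (((d : ℝ) + 1)⁻¹) : MvPolynomial (Fin N) ℝ) * C ((d : ℝ) + 1) = 1 := by
      rw [← map_mul, inv_mul_cancel₀ hc0, map_one]
    rw [map_add, map_one] at hcc
    linear_combination (-b i) * hcc

/-- Lemma 2. -/
theorem lemma2 (hε : ∀ i, ε i * ε i = 1) (hN : 3 ≤ N) (d : ℕ) :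
    ∀ (a : Fin N → MvPolynomial (Fin N) ℝ), (∀ i, (a i).IsHomogeneous d) →
    (∀ i j k, fl ε i * (pderiv j (a k) - pderiv k (a j)) + fl ε j * (pderiv k (a i) - pderiv i (a k)) +
      fl ε k * (pderiv i (a j) - pderiv j (a i)) = 0) →
    ∃ G h : MvPolynomial (Fin N) ℝ, G.IsHomogeneous (d + 1) ∧ h.IsHomogeneous (d - 1) ∧
      ∀ i, a i = pderiv i G + h * fl ε i := by
  induction d using Nat.strong_induction_on with
  | _ d ih =>
  intro a ha hc
  obtain ⟨γ, hγ, hγ0, hω⟩ := koszul ε hε hN (m := d - 1) (fun j k => pderiv j (a k) - pderiv k (a j))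
    (fun j k => homog_sub (ha k).pderiv (ha j).pderiv) (fun j k => by ring) hc
  by_cases hd : d ≤ 1
  · have hz := hγ0 (by omega)
    obtain ⟨G, hG, hG'⟩ := poincare a ha (fun i j => by
      have := hω i j
      rw [hz, hz] at this
      linear_combination this)
    exact ⟨G, 0, hG, isHomogeneous_zero _ _ _, fun i => by rw [hG' i]; ring⟩
  · push Not at hd
    have hsym : ∀ i j, pderiv i (fl ε j) = pderiv j (fl ε i) := by
      intro i j; rw [pd_fl, pd_fl]
      by_cases h : i = j
      · subst h; rfl
      · rw [if_neg h, if_neg (Ne.symm h)]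
    obtain ⟨G', h', hG', hh', hγ'⟩ := ih (d - 2) (by omega) γ
      (fun k => homog_of_eq (hγ k) (by omega)) (by
      intro i j k
      have e1 := congrArg (pderiv i) (hω j k)
      have e2 := congrArg (pderiv j) (hω k i)
      have e3 := congrArg (pderiv k) (hω i j)
      simp only [map_sub, Derivation.leibniz, smul_eq_mul] at e1 e2 e3
      rw [pderiv_comm' i j, pderiv_comm' i k] at e1
      rw [pderiv_comm' j k] at e2
      linear_combination e1 + e2 + e3 + γ k * hsym i j - γ j * hsym i k + γ i * hsym j k)
    obtain ⟨G, hG, hGG⟩ := poincare (fun k => a k + G' * fl ε k) (d := d) (fun k => (ha k).add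
      (homog_of_eq (hG'.mul (fl_homog ε k)) (by omega))) (by
      intro j k
      have := hω j k
      rw [hγ' k, hγ' j] at this
      simp only [map_add, Derivation.leibniz, smul_eq_mul]
      linear_combination this + G' * hsym j k)
    refine ⟨G, -G', hG, homog_neg (homog_of_eq hG' (by omega)), fun i => ?_⟩
    have := hGG i
    linear_combination this

/-- The operator `L`. -/
noncomputable def opL (ξ : Fin N → MvPolynomial (Fin N) ℝ) (j : Fin N) : MvPolynomial (Fin N) ℝ :=
  pderiv j (∑ i, fl ε i * ξ i) - (∑ i, pderiv i (ξ i)) * fl ε j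

theorem opL_add (ξ ζ : Fin N → MvPolynomial (Fin N) ℝ) (j : Fin N) :
    opL ε (fun i => ξ i + ζ i) j = opL ε ξ j + opL ε ζ j := by
  simp only [opL, mul_add, Finset.sum_add_distrib, map_add]
  ring

/-- quadratic form -/
noncomputable def QQ : MvPolynomial (Fin N) ℝ := C (1/2) * ∑ i, fl ε i * X i

theorem QQ_homog : (QQ ε).IsHomogeneous 2 :=
  homog_C_mul (IsHomogeneous.sum _ _ _ fun i _ => (fl_homog ε i).mul (isHomogeneous_X ℝ i)) _

theorem sum_single_mul (i : Fin N) (b : Fin N → MvPolynomial (Fin N) ℝ) :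
    ∑ j, b j * (Pi.single (M := fun _ => MvPolynomial (Fin N) ℝ) i 1 j) = b i := by
  rw [Finset.sum_eq_single i]
  · simp
  · intro j _ hj; simp [hj]
  · simp

theorem C_half_two : (C (1/2 : ℝ) : MvPolynomial (Fin N) ℝ) * 2 = 1 := by
  have : (2 : MvPolynomial (Fin N) ℝ) = C 2 := (map_ofNat C 2).symm
  rw [this, ← map_mul]; norm_num

theorem pderiv_QQ (j : Fin N) : pderiv j (QQ ε) = fl ε j := by
  rw [QQ, pderiv_C_mul, map_sum]
  simp only [Derivation.leibniz, pderiv_X, smul_eq_mul, Finset.sum_add_distrib, pd_fl]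
  rw [sum_single_mul]
  simp only [mul_ite, mul_zero, Finset.sum_ite_eq, Finset.mem_univ, if_true]
  rw [show X j * C (ε j) = fl ε j by rw [fl, mul_comm]]
  linear_combination fl ε j * C_half_two (N := N)

theorem opL_Q (ξ : Fin N → MvPolynomial (Fin N) ℝ) (j : Fin N) :
    opL ε (fun i => QQ ε * ξ i) j = QQ ε * opL ε ξ j := by
  have h1 : ∑ i, fl ε i * (QQ ε * ξ i) = QQ ε * ∑ i, fl ε i * ξ i := by
    rw [Finset.mul_sum]; exact Finset.sum_congr rfl fun i _ => by ring
  simp only [opL, h1, Derivation.leibniz, smul_eq_mul, pderiv_QQ, Finset.sum_add_distrib,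
    ← Finset.mul_sum]
  have h2 : ∑ i, ξ i * fl ε i = ∑ i, fl ε i * ξ i := Finset.sum_congr rfl fun i _ => mul_comm _ _
  rw [h2]; ring

theorem opL_C (c : ℝ) (ξ : Fin N → MvPolynomial (Fin N) ℝ) (j : Fin N) :
    opL ε (fun i => C c * ξ i) j = C c * opL ε ξ j := by
  have h1 : ∑ i, fl ε i * (C c * ξ i) = C c * ∑ i, fl ε i * ξ i := by
    rw [Finset.mul_sum]; exact Finset.sum_congr rfl fun i _ => by ring
  simp only [opL, h1, pderiv_C_mul, smul_eq_C_mul, ← Finset.mul_sum]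
  ring

/-- Laplacian -/
noncomputable def lap (h : MvPolynomial (Fin N) ℝ) : MvPolynomial (Fin N) ℝ :=
  ∑ i, C (ε i) * pderiv i (pderiv i h)

theorem fl_eps (hε : ∀ i, ε i * ε i = 1) (i : Fin N) : fl ε i * C (ε i) = X i := by
  have : (C (ε i) : MvPolynomial (Fin N) ℝ) * C (ε i) = 1 := by rw [← map_mul, hε, map_one]
  rw [fl]; linear_combination X i * this

/-- `L` on a gradient. -/
theorem opL_grad (hε : ∀ i, ε i * ε i = 1) {m : ℕ} {G : MvPolynomial (Fin N) ℝ} (hG : G.IsHomogeneous m)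
    (j : Fin N) : opL ε (fun i => C (ε i) * pderiv i G) j = C (m : ℝ) * pderiv j G - lap ε G * fl ε j := by
  have h1 : ∑ i, fl ε i * (C (ε i) * pderiv i G) = C (m : ℝ) * G := by
    rw [← euler hG]
    refine Finset.sum_congr rfl fun i _ => ?_
    rw [← mul_assoc, fl_eps ε hε]
  simp only [opL, h1, pderiv_C_mul, smul_eq_C_mul, lap]

/-- `L` on a radial field. -/
theorem opL_rad {d : ℕ} {h : MvPolynomial (Fin N) ℝ} (hh : h.IsHomogeneous d)
    (j : Fin N) : opL ε (fun i => h * X i) j =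
      2 * pderiv j (h * QQ ε) - C ((N : ℝ) + d) * h * fl ε j := by
  have h1 : ∑ i, fl ε i * (h * X i) = 2 * (h * QQ ε) := by
    have : ∑ i, fl ε i * (h * X i) = h * ∑ i, fl ε i * X i := by
      rw [Finset.mul_sum]; exact Finset.sum_congr rfl fun i _ => by ring
    rw [this, QQ]
    linear_combination (-h * ∑ i, fl ε i * X i) * C_half_two (N := N)
  have h2 : ∑ i, pderiv i (h * X i) = C ((N : ℝ) + d) * h := by
    simp only [Derivation.leibniz, smul_eq_mul, Finset.sum_add_distrib, pderiv_X_self, euler hh]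
    simp
    ring
  have h3 : pderiv j (2 * (h * QQ ε)) = 2 * pderiv j (h * QQ ε) := by
    have : (2 : MvPolynomial (Fin N) ℝ) = C 2 := (map_ofNat C 2).symm
    rw [this, pderiv_C_mul]
  rw [opL, h1, h2, h3]

theorem lemma3 (hε : ∀ i, ε i * ε i = 1) (hN : 3 ≤ N) (d : ℕ) :
    ∀ h : MvPolynomial (Fin N) ℝ, h.IsHomogeneous d →
    ∃ ξ : Fin N → MvPolynomial (Fin N) ℝ, (∀ i, (ξ i).IsHomogeneous (d + 1)) ∧
      ∀ j, opL ε ξ j = h * fl ε j := by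
  have hN' : (3 : ℝ) ≤ N := by exact_mod_cast hN
  induction d using Nat.strong_induction_on with
  | _ d ih =>
  intro h hh
  by_cases hd0 : d = 0
  · subst hd0
    have hc0 : (2 - (N : ℝ)) ≠ 0 := by linarith
    refine ⟨fun i => C ((2 - (N : ℝ))⁻¹) * (h * X i), fun i => homog_C_mul (hh.mul (isHomogeneous_X ℝ i)) _,
      fun j => ?_⟩
    rw [opL_C, opL_rad ε hh, Derivation.leibniz, pderiv_homog_zero hh, pderiv_QQ]
    have hcc : (C ((2 - (N : ℝ))⁻¹) : MvPolynomial (Fin N) ℝ) * C (2 - (N : ℝ)) = 1 := by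
      rw [← map_mul, inv_mul_cancel₀ hc0, map_one]
    simp only [smul_eq_mul, Nat.cast_zero, add_zero, mul_zero, map_sub, map_ofNat] at hcc ⊢
    linear_combination h * fl ε j * hcc
  · -- the correction
    obtain ⟨ξ', hξ', hL'⟩ : ∃ ξ' : Fin N → MvPolynomial (Fin N) ℝ,
        (∀ i, (QQ ε * ξ' i).IsHomogeneous (d + 1)) ∧ ∀ j, opL ε ξ' j = lap ε h * fl ε j := by
      by_cases hd1 : d = 1
      · refine ⟨fun _ => 0, fun i => by rw [mul_zero]; exact isHomogeneous_zero _ _ _, fun j => ?_⟩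
        have : lap ε h = 0 := by
          refine Finset.sum_eq_zero fun i _ => ?_
          rw [pderiv_homog_zero (homog_of_eq hh.pderiv (by omega)), mul_zero]
        rw [this]; simp [opL]
      · obtain ⟨ξ', h1, h2⟩ := ih (d - 2) (by omega) (lap ε h) (IsHomogeneous.sum _ _ _ fun i _ =>
          homog_C_mul (homog_of_eq hh.pderiv.pderiv (by omega)) _)
        exact ⟨ξ', fun i => homog_of_eq ((QQ_homog ε).mul (h1 i)) (by omega), h2⟩
    have hd0' : (0 : ℝ) < d := by exact_mod_cast Nat.pos_of_ne_zero hd0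
    have hne : (d : ℝ) * (d + N - 2) ≠ 0 := by
      apply mul_ne_zero hd0'.ne'; linarith
    set b : ℝ := 2 / ((d : ℝ) * (d + N - 2)) with hb
    refine ⟨fun i => (C (-b * d / 2) * (h * X i) + C b * (QQ ε * (C (ε i) * pderiv i h))) +
      C b * (QQ ε * ξ' i), fun i => ?_, fun j => ?_⟩
    · refine ((homog_C_mul (hh.mul (isHomogeneous_X ℝ i)) _).add (homog_C_mul ?_ _)).add
        (homog_C_mul (hξ' i) _)
      exact homog_of_eq ((QQ_homog ε).mul (homog_C_mul (hh.pderiv (i := i)) _)) (by omega)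
    · rw [opL_add, opL_add, opL_C, opL_C, opL_C, opL_Q, opL_Q, hL', opL_grad ε hε hh, opL_rad ε hh,
        Derivation.leibniz, pderiv_QQ, smul_eq_mul, smul_eq_mul]
      have e1 : (C (-b * d / 2) : MvPolynomial (Fin N) ℝ) * 2 = - (C b * C (d : ℝ)) := by
        have : (2 : MvPolynomial (Fin N) ℝ) = C 2 := (map_ofNat C 2).symm
        rw [this, ← map_mul, ← map_mul, ← map_neg]; congr 1; ring
      have e2 : (C (-b * d / 2) : MvPolynomial (Fin N) ℝ) * (2 - C ((N : ℝ) + d)) = 1 := by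
        have : (2 : MvPolynomial (Fin N) ℝ) = C 2 := (map_ofNat C 2).symm
        rw [this, ← map_sub, ← map_mul, ← map_one C]; congr 1
        have h3 : (d:ℝ)+N-2 ≠ 0 := by linarith
        have h4 := hd0'.ne'
        rw [hb]; field_simp; ring
      linear_combination h * fl ε j * e2 + (QQ ε * pderiv j h) * e1

/-- Solvability of the linearized equation. -/
theorem solveL (hε : ∀ i, ε i * ε i = 1) (hN : 3 ≤ N) (m : ℕ) (hm : 1 ≤ m)
    (a : Fin N → MvPolynomial (Fin N) ℝ) (ha : ∀ i, (a i).IsHomogeneous m)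
    (hc : ∀ i j k, fl ε i * (pderiv j (a k) - pderiv k (a j)) + fl ε j * (pderiv k (a i) - pderiv i (a k)) +
      fl ε k * (pderiv i (a j) - pderiv j (a i)) = 0) :
    ∃ ξ : Fin N → MvPolynomial (Fin N) ℝ, (∀ i, (ξ i).IsHomogeneous m) ∧ ∀ j, opL ε ξ j = a j := by
  obtain ⟨G, h, hG, hh, hGh⟩ := lemma2 ε hε hN m a ha hc
  have hc0 : (((m + 1 : ℕ) : ℝ)) ≠ 0 := by positivity
  have hlap : (lap ε G).IsHomogeneous (m - 1) := IsHomogeneous.sum _ _ _ fun i _ =>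
    homog_C_mul (homog_of_eq hG.pderiv.pderiv (by omega)) _
  obtain ⟨ζ, hζ, hLζ⟩ := lemma3 ε hε hN (m - 1) (h + C (((m + 1 : ℕ) : ℝ)⁻¹) * lap ε G)
    (hh.add (homog_C_mul hlap _))
  refine ⟨fun i => C (((m + 1 : ℕ) : ℝ)⁻¹) * (C (ε i) * pderiv i G) + ζ i, fun i => ?_, fun j => ?_⟩
  · exact (homog_C_mul (homog_C_mul (homog_of_eq hG.pderiv (by omega)) _) _).add
      (homog_of_eq (hζ i) (by omega))
  · rw [opL_add, opL_C, opL_grad ε hε hG, hLζ, hGh]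
    have hcc : (C (((m + 1 : ℕ) : ℝ)⁻¹) : MvPolynomial (Fin N) ℝ) * C ((m + 1 : ℕ) : ℝ) = 1 := by
      rw [← map_mul, inv_mul_cancel₀ hc0, map_one]
    linear_combination pderiv j G * hcc

theorem fl_ne (hε : ∀ i, ε i * ε i = 1) (i : Fin N) : fl ε i ≠ 0 := by
  intro h
  have h1 := fl_eps ε hε i
  rw [h, zero_mul] at h1
  exact X_ne_zero i h1.symm

theorem solveH (hε : ∀ i, ε i * ε i = 1) (hN : 3 ≤ N) (m : ℕ) (hm : 1 ≤ m)
    (a : Fin N → MvPolynomial (Fin N) ℝ) (ha : ∀ i, (a i).IsHomogeneous m)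
    (hc : ∀ i j k, i ≠ j → i ≠ k → j ≠ k →
      fl ε i * (fl ε i * pderiv j (a k) - fl ε j * pderiv i (a k))
      - fl ε k * (fl ε i * pderiv j (a i) - fl ε j * pderiv i (a i))
      - fl ε i * (fl ε i * pderiv k (a j) - fl ε k * pderiv i (a j))
      + fl ε j * (fl ε i * pderiv k (a i) - fl ε k * pderiv i (a i)) = 0) :
    ∃ ξ : Fin N → MvPolynomial (Fin N) ℝ, (∀ i, (ξ i).IsHomogeneous m) ∧ ∀ j, opL ε ξ j = a j := by
  refine solveL ε hε hN m hm a ha fun i j k => ?_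
  by_cases hij : i = j
  · subst hij; ring
  by_cases hik : i = k
  · subst hik; ring
  by_cases hjk : j = k
  · subst hjk; ring
  apply mul_left_cancel₀ (fl_ne ε hε i)
  linear_combination hc i j k hij hik hjk

theorem solveG (hε : ∀ i, ε i * ε i = 1) (hN : 3 ≤ N) (m : ℕ) (hm : 1 ≤ m)
    (g : Fin N → Fin N → MvPolynomial (Fin N) ℝ) (hg : ∀ i j, (g i j).IsHomogeneous m)
    (ha : ∀ j k, g j k = - g k j)
    (hp : ∀ i j k, i ≠ j → i ≠ k → j ≠ k → fl ε i * g j k = fl ε j * g i k - fl ε k * g i j)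
    (hc : ∀ i j k, i ≠ j → i ≠ k → j ≠ k →
      - fl ε i * (fl ε i * pderiv j (g i k) - fl ε j * pderiv i (g i k))
      + fl ε i * (fl ε i * pderiv k (g i j) - fl ε k * pderiv i (g i j))
      - fl ε j * C (ε i) * g i k + fl ε k * C (ε i) * g i j = 0) :
    ∃ G : MvPolynomial (Fin N) ℝ, G.IsHomogeneous m ∧
      ∀ j k, g j k = fl ε j * pderiv k G - fl ε k * pderiv j G := by
  have hself : ∀ j, g j j = 0 := by
    intro j
    have := ha j j
    have h2 : (2 : MvPolynomial (Fin N) ℝ) * g j j = 0 := by linear_combination this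
    rcases mul_eq_zero.1 h2 with h | h
    · exact absurd h two_ne_zero
    · exact h
  obtain ⟨A, hA, -, hgA⟩ := koszul ε hε hN g hg ha (by
    intro i j k
    by_cases hij : i = j
    · subst hij; rw [hself, ha k i]; ring
    by_cases hik : i = k
    · subst hik; rw [hself, ha j i]; ring
    by_cases hjk : j = k
    · subst hjk; rw [hself, ha j i]; ring
    rw [hp i j k hij hik hjk, ha k i]; ring)
  obtain ⟨G, h, hG, hh, hGh⟩ := lemma2 ε hε hN (m - 1) A hA (by
    intro i j k
    by_cases hij : i = j
    · subst hij; ring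
    by_cases hik : i = k
    · subst hik; ring
    by_cases hjk : j = k
    · subst hjk; ring
    apply mul_left_cancel₀ (fl_ne ε hε i)
    apply mul_left_cancel₀ (fl_ne ε hε i)
    have := hc i j k hij hik hjk
    rw [hgA i k, hgA i j] at this
    simp only [map_sub, Derivation.leibniz, smul_eq_mul, pd_fl, if_true, if_neg hij, if_neg hik,
      if_neg hjk, if_neg (Ne.symm hij), if_neg (Ne.symm hik), if_neg (Ne.symm hjk)] at this
    linear_combination -this)
  refine ⟨G, homog_of_eq hG (by omega), fun j k => ?_⟩
  rw [hgA, hGh, hGh]; ring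

end PolyAlgebra

end NambuLin

namespace NambuLin

section LeadForms

theorem map_ff {n q : ℕ} {R S : Type*} [CommRing R] [CommRing S] (f : R →+* S) (w : Idx n q → R)
    (A : Fin (q + 1) → Fin n → R) (j : Fin (q + 1)) :
    f (ff w A j) = ff (fun I => f (w I)) (fun l k => f (A l k)) j := by
  rw [ff, ff, map_mul, map_ev]; simp; rfl

theorem XX_eq_ff {n q : ℕ} {R : Type*} [CommRing R] (w : Idx n q → R)
    (A : Fin (q + 1) → Fin n → R) (i j : Fin (q + 1)) (α : Fin n → R) :
    XX w A i j α = - ff w (Function.update A i α) j := rfl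

theorem map_XX {n q : ℕ} {R S : Type*} [CommRing R] [CommRing S] (f : R →+* S) (w : Idx n q → R)
    (A : Fin (q + 1) → Fin n → R) (i j : Fin (q + 1)) (α : Fin n → R) :
    f (XX w A i j α) = XX (fun I => f (w I)) (fun l k => f (A l k)) i j (fun k => f (α k)) := by
  rw [XX_eq_ff, XX_eq_ff, map_neg, map_ff]
  congr 2
  funext l k
  by_cases hl : l = i
  · subst hl; simp
  · simp [hl]

variable {n q : ℕ} {R : Type*} [CommRing R]

theorem lead_pm (j : ℕ) : Lead 0 ((-1 : PowerSeries R) ^ j) ((-1 : R) ^ j) := by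
  have := lead_const ((-1 : PowerSeries R) ^ j)
  simpa using this

theorem lead_ff {a : ℕ} {w : Idx n q → PowerSeries R} {w0 : Idx n q → R}
    {A : Fin (q + 1) → Fin n → PowerSeries R} {A0 : Fin (q + 1) → Fin n → R}
    (hw : ∀ I, Lead a (w I) (w0 I)) (hA : ∀ l k, Lead 0 (A l k) (A0 l k)) (j : Fin (q + 1)) :
    Lead a (ff w A j) (ff w0 A0 j) := by
  have h := (lead_pm (R := R) (j : ℕ)).mul
    (lead_ev (c := fun _ => 0) hw (fun (s : Fin q) k => hA (j.succAbove s) k))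
  simp only [zero_add, Finset.sum_const_zero, add_zero] at h
  exact h

theorem lead_XX {a c : ℕ} {w : Idx n q → PowerSeries R} {w0 : Idx n q → R}
    {A : Fin (q + 1) → Fin n → PowerSeries R} {A0 : Fin (q + 1) → Fin n → R}
    {α : Fin n → PowerSeries R} {α0 : Fin n → R}
    (hw : ∀ I, Lead a (w I) (w0 I)) (hA : ∀ l k, Lead 0 (A l k) (A0 l k))
    (hα : ∀ k, Lead c (α k) (α0 k)) {i j : Fin (q + 1)} (hij : i ≠ j) :
    Lead (a + c) (XX w A i j α) (XX w0 A0 i j α0) := by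
  obtain ⟨i', rfl⟩ := Fin.exists_succAbove_eq hij
  simp only [XX, Fin.removeNth_update_succAbove]
  have h := ((lead_pm (R := R) (j : ℕ)).mul
    (lead_ev (c := Pi.single i' c) (α := Function.update (j.removeNth A) i' α)
      (α0 := Function.update (j.removeNth A0) i' α0) hw (fun (s : Fin q) k => by
        by_cases hs : s = i'
        · subst hs; simpa using hα k
        · simpa [hs, Fin.removeNth] using hA (j.succAbove s) k))).neg
  simpa using h

/-- Linearization of an alternating form. -/
theorem lead_lin {m : ℕ} (hm : 2 ≤ m) {w : Idx n q → PowerSeries R} {w0 : Idx n q → R}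
    {α β : Fin q → Fin n → PowerSeries R} {α0 β0 : Fin q → Fin n → R}
    (hw : ∀ I, Lead 1 (w I) (w0 I)) (hα : ∀ l k, Lead 0 (α l k) (α0 l k))
    (hβ : ∀ l k, Lead (m - 1) (β l k) (β0 l k)) :
    Lead m (ev w (fun l => α l + β l) - ev w α) (∑ s, ev w0 (Function.update α0 s (β0 s))) := by
  classical
  have key : ∀ T : Finset (Fin q),
      Lead m (ev w (T.piecewise (fun l => α l + β l) α) - ev w α)
        (∑ s ∈ T, ev w0 (Function.update α0 s (β0 s))) := by
    intro T
    induction T using Finset.induction_on with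
    | empty => simpa using lead_zero m
    | insert t T ht ih =>
      rw [Finset.sum_insert ht, Finset.piecewise_insert, AlternatingMap.map_update_add]
      have h1 : Function.update (T.piecewise (fun l => α l + β l) α) t (α t) =
          T.piecewise (fun l => α l + β l) α := by
        rw [Function.update_eq_self_iff]; simp [ht]
      rw [h1]
      have h2 : Lead (1 + ∑ s, (Pi.single t (m - 1) : Fin q → ℕ) s)
          (ev w (Function.update (T.piecewise (fun l => α l + β l) α) t (β t)))
          (ev w0 (Function.update α0 t (β0 t))) := by
        refine lead_ev hw fun s k => ?_
        by_cases hs : s = t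
        · subst hs; simpa using hβ s k
        · simp only [Function.update_of_ne hs, Pi.single_eq_of_ne hs]
          by_cases hsT : s ∈ T
          · simp only [Finset.piecewise_eq_of_mem _ _ _ hsT, Pi.add_apply]
            have := (hα s k).add ((hβ s k).drop (l := 0) (by omega))
            simpa using this
          · simp only [Finset.piecewise_eq_of_notMem _ _ _ hsT]
            exact hα s k
      rw [Finset.sum_pi_single'] at h2
      simp only [Finset.mem_univ, if_true] at h2
      rw [show 1 + (m - 1) = m by omega] at h2
      have := h2.add ih
      convert this using 1
      ring
  have := key Finset.univ
  simpa using this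

/-- Linearization of `ff`. -/
theorem lead_lin_ff {m : ℕ} (hm : 2 ≤ m) {w : Idx n q → PowerSeries R} {w0 : Idx n q → R}
    {A B : Fin (q + 1) → Fin n → PowerSeries R} {A0 B0 : Fin (q + 1) → Fin n → R}
    (hw : ∀ I, Lead 1 (w I) (w0 I)) (hA : ∀ l k, Lead 0 (A l k) (A0 l k))
    (hB : ∀ l k, Lead (m - 1) (B l k) (B0 l k)) (j : Fin (q + 1)) :
    Lead m (ff w (fun l => A l + B l) j - ff w A j)
      (∑ s : Fin q, - XX w0 A0 (j.succAbove s) j (B0 (j.succAbove s))) := by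
  have h := (lead_pm (R := R) (j : ℕ)).mul
    (lead_lin hm hw (fun (s : Fin q) k => hA (j.succAbove s) k)
      (fun (s : Fin q) k => hB (j.succAbove s) k))
  rw [zero_add] at h
  simp only [XX, neg_neg, Fin.removeNth_update_succAbove]
  rw [← Finset.mul_sum]
  convert h using 1
  · simp only [ff, mul_sub]
    rfl
  · rfl

end LeadForms

end NambuLin

namespace NambuLin

section Ctx
open MvPolynomial
variable {n q : ℕ}

/-- Families of differentials. -/
noncomputable def fam (φ : Fin n → Sm n) (κ : Fin (q + 1) → Fin n) : Fin (q + 1) → Fin n → Sm n :=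
  fun l => gr (φ (κ l))

/-- error of the first kind -/
noncomputable def er (τ : Fin (q + 1) → Fin n) (P : Idx n q → Sm n) (ε : Fin (q + 1) → ℝ)
    (φ : Fin n → Sm n) (j : Fin (q + 1)) : Sm n := ff P (fam φ τ) j - ε j • φ (τ j)

/-- error of the second kind -/
noncomputable def ex (τ : Fin (q + 1) → Fin n) (P : Idx n q → Sm n)
    (φ : Fin n → Sm n) (i j : Fin (q + 1)) (a : Fin n) : Sm n := XX P (fam φ τ) i j (gr (φ a))

/-- The equations hold to order `m`. -/
def EqN (τ : Fin (q + 1) → Fin n) (V : Set (Fin n → ℝ)) (P : Idx n q → Sm n) (ε : Fin (q + 1) → ℝ)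
    (m : ℕ) (φ : Fin n → Sm n) : Prop :=
  (∀ j, VO τ V m (er τ P ε φ j)) ∧
    ∀ a, (∀ j, τ j ≠ a) → ∀ i j, i ≠ j → VO τ V m (ex τ P φ i j a)

/-- Close to the identity. -/
def Near (τ : Fin (q + 1) → Fin n) (V : Set (Fin n → ℝ)) (φ : Fin n → Sm n) : Prop :=
  ∀ i, VO τ V 2 (φ i - co i)

/-- The standing assumptions. -/
structure Ctx (τ : Fin (q + 1) → Fin n) (V : Set (Fin n → ℝ)) (P : Idx n q → Sm n)
    (ε : Fin (q + 1) → ℝ) : Prop where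
  hτ : Function.Injective τ
  hq : 2 ≤ q
  hqn : q ≤ n
  hε : ∀ i, ε i * ε i = 1
  hV : IsOpen V
  good : ∀ z ∈ V, GoodAt P z
  p1 : ∀ I, VO τ V 1 (P I)
  e1 : EqN τ V P ε 2 co

variable {τ : Fin (q + 1) → Fin n} {V : Set (Fin n → ℝ)} {P : Idx n q → Sm n}
    {ε : Fin (q + 1) → ℝ} {φ : Fin n → Sm n} {s : Fin n → ℝ}

theorem VO.lead {N m : ℕ} {τ : Fin N → Fin n} {F : Sm n} (h : VO τ V m F) (hs : s ∈ V) (hS : s ∈ SS τ) :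
    Lead m (TT τ s F) (sy τ s m F) := by
  rw [lead_iff, coeff_TT]; exact ⟨h s hs hS, rfl⟩

theorem VO.pd_top {N m : ℕ} {τ : Fin N → Fin n} {F : Sm n} (h : VO τ V (m + 1) F) (j : Fin N) :
    VO τ V m (pd (τ j) F) := fun s hs hS => (lead_pd τ j (h.lead hs hS)).dvd

theorem VO.mono {N m l : ℕ} {τ : Fin N → Fin n} {F : Sm n} (h : VO τ V m F) (hl : l ≤ m) :
    VO τ V l F := fun s hs hS => dvd_of_le (h s hs hS) hl

theorem VO.pd_any {N m : ℕ} {τ : Fin N → Fin n} (hV : IsOpen V) {F : Sm n} (h : VO τ V (m + 1) F)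
    (k : Fin n) : VO τ V m (pd k F) := by
  by_cases hk : ∃ j, τ j = k
  · obtain ⟨j, rfl⟩ := hk; exact h.pd_top j
  · push Not at hk
    exact (h.pd_other τ hV k hk).mono (Nat.le_succ _)

/-- symbol of a gradient -/
noncomputable def grsym {N : ℕ} (τ : Fin N → Fin n) (p : MvPolynomial (Fin N) ℝ) (k : Fin n) :
    MvPolynomial (Fin N) ℝ := ∑ j, if τ j = k then pderiv j p else 0

theorem grsym_top {N : ℕ} {τ : Fin N → Fin n} (hτ : Function.Injective τ) (p : MvPolynomial (Fin N) ℝ)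
    (j : Fin N) : grsym τ p (τ j) = pderiv j p := by
  rw [grsym, Finset.sum_eq_single j] <;> simp +contextual [hτ.eq_iff]

theorem lead_gr {N m : ℕ} {τ : Fin N → Fin n} (hτ : Function.Injective τ) (hV : IsOpen V) {F : Sm n}
    (hm : 1 ≤ m) (h : VO τ V m F) (hs : s ∈ V) (hS : s ∈ SS τ) (k : Fin n) :
    Lead (m - 1) (TT τ s (gr F k)) (grsym τ (sy τ s m F) k) := by
  obtain ⟨m, rfl⟩ : ∃ l, m = l + 1 := ⟨m - 1, by omega⟩
  rw [Nat.add_sub_cancel]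
  by_cases hk : ∃ j, τ j = k
  · obtain ⟨j, rfl⟩ := hk
    rw [grsym_top hτ]
    exact lead_pd τ j (h.lead hs hS)
  · push Not at hk
    have : grsym τ (sy τ s (m + 1) F) k = 0 := Finset.sum_eq_zero fun j _ => by rw [if_neg (hk j)]
    rw [this]
    exact lead_of_dvd (h.pd_other τ hV k hk s hs hS) (Nat.lt_succ_self m)

theorem gr_co (i : Fin n) : gr (co i) = Pi.single i 1 := by
  funext k
  rw [gr, pd_co, Pi.single_apply]

theorem near_lead {N : ℕ} {τ : Fin N → Fin n} (hV : IsOpen V) {F : Sm n} {i : Fin n}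
    (h : VO τ V 2 (F - co i)) (hs : s ∈ V) (hS : s ∈ SS τ) (k : Fin n) :
    Lead 0 (TT τ s (gr F k)) ((Pi.single i 1 : Fin n → MvPolynomial (Fin N) ℝ) k) := by
  have h1 : gr F k = gr (co i) k + pd k (F - co i) := by simp [gr]
  have h2 : Lead 0 (TT τ s (gr (co i) k)) ((Pi.single i 1 : Fin n → MvPolynomial (Fin N) ℝ) k) := by
    rw [gr_co, Pi.single_apply, Pi.single_apply]
    split_ifs
    · rw [map_one]; exact lead_one
    · rw [map_zero]; exact lead_zero 0
  have h3 := h2.add (lead_of_dvd (h.pd_any hV k s hs hS) Nat.zero_lt_one)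
  rwa [add_zero, ← map_add, ← h1] at h3

/-- symbol of `P` -/
noncomputable def w0 (τ : Fin (q + 1) → Fin n) (P : Idx n q → Sm n) (s : Fin n → ℝ) :
    Idx n q → MvPolynomial (Fin (q + 1)) ℝ := fun I => sy τ s 1 (P I)

/-- constant covectors -/
noncomputable def ee (κ : Fin (q + 1) → Fin n) : Fin (q + 1) → Fin n → MvPolynomial (Fin (q + 1)) ℝ :=
  fun l => Pi.single (κ l) 1

theorem Ctx.lead_P (c : Ctx τ V P ε) (hs : s ∈ V) (hS : s ∈ SS τ) (I : Idx n q) :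
    Lead 1 (TT τ s (P I)) (w0 τ P s I) := (c.p1 I).lead hs hS

theorem Ctx.lead_ffk (c : Ctx τ V P ε) (hφ : Near τ V φ) (hs : s ∈ V) (hS : s ∈ SS τ)
    (κ : Fin (q + 1) → Fin n) (j : Fin (q + 1)) :
    Lead 1 (TT τ s (ff P (fam φ κ) j)) (ff (w0 τ P s) (ee κ) j) := by
  rw [map_ff]
  exact lead_ff (c.lead_P hs hS) (fun l k => near_lead c.hV (hφ (κ l)) hs hS k) j

theorem near_co : Near τ V co := fun i s _ _ => by simp

theorem lead_co_top (hτ : Function.Injective τ) (hS : s ∈ SS τ) (j : Fin (q + 1)) :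
    Lead 1 (TT τ s (co (τ j))) (X j) := by
  rw [TT_co_top τ hτ, hS j]
  exact ⟨PowerSeries.C (X j), by simp, by simp⟩

theorem Ctx.ff_w0 (c : Ctx τ V P ε) (hs : s ∈ V) (hS : s ∈ SS τ) (j : Fin (q + 1)) :
    ff (w0 τ P s) (ee τ) j = fl ε j := by
  have h1 := c.lead_ffk near_co hs hS τ j
  have h2 : Lead 1 (TT τ s (ff P (fam co τ) j)) (fl ε j) := by
    have h3 := lead_of_dvd (c.e1.1 j s hs hS) (l := 1) (by norm_num)
    have h4 : Lead 1 (TT τ s (ε j • co (τ j))) (fl ε j) := by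
      rw [TT_smul]
      have := (lead_const (PowerSeries.C (C (ε j)) : PowerSeries (MvPolynomial (Fin (q+1)) ℝ))).mul
        (lead_co_top c.hτ hS j)
      simpa [fl] using this
    have h5 := h3.add h4
    rw [zero_add, ← map_add, er, sub_add_cancel] at h5
    exact h5
  exact h1.uniq h2

theorem Ctx.lead_f (c : Ctx τ V P ε) (hφ : Near τ V φ) (hs : s ∈ V) (hS : s ∈ SS τ)
    (j : Fin (q + 1)) : Lead 1 (TT τ s (ff P (fam φ τ) j)) (fl ε j) := by
  rw [← c.ff_w0 hs hS j]; exact c.lead_ffk hφ hs hS τ j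

theorem Ctx.ev_dvd (c : Ctx τ V P ε) (hs : s ∈ V) (hS : s ∈ SS τ) (γ : Fin q → Fin n → Sm n) :
    PowerSeries.X ^ 1 ∣ TT τ s (ev P γ) := by
  rw [map_ev, ev_apply]
  exact Finset.dvd_sum fun I _ => Dvd.dvd.mul_left (c.p1 I s hs hS) _

theorem Ctx.d3 (c : Ctx τ V P ε) (hφ : Near τ V φ) {m : ℕ} (he : EqN τ V P ε m φ)
    (hs : s ∈ V) (hS : s ∈ SS τ) {a : Fin n} (ha : ∀ j, τ j ≠ a) (γ : Fin q → Fin n → Sm n) (t : Fin q) :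
    PowerSeries.X ^ m ∣ TT τ s (ev P (Function.update γ t (gr (φ a)))) := by
  refine (c.lead_f hφ hs hS 0).cancel (fl_ne ε c.hε 0) ?_
  rw [← map_mul]
  have : TT τ s (ff P (fam φ τ) 0 * ev P (Function.update γ t (gr (φ a)))) =
      TT τ s (∑ l ∈ Finset.univ.erase 0, XX P (fam φ τ) 0 l (gr (φ a)) *
        ev P (Function.update γ t (fam φ τ l))) := by
    refine TT_congr τ ?_
    filter_upwards [c.hV.mem_nhds hs] with z hz
    exact d3_at c.hqn (c.good z hz) (fam φ τ) 0 (gr (φ a)) γ t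
  rw [this, map_sum]
  refine Finset.dvd_sum fun l hl => ?_
  rw [map_mul, add_comm 1 m, pow_add]
  exact mul_dvd_mul (he.2 a ha 0 l (Finset.ne_of_mem_erase hl).symm s hs hS) (c.ev_dvd hs hS _)

theorem Ctx.d3' (c : Ctx τ V P ε) (hφ : Near τ V φ) {m : ℕ} (he : EqN τ V P ε m φ)
    (hs : s ∈ V) (hS : s ∈ SS τ) {a : Fin n} (ha : ∀ j, τ j ≠ a) (γ : Fin q → Fin n → Sm n) (t : Fin q)
    (ht : γ t = gr (φ a)) :
    PowerSeries.X ^ m ∣ TT τ s (ev P γ) := by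
  have := c.d3 hφ he hs hS ha γ t
  rwa [← ht, Function.update_eq_self] at this

theorem Ctx.w0_y (c : Ctx τ V P ε) (hs : s ∈ V) (hS : s ∈ SS τ) {a : Fin n} (ha : ∀ j, τ j ≠ a)
    (I : Idx n q) (hI : a ∈ I.1) : w0 τ P s I = 0 := by
  obtain ⟨t, ht⟩ : ∃ t, I.1.orderEmbOfFin I.2 t = a := by
    have := Finset.range_orderEmbOfFin I.1 I.2
    have h2 : a ∈ Set.range (I.1.orderEmbOfFin I.2) := by rw [this]; exact hI
    exact h2
  have h := c.d3' near_co c.e1 hs hS ha (fun t => gr (co (I.1.orderEmbOfFin I.2 t))) t (by rw [ht])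
  simp only [gr_co] at h
  rw [ev_single] at h
  have := lead_of_dvd h (l := 1) (by norm_num)
  exact (c.lead_P hs hS I).uniq this

theorem Ctx.ev_w0_y (c : Ctx τ V P ε) (hs : s ∈ V) (hS : s ∈ SS τ) {a : Fin n} (ha : ∀ j, τ j ≠ a)
    (α : Fin q → Fin n → MvPolynomial (Fin (q + 1)) ℝ) (t : Fin q) (ht : α t = Pi.single a 1) :
    ev (w0 τ P s) α = 0 := ev_single_zero _ a (c.w0_y hs hS ha) α t 1 ht

theorem Ctx.XX_w0 (c : Ctx τ V P ε) (hs : s ∈ V) (hS : s ∈ SS τ) {i j : Fin (q + 1)} (hij : i ≠ j)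
    (α : Fin n → MvPolynomial (Fin (q + 1)) ℝ) :
    XX (w0 τ P s) (ee τ) i j α = fl ε i * α (τ j) - fl ε j * α (τ i) := by
  have hτij : τ i ≠ τ j := fun h => hij (c.hτ h)
  rw [XX_expand _ _ hij, Fintype.sum_eq_add (τ i) (τ j) hτij]
  · have h1 : XX (w0 τ P s) (ee τ) i j (Pi.single (τ i) 1) = _ := XX_self_left _ (ee τ) i j
    have h2 : XX (w0 τ P s) (ee τ) i j (Pi.single (τ j) 1) = _ := XX_self_right _ (ee τ) hij
    rw [h1, h2, c.ff_w0 hs hS, c.ff_w0 hs hS]; ring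
  · rintro k ⟨hki, hkj⟩
    by_cases hk : ∃ l, τ l = k
    · obtain ⟨l, rfl⟩ := hk
      have h1 : XX (w0 τ P s) (ee τ) i j (Pi.single (τ l) 1) = _ :=
        XX_other _ (ee τ) hij (k := l) (fun h => hki (h ▸ rfl)) (fun h => hkj (h ▸ rfl))
      rw [h1, mul_zero]
    · push Not at hk
      obtain ⟨i', rfl⟩ := Fin.exists_succAbove_eq hij
      rw [XX, Fin.removeNth_update_succAbove, c.ev_w0_y hs hS hk _ i' (by simp)]
      simp

/-- The derivation along the Hamiltonian-like fields. -/
noncomputable def DD (τ : Fin (q + 1) → Fin n) (P : Idx n q → Sm n) (φ : Fin n → Sm n)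
    (i j : Fin (q + 1)) (F : Sm n) : Sm n := XX P (fam φ τ) i j (gr F)

theorem Ctx.lead_DD (c : Ctx τ V P ε) (hφ : Near τ V φ) {m : ℕ} (hm : 1 ≤ m) {F : Sm n}
    (hF : VO τ V m F) (hs : s ∈ V) (hS : s ∈ SS τ) {i j : Fin (q + 1)} (hij : i ≠ j) :
    Lead m (TT τ s (DD τ P φ i j F))
      (fl ε i * pderiv j (sy τ s m F) - fl ε j * pderiv i (sy τ s m F)) := by
  rw [DD, map_XX]
  have h := lead_XX (c.lead_P hs hS) (fun l k => near_lead c.hV (hφ (τ l)) hs hS k)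
    (fun k => lead_gr c.hτ c.hV hm hF hs hS k) hij
  have h2 := c.XX_w0 hs hS hij (grsym τ (sy τ s m F))
  rw [grsym_top c.hτ, grsym_top c.hτ] at h2
  rw [← h2]
  rw [show 1 + (m - 1) = m by omega] at h
  exact h

theorem DD_add {i j : Fin (q + 1)} (hij : i ≠ j) (F G : Sm n) :
    DD τ P φ i j (F + G) = DD τ P φ i j F + DD τ P φ i j G := by
  rw [DD, DD, DD, ← XX_add _ _ hij]; congr 1; funext k; simp [gr]

theorem DD_smul {i j : Fin (q + 1)} (hij : i ≠ j) (a : ℝ) (F : Sm n) :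
    DD τ P φ i j (a • F) = a • DD τ P φ i j F := by
  rw [DD, DD, Algebra.smul_def, Algebra.smul_def, ← XX_smul _ _ hij]; congr 1; funext k
  simp [gr, ← Algebra.smul_def]

theorem DD_neg {i j : Fin (q + 1)} (hij : i ≠ j) (F : Sm n) :
    DD τ P φ i j (-F) = - DD τ P φ i j F := by
  have := DD_smul (τ := τ) (P := P) (φ := φ) hij (-1) F
  simpa using this

theorem DD_left (i j : Fin (q + 1)) : DD τ P φ i j (φ (τ i)) = - ff P (fam φ τ) j :=
  XX_self_left P (fam φ τ) i j

theorem DD_right {i j : Fin (q + 1)} (hij : i ≠ j) : DD τ P φ i j (φ (τ j)) = ff P (fam φ τ) i :=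
  XX_self_right P (fam φ τ) hij

theorem DD_other {i j k : Fin (q + 1)} (hij : i ≠ j) (hki : k ≠ i) (hkj : k ≠ j) :
    DD τ P φ i j (φ (τ k)) = 0 := XX_other P (fam φ τ) hij hki hkj

theorem DD_z {i j : Fin (q + 1)} (hij : i ≠ j) (F : Sm n) (z : Fin n → ℝ) :
    DD τ P φ i j F z = dd (fun m => XX (at' P z) (fun a k => fam φ τ a k z) i j (Pi.single m 1)) F z := by
  rw [DD, XX_z, XX_expand _ _ hij, dd_apply]
  exact Finset.sum_congr rfl fun k _ => mul_comm _ _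

theorem DD_inv (hqn : q ≤ n) {z : Fin n → ℝ} (hP : GoodAt P z) (ρ : Fin (q + 1) → Sm n)
    {i j k l : Fin (q + 1)} (hij : i ≠ j) (hkl : k ≠ l) :
    (∑ t, (DD τ P φ i j (ff P (fun l => gr (ρ l)) t) * DD τ P φ k l (ρ t) -
      DD τ P φ k l (ff P (fun l => gr (ρ l)) t) * DD τ P φ i j (ρ t))) z = 0 := by
  have := inv_at hqn hP ρ (fun a k => fam φ τ a k z) (fun a k => fam φ τ a k z) hij hkl _ _ rfl rfl
  rw [Sm.sum_ap, ← this]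
  refine Finset.sum_congr rfl fun t _ => ?_
  rw [Sm.sub_ap, Sm.mul_ap, Sm.mul_ap, DD_z hij, DD_z hij, DD_z hkl, DD_z hkl]

theorem inv1 (hqn : q ≤ n) {z : Fin n → ℝ} (hP : GoodAt P z)
    {i j k : Fin (q + 1)} (hij : i ≠ j) (hik : i ≠ k) (hjk : j ≠ k) :
    (ff P (fam φ τ) i * DD τ P φ i j (er τ P ε φ k) - ff P (fam φ τ) k * DD τ P φ i j (er τ P ε φ i)
      - ff P (fam φ τ) i * DD τ P φ i k (er τ P ε φ j)
      + ff P (fam φ τ) j * DD τ P φ i k (er τ P ε φ i)) z = 0 := by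
  rw [← DD_inv (τ := τ) (φ := φ) hqn hP (fun t => φ (τ t)) hij hik]
  refine congrArg (fun F : Sm n => F z) ?_
  have e : ∀ t, ff P (fun l => gr (φ (τ l))) t = er τ P ε φ t + ε t • φ (τ t) := fun t => by
    rw [er, sub_add_cancel]; rfl
  have e2 : ∀ t, DD τ P φ i j (ff P (fun l => gr (φ (τ l))) t) * DD τ P φ i k (φ (τ t)) -
      DD τ P φ i k (ff P (fun l => gr (φ (τ l))) t) * DD τ P φ i j (φ (τ t)) =
      DD τ P φ i j (er τ P ε φ t) * DD τ P φ i k (φ (τ t)) -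
      DD τ P φ i k (er τ P ε φ t) * DD τ P φ i j (φ (τ t)) := by
    intro t
    rw [e, DD_add hij, DD_add hik, DD_smul hij, DD_smul hik]
    simp only [Algebra.smul_def]; ring
  rw [Finset.sum_congr rfl fun t _ => e2 t, Finset.sum_sub_distrib,
    Fintype.sum_eq_add i k hik, Fintype.sum_eq_add i j hij]
  · rw [DD_left, DD_left, DD_right hij, DD_right hik]; ring
  · rintro x ⟨h1, h2⟩; rw [DD_other hij h1 h2, mul_zero]
  · rintro x ⟨h1, h2⟩; rw [DD_other hik h1 h2, mul_zero]

theorem inv2 (hqn : q ≤ n) {z : Fin n → ℝ} (hP : GoodAt P z) (a : Fin n)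
    {i j k : Fin (q + 1)} (hij : i ≠ j) (hik : i ≠ k) (hjk : j ≠ k) :
    (- ff P (fam φ τ) i * DD τ P φ i j (ex τ P φ i k a) + ff P (fam φ τ) i * DD τ P φ i k (ex τ P φ i j a)
      + DD τ P φ i j (ff P (fam φ τ) i) * ex τ P φ i k a
      - DD τ P φ i k (ff P (fam φ τ) i) * ex τ P φ i j a) z = 0 := by
  rw [← DD_inv (τ := τ) (φ := φ) hqn hP (Function.update (fun t => φ (τ t)) i (φ a)) hij hik]
  refine congrArg (fun F : Sm n => F z) ?_
  have e0 : (fun l => gr (Function.update (fun t => φ (τ t)) i (φ a) l)) =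
      Function.update (fam φ τ) i (gr (φ a)) := by
    funext l
    by_cases hl : l = i
    · subst hl; simp
    · simp [hl, fam]
  have e1 : ∀ t, ff P (Function.update (fam φ τ) i (gr (φ a))) t = - ex τ P φ i t a := fun t => by
    rw [ex, XX_eq_ff, neg_neg]
  have e2 : ff P (Function.update (fam φ τ) i (gr (φ a))) i = ff P (fam φ τ) i := by
    rw [ff, ff, Fin.removeNth_update]
  rw [e0, Finset.sum_sub_distrib, Fintype.sum_eq_add i k hik, Fintype.sum_eq_add i j hij]
  · rw [e2, e1, e1, Function.update_self, Function.update_of_ne hik.symm, Function.update_of_ne hij.symm,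
      DD_right hij, DD_right hik, DD_neg hij, DD_neg hik]
    simp only [ex, DD]
    ring
  · rintro x ⟨h1, h2⟩; rw [Function.update_of_ne h1, DD_other hij h1 h2, mul_zero]
  · rintro x ⟨h1, h2⟩; rw [Function.update_of_ne h1, DD_other hik h1 h2, mul_zero]

end Ctx
end NambuLin

namespace NambuLin

section Realize
open MvPolynomial
variable {n N : ℕ}

/-- transversal scaling -/
noncomputable def scl (τ : Fin N → Fin n) (t : ℝ) : (Fin n → ℝ) →L[ℝ] (Fin n → ℝ) :=
  open Classical in
  ContinuousLinearMap.pi fun k => if ∃ j, τ j = k then t • ContinuousLinearMap.proj k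
    else ContinuousLinearMap.proj k

theorem scl_top (τ : Fin N → Fin n) (t : ℝ) (z : Fin n → ℝ) (j : Fin N) :
    scl τ t z (τ j) = t * z (τ j) := by
  simp [scl]

theorem scl_other (τ : Fin N → Fin n) (t : ℝ) (z : Fin n → ℝ) {a : Fin n} (ha : ∀ j, τ j ≠ a) :
    scl τ t z a = z a := by
  have : ¬ ∃ j, τ j = a := by push Not; exact ha
  simp [scl, this]

theorem scl_zero_scl (τ : Fin N → Fin n) (t : ℝ) (z : Fin n → ℝ) :
    scl τ 0 (scl τ t z) = scl τ 0 z := by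
  funext k
  by_cases hk : ∃ j, τ j = k
  · obtain ⟨j, rfl⟩ := hk; simp [scl_top]
  · push Not at hk; simp [scl_other _ _ _ hk]

theorem scl_S {τ : Fin N → Fin n} {s : Fin n → ℝ} (hS : s ∈ SS τ) (t : ℝ) : scl τ t s = s := by
  funext k
  by_cases hk : ∃ j, τ j = k
  · obtain ⟨j, rfl⟩ := hk; rw [scl_top, hS j, mul_zero]
  · push Not at hk; simp [scl_other _ _ _ hk]

theorem scl_zero_mem (τ : Fin N → Fin n) (z : Fin n → ℝ) : scl τ 0 z ∈ SS τ := fun j => by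
  rw [scl_top, zero_mul]

/-- pull-back along the projection -/
noncomputable def pb (τ : Fin N → Fin n) (c : Sm n) : Sm n :=
  mkSm (fun z => c (scl τ 0 z)) ((Sm.smooth c).comp (scl τ 0).contDiff)

theorem pb_ap (τ : Fin N → Fin n) (c : Sm n) (z : Fin n → ℝ) : pb τ c z = c (scl τ 0 z) := rfl

theorem pd_pb (τ : Fin N → Fin n) (c : Sm n) (i : Fin N) : pd (τ i) (pb τ c) = 0 := by
  refine Sm.ext' fun z => ?_
  rw [pd_apply]
  have h : HasFDerivAt (pb τ c : (Fin n → ℝ) → ℝ)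
      ((fderiv ℝ (c : (Fin n → ℝ) → ℝ) (scl τ 0 z)).comp (scl τ 0)) z :=
    (Sm.diff c _).hasFDerivAt.comp z (scl τ 0).hasFDerivAt
  rw [h.fderiv]
  have : scl τ 0 (Pi.single (τ i) 1) = 0 := by
    funext k
    by_cases hk : ∃ j, τ j = k
    · obtain ⟨j, rfl⟩ := hk; simp [scl_top]
    · push Not at hk; rw [scl_other _ _ _ hk, Pi.single_eq_of_ne (hk i).symm]; rfl
  simp [this]

theorem TT_pb (τ : Fin N → Fin n) (c : Sm n) {s : Fin n → ℝ} (hS : s ∈ SS τ) :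
    TT τ s (pb τ c) = PowerSeries.C (C (c s)) := by
  rw [TT_const τ (pd_pb τ c), pb_ap, scl_S hS]

theorem eval₂_homog {A : Type*} [CommRing A] (f : ℝ →+* A) (g : Fin N → A) (r : A) {m : ℕ}
    {p : MvPolynomial (Fin N) ℝ} (hp : p.IsHomogeneous m) :
    eval₂ f (fun j => r * g j) p = r ^ m * eval₂ f g p := by
  rw [eval₂_eq', eval₂_eq', Finset.mul_sum]
  refine Finset.sum_congr rfl fun d hd => ?_
  have : ∑ i, d i = m := by
    have := hp (mem_support_iff.1 hd)
    rw [← this, Finsupp.weight_apply, Finsupp.sum_fintype] <;> simp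
  simp only [mul_pow]
  rw [Finset.prod_mul_distrib, Finset.prod_pow_eq_pow_sum, this]; ring

/-- polynomial in the transversal coordinates -/
noncomputable def rl (τ : Fin N → Fin n) (p : MvPolynomial (Fin N) ℝ) : Sm n :=
  aeval (fun j => co (τ j)) p

theorem TT_rl {τ : Fin N → Fin n} (hτ : Function.Injective τ) {s : Fin n → ℝ} (hS : s ∈ SS τ) {m : ℕ}
    {p : MvPolynomial (Fin N) ℝ} (hp : p.IsHomogeneous m) :
    TT τ s (rl τ p) = PowerSeries.X ^ m * PowerSeries.C p := by
  rw [rl, aeval_def, eval₂_comp_left]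
  have h1 : (TT τ s).comp (algebraMap ℝ (Sm n)) =
      (PowerSeries.C (R := MvPolynomial (Fin N) ℝ)).comp C := by
    ext1 c
    have := TT_smul τ (s := s) c 1
    rw [map_one, mul_one] at this
    rw [RingHom.comp_apply, Algebra.algebraMap_eq_smul_one, this]; rfl
  have h2 : (⇑(TT τ s) ∘ fun j => co (τ j)) =
      fun j => PowerSeries.X * (PowerSeries.C (R := MvPolynomial (Fin N) ℝ)) (X j) := by
    funext j
    rw [Function.comp_apply, TT_co_top τ hτ, hS j]; simp
  rw [h1, h2, eval₂_homog _ _ _ hp]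
  congr 1
  have := eval₂_comp_left (PowerSeries.C (R := MvPolynomial (Fin N) ℝ)) C X p
  rw [eval₂_eta] at this
  rw [this]; rfl

theorem rl_scl (τ : Fin N → Fin n) {m : ℕ} {p : MvPolynomial (Fin N) ℝ} (hp : p.IsHomogeneous m)
    (t : ℝ) (z : Fin n → ℝ) : rl τ p (scl τ t z) = t ^ m * rl τ p z := by
  have h : ∀ z, rl τ p z = eval₂ (RingHom.id ℝ) (fun j => z (τ j)) p := by
    intro z
    have : rl τ p z = (evz z).toRingHom (rl τ p) := rfl
    rw [this, rl, aeval_def, eval₂_comp_left]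
    rfl
  rw [h, h, ← eval₂_homog _ _ _ hp]
  simp only [scl_top]

theorem realize {τ : Fin N → Fin n} (hτ : Function.Injective τ) {V : Set (Fin n → ℝ)} {m : ℕ}
    {ι κ : Type} [Fintype ι] [DecidableEq ι]
    (Λ : (κ → homogeneousSubmodule (Fin N) ℝ m) →ₗ[ℝ] (ι → MvPolynomial (Fin N) ℝ))
    (F : ι → Sm n)
    (hex : ∀ s ∈ V, s ∈ SS τ → ∃ e, Λ e = fun α => sy τ s m (F α)) :
    ∃ u : κ → Sm n,
      (∀ s ∈ V, s ∈ SS τ → ∃ e, (Λ e = fun α => sy τ s m (F α)) ∧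
        ∀ k, sy τ s m (u k) = (e k : MvPolynomial (Fin N) ℝ)) ∧
      (∀ k t z, u k (scl τ t z) = t ^ m * u k z) ∧ ∀ k, VO τ Set.univ m (u k) := by
  obtain ⟨g, hg⟩ := Λ.rangeRestrict.exists_rightInverse_of_surjective (LinearMap.range_rangeRestrict Λ)
  obtain ⟨R, hR⟩ := LinearMap.exists_extend g
  have hRy : ∀ e, Λ (R (Λ e)) = Λ e := by
    intro e
    have h1 : R (Λ e) = g ⟨Λ e, LinearMap.mem_range_self Λ e⟩ := by rw [← hR]; rfl
    rw [h1]
    have h2 := LinearMap.congr_fun hg ⟨Λ e, LinearMap.mem_range_self Λ e⟩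
    exact congrArg Subtype.val h2
  have key : ∀ k s, s ∈ SS τ →
      TT τ s (∑ α, ∑ d ∈ (symR τ m (F α)).support, pb τ ((symR τ m (F α)).coeff d) *
      rl τ (R (Pi.single α (monomial d 1)) k : MvPolynomial (Fin N) ℝ)) =
      PowerSeries.X ^ m * PowerSeries.C (R (fun α => sy τ s m (F α)) k : MvPolynomial (Fin N) ℝ) := by
    intro k s hS
    have h1 : (fun α => sy τ s m (F α)) = ∑ α, ∑ d ∈ (symR τ m (F α)).support,
        ((symR τ m (F α)).coeff d) s • (Pi.single α (monomial d 1) : ι → MvPolynomial (Fin N) ℝ) := by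
      funext β
      rw [Finset.sum_apply, Finset.sum_eq_single β]
      · rw [sy]
        conv_lhs => rw [(symR τ m (F β)).as_sum]
        rw [map_sum, Finset.sum_apply]
        refine Finset.sum_congr rfl fun d _ => ?_
        rw [map_monomial, Pi.smul_apply, Pi.single_eq_same, smul_monomial, smul_eq_mul, mul_one]; rfl
      · intro α _ hα
        rw [Finset.sum_apply]
        refine Finset.sum_eq_zero fun d _ => ?_
        rw [Pi.smul_apply, Pi.single_eq_of_ne hα.symm, smul_zero]
      · simp
    rw [h1, map_sum, map_sum, Finset.sum_apply, Submodule.coe_sum, map_sum, Finset.mul_sum]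
    refine Finset.sum_congr rfl fun α _ => ?_
    rw [map_sum, map_sum, Finset.sum_apply, Submodule.coe_sum, map_sum, Finset.mul_sum]
    refine Finset.sum_congr rfl fun d _ => ?_
    rw [map_mul, TT_pb τ _ hS, TT_rl hτ hS (R (Pi.single α (monomial d 1)) k).2, map_smul,
      Pi.smul_apply, Submodule.coe_smul, smul_eq_C_mul, map_mul]
    ring
  refine ⟨fun k => ∑ α, ∑ d ∈ (symR τ m (F α)).support, pb τ ((symR τ m (F α)).coeff d) *
      rl τ (R (Pi.single α (monomial d 1)) k : MvPolynomial (Fin N) ℝ), ?_, ?_, ?_⟩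
  · intro s hs hS
    obtain ⟨e, he⟩ := hex s hs hS
    refine ⟨R (Λ e), ?_, fun k => ?_⟩
    · rw [hRy, he]
    · rw [← coeff_TT, key k s hS, he, PowerSeries.coeff_X_pow_mul']
      simp
  · intro k t z
    simp only [Sm.sum_ap, Sm.mul_ap, Finset.mul_sum]
    refine Finset.sum_congr rfl fun α _ => Finset.sum_congr rfl fun d _ => ?_
    rw [rl_scl τ (R (Pi.single α (monomial d 1)) k).2, pb_ap, pb_ap, scl_zero_scl]
    ring
  · intro k s _ hS
    rw [key k s hS]
    exact Dvd.intro _ rfl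

end Realize

end NambuLin

namespace NambuLin

section Step
open MvPolynomial
variable {n q : ℕ} {τ : Fin (q + 1) → Fin n} {V : Set (Fin n → ℝ)} {P : Idx n q → Sm n}
    {ε : Fin (q + 1) → ℝ} {φ : Fin n → Sm n} {s : Fin n → ℝ}

theorem Ctx.symH (c : Ctx τ V P ε) (hφ : Near τ V φ) {m : ℕ} (hm : 1 ≤ m) (he : EqN τ V P ε m φ)
    (hs : s ∈ V) (hS : s ∈ SS τ) :
    ∃ ξ : Fin (q + 1) → MvPolynomial (Fin (q + 1)) ℝ, (∀ i, (ξ i).IsHomogeneous m) ∧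
      ∀ j, opL ε ξ j = sy τ s m (er τ P ε φ j) := by
  refine solveH ε c.hε (by have := c.hq; omega) m hm _ (fun i => sy_homog τ s m _) ?_
  intro i j k hij hik hjk
  have h0 : TT τ s (ff P (fam φ τ) i * DD τ P φ i j (er τ P ε φ k) - ff P (fam φ τ) k * DD τ P φ i j (er τ P ε φ i)
      - ff P (fam φ τ) i * DD τ P φ i k (er τ P ε φ j)
      + ff P (fam φ τ) j * DD τ P φ i k (er τ P ε φ i)) = TT τ s 0 := by
    refine TT_congr τ ?_
    filter_upwards [c.hV.mem_nhds hs] with z hz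
    exact inv1 c.hqn (c.good z hz) hij hik hjk
  rw [map_zero] at h0
  have l := fun a b (hab : i ≠ b) => c.lead_DD hφ hm (he.1 a) hs hS hab
  have f := c.lead_f hφ hs hS
  have h1 := ((((f i).mul (l k j hij)).sub ((f k).mul (l i j hij))).sub ((f i).mul (l j k hik))).add
    ((f j).mul (l i k hik))
  simp only [← map_mul, ← map_sub, ← map_add] at h1
  rw [h0] at h1
  exact (h1.uniq (lead_zero _))

theorem Ctx.symG (c : Ctx τ V P ε) (hφ : Near τ V φ) {m : ℕ} (hm : 1 ≤ m) (he : EqN τ V P ε m φ)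
    (hs : s ∈ V) (hS : s ∈ SS τ) (a : Fin n) (ha : ∀ j, τ j ≠ a) :
    ∃ G : MvPolynomial (Fin (q + 1)) ℝ, G.IsHomogeneous m ∧
      ∀ i j, sy τ s m (if i = j then 0 else ex τ P φ i j a) = fl ε i * pderiv j G - fl ε j * pderiv i G := by
  have f := c.lead_f hφ hs hS
  have hg : ∀ i j, i ≠ j → Lead m (TT τ s (ex τ P φ i j a)) (sy τ s m (ex τ P φ i j a)) := fun i j hij =>
    (he.2 a ha i j hij).lead hs hS
  refine solveG ε c.hε (by have := c.hq; omega) m hm (fun i j => sy τ s m (if i = j then 0 else ex τ P φ i j a))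
    (fun i j => sy_homog τ s m _) ?_ ?_ ?_
  · intro i j
    by_cases hij : i = j
    · subst hij; simp [sy_zero_fun]
    · simp only [if_neg hij, if_neg (Ne.symm hij)]
      rw [ex, XX_antisymm _ _ hij, ← neg_one_smul ℝ, sy_smul]
      simp [ex]
  · intro i j k hij hik hjk
    simp only [if_neg hij, if_neg hik, if_neg hjk]
    have h0 : TT τ s (ff P (fam φ τ) i * ex τ P φ j k a) =
        TT τ s (ff P (fam φ τ) j * ex τ P φ i k a - ff P (fam φ τ) k * ex τ P φ i j a) := by
      refine TT_congr τ ?_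
      filter_upwards [c.hV.mem_nhds hs] with z hz
      exact pl_at c.hqn (c.good z hz) (fam φ τ) hij hik hjk _
    have h1 := (f i).mul (hg j k hjk)
    have h2 := ((f j).mul (hg i k hik)).sub ((f k).mul (hg i j hij))
    simp only [← map_mul, ← map_sub] at h1 h2
    rw [h0] at h1
    exact h1.uniq h2
  · intro i j k hij hik hjk
    simp only [if_neg hij, if_neg hik]
    have h0 : TT τ s (- ff P (fam φ τ) i * DD τ P φ i j (ex τ P φ i k a) + ff P (fam φ τ) i * DD τ P φ i k (ex τ P φ i j a)
      + DD τ P φ i j (ff P (fam φ τ) i) * ex τ P φ i k a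
      - DD τ P φ i k (ff P (fam φ τ) i) * ex τ P φ i j a) = TT τ s 0 := by
      refine TT_congr τ ?_
      filter_upwards [c.hV.mem_nhds hs] with z hz
      exact inv2 c.hqn (c.good z hz) a hij hik hjk
    rw [map_zero] at h0
    have l := fun b d (hab : i ≠ b) (h' : i ≠ d) => c.lead_DD hφ hm (he.2 a ha i d h') hs hS hab
    have v1 : VO τ V 1 (ff P (fam φ τ) i) := fun s hs hS => (c.lead_f hφ hs hS i).dvd
    have v2 : sy τ s 1 (ff P (fam φ τ) i) = fl ε i := (v1.lead hs hS).uniq (f i)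
    have l2 := fun b (hab : i ≠ b) => c.lead_DD hφ le_rfl v1 hs hS hab
    simp only [v2] at l2
    have h1 := (((((f i).neg).mul (l j k hij hik)).add ((f i).mul (l k j hik hij))).add ((l2 j hij).mul (hg i k hik))).sub
      ((l2 k hik).mul (hg i j hij))
    simp only [← map_mul, ← map_sub, ← map_add, ← map_neg] at h1
    rw [h0] at h1
    have h2 := h1.uniq (lead_zero _)
    simp only [pd_fl, if_neg hij.symm, if_neg hik.symm, if_true] at h2
    linear_combination h2

theorem fam_add (φ u : Fin n → Sm n) (κ : Fin (q + 1) → Fin n) :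
    fam (φ + u) κ = fun l => fam φ κ l + fam u κ l := by
  funext l k
  simp [fam, gr]

theorem Ctx.lin_ff (c : Ctx τ V P ε) (hφ : Near τ V φ) {m : ℕ} (hm : 2 ≤ m)
    {u : Fin n → Sm n} (hu : ∀ i, VO τ V m (u i)) (hs : s ∈ V) (hS : s ∈ SS τ)
    (κ : Fin (q + 1) → Fin n) (j : Fin (q + 1)) :
    Lead m (TT τ s (ff P (fam (φ + u) κ) j - ff P (fam φ κ) j))
      (∑ t : Fin q, - XX (w0 τ P s) (ee κ) (j.succAbove t) j (grsym τ (sy τ s m (u (κ (j.succAbove t)))))) := by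
  rw [map_sub, map_ff, map_ff, fam_add]
  have := lead_lin_ff hm (c.lead_P hs hS) (fun l k => near_lead c.hV (hφ (κ l)) hs hS k)
    (fun l k => lead_gr c.hτ c.hV (by omega) (hu (κ l)) hs hS k) j
  convert this using 3
  · funext l k
    simp [fam]
  · rfl
  · rfl

theorem Ctx.lin_er (c : Ctx τ V P ε) (hφ : Near τ V φ) {m : ℕ} (hm : 2 ≤ m)
    {u : Fin n → Sm n} (hu : ∀ i, VO τ V m (u i)) (hs : s ∈ V) (hS : s ∈ SS τ) (j : Fin (q + 1)) :
    Lead m (TT τ s (er τ P ε (φ + u) j - er τ P ε φ j)) (- opL ε (fun i => sy τ s m (u (τ i))) j) := by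
  have h1 := c.lin_ff hφ hm hu hs hS τ j
  have h2 : Lead m (TT τ s (ε j • u (τ j))) (C (ε j) * sy τ s m (u (τ j))) := by
    rw [TT_smul]
    have := (lead_const (PowerSeries.C (C (ε j)) : PowerSeries (MvPolynomial (Fin (q+1)) ℝ))).mul
        ((hu (τ j)).lead hs hS)
    simpa using this
  have h3 := h1.sub h2
  rw [← map_sub] at h3
  convert h3 using 1
  · congr 1
    simp only [er, Pi.add_apply, smul_add]; ring
  · have e : ∀ t : Fin q, - XX (w0 τ P s) (ee τ) (j.succAbove t) j (grsym τ (sy τ s m (u (τ (j.succAbove t))))) =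
      - (fl ε (j.succAbove t) * pderiv j (sy τ s m (u (τ (j.succAbove t)))) -
        fl ε j * pderiv (j.succAbove t) (sy τ s m (u (τ (j.succAbove t))))) := fun t => by
      rw [c.XX_w0 hs hS (Fin.succAbove_ne j t), grsym_top c.hτ, grsym_top c.hτ]
    rw [Finset.sum_congr rfl fun t _ => e t]
    have e2 := Fin.sum_univ_succAbove (fun i => - (fl ε i * pderiv j (sy τ s m (u (τ i))) -
        fl ε j * pderiv i (sy τ s m (u (τ i))))) j
    rw [sub_self, neg_zero, zero_add] at e2
    rw [← e2, opL, map_sum, Finset.sum_mul, Finset.sum_neg_distrib, Finset.sum_sub_distrib]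
    have e3 : ∀ i, pderiv j (fl ε i * sy τ s m (u (τ i))) =
        (if j = i then C (ε j) * sy τ s m (u (τ i)) else 0) + fl ε i * pderiv j (sy τ s m (u (τ i))) := by
      intro i
      rw [Derivation.leibniz, pd_fl, smul_eq_mul, smul_eq_mul]
      split_ifs <;> ring
    rw [Finset.sum_congr rfl fun t _ => e3 t, Finset.sum_add_distrib, Finset.sum_ite_eq]
    simp only [Finset.mem_univ, if_true]
    have e4 : ∑ i, pderiv i (sy τ s m (u (τ i))) * fl ε j = ∑ i, fl ε j * pderiv i (sy τ s m (u (τ i))) :=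
      Finset.sum_congr rfl fun i _ => mul_comm _ _
    rw [e4]; ring

theorem ex_eq_ff (i j : Fin (q + 1)) (a : Fin n) (φ : Fin n → Sm n) :
    ex τ P φ i j a = - ff P (fam φ (Function.update τ i a)) j := by
  rw [ex, XX_eq_ff]
  congr 2
  funext l
  by_cases hl : l = i
  · subst hl; simp [fam]
  · simp [fam, hl]

theorem Ctx.lin_ex (c : Ctx τ V P ε) (hφ : Near τ V φ) {m : ℕ} (hm : 2 ≤ m)
    {u : Fin n → Sm n} (hu : ∀ i, VO τ V m (u i)) (hs : s ∈ V) (hS : s ∈ SS τ) {i j : Fin (q + 1)} (hij : i ≠ j)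
    {a : Fin n} (ha : ∀ j, τ j ≠ a) :
    Lead m (TT τ s (ex τ P (φ + u) i j a - ex τ P φ i j a))
      (fl ε i * pderiv j (sy τ s m (u a)) - fl ε j * pderiv i (sy τ s m (u a))) := by
  have h1 := (c.lin_ff hφ hm hu hs hS (Function.update τ i a) j).neg
  rw [← map_neg] at h1
  obtain ⟨i', rfl⟩ := Fin.exists_succAbove_eq hij
  convert h1 using 1
  · rw [ex_eq_ff, ex_eq_ff]; congr 1; ring
  · rw [Finset.sum_eq_single i']
    · rw [neg_neg, Function.update_self]
      have h2 := c.XX_w0 hs hS hij (grsym τ (sy τ s m (u a)))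
      rw [grsym_top c.hτ, grsym_top c.hτ] at h2
      rw [← h2, XX, XX]
      congr 4
      funext l
      by_cases hl : l = j.succAbove i'
      · subst hl; simp
      · simp [ee, hl]
    · intro t _ ht
      rw [XX, Fin.removeNth_update_succAbove, c.ev_w0_y hs hS ha _ i']
      · simp
      · rw [Function.update_of_ne (Ne.symm ht)]
        simp [Fin.removeNth, ee]
    · simp

theorem Ctx.step (c : Ctx τ V P ε) (hφ : Near τ V φ) {m : ℕ} (hm : 2 ≤ m) (he : EqN τ V P ε m φ) :
    ∃ u : Fin n → Sm n, EqN τ V P ε (m + 1) (φ + u) ∧ (∀ i, VO τ Set.univ m (u i)) ∧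
      ∀ i t z, u i (scl τ t z) = t ^ m * u i z := by
  let L1 : (Fin (q + 1) → homogeneousSubmodule (Fin (q + 1)) ℝ m) →ₗ[ℝ]
      (Fin (q + 1) → MvPolynomial (Fin (q + 1)) ℝ) :=
    { toFun := fun e j => opL ε (fun i => (e i : MvPolynomial (Fin (q + 1)) ℝ)) j
      map_add' := fun e e' => by
        funext j
        simp only [Pi.add_apply, Submodule.coe_add]
        exact opL_add ε _ _ j
      map_smul' := fun r e => by
        funext j
        simp only [Pi.smul_apply, Submodule.coe_smul, RingHom.id_apply, smul_eq_C_mul]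
        exact opL_C ε r _ j }
  let L2 : (Unit → homogeneousSubmodule (Fin (q + 1)) ℝ m) →ₗ[ℝ]
      (Fin (q + 1) × Fin (q + 1) → MvPolynomial (Fin (q + 1)) ℝ) :=
    { toFun := fun e p => - (fl ε p.1 * pderiv p.2 (e () : MvPolynomial (Fin (q + 1)) ℝ) -
        fl ε p.2 * pderiv p.1 (e () : MvPolynomial (Fin (q + 1)) ℝ))
      map_add' := fun e e' => by
        funext j
        simp only [Pi.add_apply, Submodule.coe_add, map_add]
        ring
      map_smul' := fun r e => by
        funext j
        simp only [Pi.smul_apply, Submodule.coe_smul, RingHom.id_apply, smul_eq_C_mul, pderiv_C_mul]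
        ring }
  obtain ⟨ux, h1, h2, h3⟩ := realize (V := V) c.hτ L1 (fun j => er τ P ε φ j) (by
    intro s hs hS
    obtain ⟨ξ, hξ, hL⟩ := c.symH hφ (by omega) he hs hS
    exact ⟨fun i => ⟨ξ i, hξ i⟩, funext hL⟩)
  have hy : ∀ a, (∀ j, τ j ≠ a) → ∃ v : Sm n, (∀ s ∈ V, s ∈ SS τ → ∀ i j, i ≠ j →
      fl ε i * pderiv j (sy τ s m v) - fl ε j * pderiv i (sy τ s m v) = - sy τ s m (ex τ P φ i j a)) ∧
      (∀ t z, v (scl τ t z) = t ^ m * v z) ∧ VO τ Set.univ m v := by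
    intro a ha
    obtain ⟨v, h1, h2, h3⟩ := realize (V := V) c.hτ L2 (fun p => if p.1 = p.2 then 0 else ex τ P φ p.1 p.2 a) (by
      intro s hs hS
      obtain ⟨G, hG, hL⟩ := c.symG hφ (by omega) he hs hS a ha
      refine ⟨fun i => - ⟨G, hG⟩, funext fun p => ?_⟩
      show - (fl ε p.1 * pderiv p.2 (-G) - fl ε p.2 * pderiv p.1 (-G)) = _
      rw [hL p.1 p.2, map_neg, map_neg]; ring)
    refine ⟨v (), ?_, h2 (), h3 ()⟩
    intro s hs hS i j hij
    obtain ⟨e, he, hk⟩ := h1 s hs hS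
    have := congrFun he (i, j)
    simp only [if_neg hij] at this
    rw [← this, hk]
    simp [L2]
  choose! uy y1 y2 y3 using hy
  have ut : ∀ j, Function.extend τ ux uy (τ j) = ux j := fun j => c.hτ.extend_apply ux uy j
  have uo : ∀ a, (∀ j, τ j ≠ a) → Function.extend τ ux uy a = uy a := fun a ha =>
    Function.extend_apply' _ _ _ (by rintro ⟨j, hj⟩; exact ha j hj)
  have hvo : ∀ i, VO τ Set.univ m (Function.extend τ ux uy i) := by
    intro i
    by_cases hi : ∃ j, τ j = i
    · obtain ⟨j, rfl⟩ := hi; rw [ut]; exact h3 j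
    · push Not at hi; rw [uo i hi]; exact y3 i hi
  have hvo' : ∀ i, VO τ V m (Function.extend τ ux uy i) := fun i s _ hS => hvo i s trivial hS
  refine ⟨Function.extend τ ux uy, ⟨?_, ?_⟩, hvo, ?_⟩
  · intro j s hs hS
    have l1 := c.lin_er hφ hm hvo' hs hS j
    have l2 := (he.1 j).lead hs hS
    have l3 := l1.add l2
    rw [← map_add, sub_add_cancel] at l3
    obtain ⟨e, he', hk⟩ := h1 s hs hS
    have e2 : opL ε (fun i => sy τ s m (Function.extend τ ux uy (τ i))) j = sy τ s m (er τ P ε φ j) := by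
      simp only [ut, hk]
      exact congrFun he' j
    rw [e2, neg_add_cancel, lead_zero_iff] at l3
    exact l3
  · intro a ha i j hij s hs hS
    have l1 := c.lin_ex hφ hm hvo' hs hS hij ha
    have l2 := (he.2 a ha i j hij).lead hs hS
    have l3 := l1.add l2
    rw [← map_add, sub_add_cancel, uo a ha, y1 a ha s hs hS i j hij, neg_add_cancel, lead_zero_iff] at l3
    exact l3
  · intro i
    by_cases hi : ∃ j, τ j = i
    · obtain ⟨j, rfl⟩ := hi; rw [ut]; exact h2 j
    · push Not at hi; rw [uo i hi]; exact y2 i hi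

theorem Near.add (hφ : Near τ V φ) {m : ℕ} (hm : 2 ≤ m) {u : Fin n → Sm n} (hu : ∀ i, VO τ Set.univ m (u i)) :
    Near τ V (φ + u) := by
  intro i s hs hS
  rw [show (φ + u) i - co i = (φ i - co i) + u i by rw [Pi.add_apply]; ring, map_add]
  exact dvd_add (hφ i s hs hS) (dvd_of_le (hu i s trivial hS) hm)

/-- The formal solution. -/
theorem Ctx.formal (c : Ctx τ V P ε) : ∃ u : ℕ → Fin n → Sm n,
    (∀ m i, VO τ Set.univ (m + 2) (u m i)) ∧ (∀ m i t z, u m i (scl τ t z) = t ^ (m + 2) * u m i z) ∧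
    ∀ m, Near τ V (co + ∑ l ∈ Finset.range m, u l) ∧ EqN τ V P ε (m + 2) (co + ∑ l ∈ Finset.range m, u l) := by
  classical
  have hst : ∀ (m : ℕ) (φ : Fin n → Sm n), ∃ u : Fin n → Sm n, (∀ i, VO τ Set.univ (m + 2) (u i)) ∧
      (∀ i t z, u i (scl τ t z) = t ^ (m + 2) * u i z) ∧
      (Near τ V φ → EqN τ V P ε (m + 2) φ → EqN τ V P ε (m + 3) (φ + u)) := by
    intro m φ
    by_cases h : Near τ V φ ∧ EqN τ V P ε (m + 2) φ
    · obtain ⟨u, h1, h2, h3⟩ := c.step h.1 (by omega) h.2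
      exact ⟨u, h2, h3, fun _ _ => h1⟩
    · refine ⟨0, fun i s _ _ => by simp, fun i t z => by simp, fun a b => absurd ⟨a, b⟩ h⟩
  choose U hU1 hU2 hU3 using hst
  let φs : ℕ → Fin n → Sm n := fun m => Nat.rec co (fun m φ => φ + U m φ) m
  have hφs : ∀ m, φs (m + 1) = φs m + U m (φs m) := fun m => rfl
  have hsum : ∀ m, φs m = co + ∑ l ∈ Finset.range m, U l (φs l) := by
    intro m
    induction m with
    | zero => simp [φs]
    | succ m ih => rw [hφs, Finset.sum_range_succ, ← add_assoc, ← ih]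
  refine ⟨fun m => U m (φs m), fun m => hU1 m _, fun m => hU2 m _, fun m => ?_⟩
  rw [← hsum]
  induction m with
  | zero => exact ⟨near_co, c.e1⟩
  | succ m ih =>
    rw [hφs]
    exact ⟨ih.1.add (m := m + 2) (by omega) (hU1 m _), hU3 m _ ih.1 ih.2⟩

end Step
end NambuLin

namespace NambuLin

section Link
variable {n N : ℕ} {τ : Fin N → Fin n} {V : Set (Fin n → ℝ)} {s : Fin n → ℝ}

/-- derivatives of order `< m` vanish at `s` -/
def FV (m : ℕ) (s : Fin n → ℝ) (F : Sm n) : Prop :=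
  ∀ k < m, iteratedFDeriv ℝ k (F : (Fin n → ℝ) → ℝ) s = 0

theorem fderiv_fun_eq (F : Sm n) : fderiv ℝ (F : (Fin n → ℝ) → ℝ) =
    fun z => ∑ i, (ContinuousLinearMap.smulRight (1 : ℝ →L[ℝ] ℝ)
      (ContinuousLinearMap.proj i : (Fin n → ℝ) →L[ℝ] ℝ)) ((pd i F : Sm n) z) := by
  funext z
  ext v
  rw [fderiv_eq_sum_pd]
  simp [mul_comm]

theorem FV.pdv {m : ℕ} {F : Sm n} (h : FV (m + 1) s F) (i : Fin n) : FV m s (pd i F) := by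
  intro k hk
  have h1 : iteratedFDeriv ℝ k (fderiv ℝ (F : (Fin n → ℝ) → ℝ)) s = 0 := by
    rw [← norm_eq_zero, norm_iteratedFDeriv_fderiv, h (k + 1) (by omega), norm_zero]
  have h2 : ((NambuLin.pd i F : Sm n) : (Fin n → ℝ) → ℝ) =
      (ContinuousLinearMap.apply ℝ ℝ (Pi.single i 1 : Fin n → ℝ)) ∘ (fderiv ℝ (F : (Fin n → ℝ) → ℝ)) := by
    funext z; rw [pd_apply]; rfl
  have h3 : ContDiff ℝ ∞ (fderiv ℝ (F : (Fin n → ℝ) → ℝ)) := (Sm.smooth F).fderiv_right (by norm_cast)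
  rw [h2, ContinuousLinearMap.iteratedFDeriv_comp_left _ h3.contDiffAt (by exact_mod_cast le_top), h1]
  ext; simp

theorem FV.succ' {m : ℕ} {F : Sm n} (h0 : F s = 0) (h : ∀ i, FV m s (pd i F)) : FV (m + 1) s F := by
  intro k hk
  rcases k with _ | k
  · ext; simp [h0]
  · rw [← norm_eq_zero, ← norm_iteratedFDeriv_fderiv, norm_eq_zero, fderiv_fun_eq]
    have hsm : ∀ i, ContDiff ℝ ∞ (fun z => (ContinuousLinearMap.smulRight (1 : ℝ →L[ℝ] ℝ)
      (ContinuousLinearMap.proj i : (Fin n → ℝ) →L[ℝ] ℝ)) ((NambuLin.pd i F : Sm n) z)) := fun i =>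
      (ContinuousLinearMap.contDiff _).comp (Sm.smooth (NambuLin.pd i F))
    rw [iteratedFDeriv_sum (fun i _ => (hsm i).of_le (by exact_mod_cast le_top)), Finset.sum_apply]
    refine Finset.sum_eq_zero fun i _ => ?_
    have := ContinuousLinearMap.iteratedFDeriv_comp_left (ContinuousLinearMap.smulRight (1 : ℝ →L[ℝ] ℝ)
      (ContinuousLinearMap.proj i : (Fin n → ℝ) →L[ℝ] ℝ)) (x := s) (n := ∞) (Sm.smooth (NambuLin.pd i F)).contDiffAt (i := k)
      (by exact_mod_cast le_top)
    refine this.trans ?_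
    rw [h i k (by omega)]
    ext; simp

theorem FV.val {m : ℕ} {F : Sm n} (h : FV (m + 1) s F) : F s = 0 := by
  have := congrArg (fun L => L 0) (h 0 (by omega))
  simpa using this

theorem FV.syz (m : ℕ) : ∀ (F : Sm n), FV (m + 1) s F → sy τ s m F = 0 := by
  induction m with
  | zero => intro F h; rw [sy_zero, h.val, map_zero]
  | succ m ih =>
    intro F h
    rw [sy_succ, Finset.sum_eq_zero, mul_zero]
    intro i _
    rw [ih _ (h.pdv (τ i)), mul_zero]

theorem FV.dvd {m : ℕ} {F : Sm n} (h : FV m s F) : PowerSeries.X ^ m ∣ TT τ s F := by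
  rw [PowerSeries.X_pow_dvd_iff]
  intro l hl
  rw [coeff_TT]
  exact FV.syz l F fun k hk => h k (by omega)

theorem VO.fv (hV : IsOpen V) (m : ℕ) : ∀ (F : Sm n), VO τ V m F → ∀ s ∈ V, s ∈ SS τ → FV m s F := by
  induction m with
  | zero => intro F h s _ _ k hk; omega
  | succ m ih =>
    intro F h s hs hS
    refine FV.succ' ?_ fun i => ih _ (h.pd_any hV i) s hs hS
    have h1 := h s hs hS
    rw [PowerSeries.X_pow_dvd_iff] at h1
    have h2 := h1 0 (by omega)
    rw [coeff_TT, sy_zero] at h2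
    simpa using h2

theorem scl_norm (τ : Fin N → Fin n) {t : ℝ} (ht : 1 ≤ t) : ‖scl τ t‖ ≤ t := by
  refine ContinuousLinearMap.opNorm_le_bound _ (by linarith) fun z => ?_
  rw [pi_norm_le_iff_of_nonneg (by positivity)]
  intro k
  have h1 := norm_le_pi_norm z k
  by_cases hk : ∃ j, τ j = k
  · obtain ⟨j, rfl⟩ := hk
    rw [scl_top, norm_mul, Real.norm_of_nonneg (by linarith : (0:ℝ) ≤ t)]
    gcongr
  · push Not at hk
    rw [scl_other _ _ _ hk]
    nlinarith [norm_nonneg z]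

/-- One cut-off term. -/
theorem cutoff (τ : Fin N → Fin n) (l : ℕ) (u : Sm n) (hu : ∀ t z, u (scl τ t z) = t ^ (l + 2) * u z)
    {δ : ℝ} (hδ : 0 < δ) :
    ∃ w : Sm n, (∀ s ∈ Metric.ball (0 : Fin n → ℝ) 1, s ∈ SS τ → (w : (Fin n → ℝ) → ℝ) =ᶠ[nhds s] u) ∧
      ∀ k ≤ l + 1, ∀ z, ‖iteratedFDeriv ℝ k (w : (Fin n → ℝ) → ℝ) z‖ ≤ δ := by
  let b : ContDiffBump (0 : Fin n → ℝ) := ⟨1, 2, by norm_num, by norm_num⟩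
  have hb : ContDiff ℝ ∞ (b : (Fin n → ℝ) → ℝ) := b.contDiff
  let g : Sm n := mkSm _ hb * u
  have hgc : HasCompactSupport (g : (Fin n → ℝ) → ℝ) := b.hasCompactSupport.mul_right
  have hbd : ∀ k : ℕ, ∃ C : ℝ, ∀ z, ‖iteratedFDeriv ℝ k (g : (Fin n → ℝ) → ℝ) z‖ ≤ C := fun k =>
    (hgc.iteratedFDeriv k).exists_bound_of_continuous
      ((Sm.smooth g).continuous_iteratedFDeriv (m := k) (by exact_mod_cast le_top))
  choose C hC using hbd
  have hC0 : ∀ k, 0 ≤ C k := fun k => (norm_nonneg _).trans (hC k 0)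
  set t : ℝ := 1 + (∑ k ∈ Finset.range (l + 2), C k) / δ with ht
  have hsum : 0 ≤ ∑ k ∈ Finset.range (l + 2), C k := Finset.sum_nonneg fun k _ => hC0 k
  have ht1 : 1 ≤ t := by have := div_nonneg hsum hδ.le; linarith
  have ht0 : t ≠ 0 := by linarith
  have hcomp : ContDiff ℝ ∞ (fun z => b (scl τ t z)) := hb.comp (scl τ t).contDiff
  refine ⟨mkSm _ hcomp * u, ?_, ?_⟩
  · intro s hs hS
    have h1 : ∀ᶠ z in nhds s, scl τ t z ∈ Metric.ball (0 : Fin n → ℝ) 1 :=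
      (scl τ t).continuous.continuousAt.preimage_mem_nhds (by
        rw [scl_S hS]; exact Metric.isOpen_ball.mem_nhds hs)
    filter_upwards [h1] with z hz
    rw [Sm.mul_ap, mkSm_apply, b.one_of_mem_closedBall (Metric.ball_subset_closedBall hz), one_mul]
  · intro k hk z
    have e : ((mkSm _ hcomp * u : Sm n) : (Fin n → ℝ) → ℝ) =
        (t ^ (l + 2))⁻¹ • ((g : (Fin n → ℝ) → ℝ) ∘ scl τ t) := by
      funext z
      show b (scl τ t z) * u z = (t ^ (l + 2))⁻¹ * (b (scl τ t z) * u (scl τ t z))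
      rw [hu]; field_simp
    have hk' : (k : WithTop ℕ∞) ≤ ∞ := by exact_mod_cast le_top
    rw [e, iteratedFDeriv_const_smul_apply (((Sm.smooth g).comp (scl τ t).contDiff).contDiffAt.of_le hk'),
      norm_smul, ContinuousLinearMap.iteratedFDeriv_comp_right _ (Sm.smooth g) z hk']
    have h1 := ContinuousMultilinearMap.norm_compContinuousLinearMap_le
      (iteratedFDeriv ℝ k (g : (Fin n → ℝ) → ℝ) (scl τ t z)) (fun _ => scl τ t)
    rw [Finset.prod_const, Finset.card_univ, Fintype.card_fin] at h1
    have h2 : ‖(t ^ (l + 2))⁻¹‖ = (t ^ (l + 2))⁻¹ := Real.norm_of_nonneg (by positivity)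
    rw [h2]
    have h3 : C k ≤ ∑ k ∈ Finset.range (l + 2), C k :=
      Finset.single_le_sum (fun k _ => hC0 k) (Finset.mem_range.2 (by omega))
    have h4 : C k ≤ δ * t := by
      have : δ * t = δ + ∑ k ∈ Finset.range (l + 2), C k := by rw [ht]; field_simp
      linarith
    have h5 : ‖scl τ t‖ ^ k ≤ t ^ (l + 1) :=
      (pow_le_pow_left₀ (norm_nonneg _) (scl_norm τ ht1) k).trans (pow_le_pow_right₀ ht1 hk)
    calc (t ^ (l + 2))⁻¹ * _ ≤ (t ^ (l + 2))⁻¹ * (C k * t ^ (l + 1)) := by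
          refine mul_le_mul_of_nonneg_left (h1.trans ?_) (by positivity)
          exact mul_le_mul (hC k _) h5 (by positivity) (hC0 k)
      _ ≤ (t ^ (l + 2))⁻¹ * ((δ * t) * t ^ (l + 1)) := by gcongr
      _ = δ := by field_simp; ring

/-- Borel lemma. -/
theorem borel (τ : Fin N → Fin n) (u : ℕ → Sm n) (hu : ∀ l t z, u l (scl τ t z) = t ^ (l + 2) * u l z)
    (hv : ∀ l, VO τ Set.univ (l + 2) (u l)) :
    ∃ F : Sm n, ∀ m, VO τ (Metric.ball (0 : Fin n → ℝ) 1) (m + 2) (F - ∑ l ∈ Finset.range m, u l) := by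
  have h := fun l => cutoff τ l (u l) (hu l) (δ := (1 / 2) ^ l) (by positivity)
  choose w hw1 hw2 using h
  have hsm : ContDiff ℝ ∞ (fun z => ∑' l, w l z) := by
    refine contDiff_tsum_of_eventually (N := ⊤) (v := fun _ l => (1 / 2 : ℝ) ^ l) (fun l => Sm.smooth (w l))
      (fun _ _ => summable_geometric_of_lt_one (by norm_num) (by norm_num)) fun k _ => ?_
    rw [Nat.cofinite_eq_atTop]
    filter_upwards [Filter.eventually_ge_atTop k] with l hl z
    exact hw2 l k (by omega) z
  refine ⟨mkSm _ hsm, fun m s hs hS => FV.dvd ?_⟩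
  have hsum : ∀ z, Summable fun l => w l z := by
    intro z
    refine Summable.of_norm_bounded (summable_geometric_of_lt_one (r := (1/2 : ℝ)) (by norm_num) (by norm_num)) fun l => ?_
    have := hw2 l 0 (by omega) z
    rwa [norm_iteratedFDeriv_zero] at this
  have e : ((mkSm _ hsm - ∑ l ∈ Finset.range m, u l : Sm n) : (Fin n → ℝ) → ℝ) =ᶠ[nhds s]
      fun z => ∑' l, w (l + m) z := by
    have h1 : ∀ᶠ z in nhds s, ∀ l ∈ Finset.range m, w l z = u l z := by
      rw [Filter.eventually_all_finset]
      exact fun l _ => hw1 l s hs hS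
    filter_upwards [h1] with z hz
    rw [Sm.sub_ap, mkSm_apply, Sm.sum_ap, ← (hsum z).sum_add_tsum_nat_add m, ← Finset.sum_congr rfl hz]
    ring
  intro k hk
  rw [(e.iteratedFDeriv ℝ k).eq_of_nhds]
  rw [iteratedFDeriv_tsum_apply (N := (m + 1 : ℕ)) (v := fun _ l => (1 / 2 : ℝ) ^ (l + m)) (fun l => (Sm.smooth (w (l + m))).of_le (by exact_mod_cast le_top))
    (fun _ _ => (summable_nat_add_iff m).2 (summable_geometric_of_lt_one (by norm_num) (by norm_num)))
    (fun k l z hk => hw2 (l + m) k (by have : k ≤ m + 1 := by exact_mod_cast hk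
                                       omega) z) (by exact_mod_cast (by omega : k ≤ m + 1))]
  rw [tsum_congr (g := fun _ => 0), tsum_zero]
  intro l
  rw [((hw1 (l + m) s hs hS).iteratedFDeriv ℝ k).eq_of_nhds]
  exact (hv (l + m)).fv isOpen_univ _ _ s trivial hS k (by omega)

end Link

section Smooth
variable {n q : ℕ} {τ : Fin (q + 1) → Fin n} {V V' : Set (Fin n → ℝ)} {P : Idx n q → Sm n}
    {ε : Fin (q + 1) → ℝ} {φ : Fin n → Sm n}

theorem VO.sub {N m : ℕ} {τ : Fin N → Fin n} {F : Sm n} (h : VO τ V m F) (hV : V' ⊆ V) : VO τ V' m F :=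
  fun s hs hS => h s (hV hs) hS

theorem EqN.sub {m : ℕ} (h : EqN τ V P ε m φ) (hV : V' ⊆ V) : EqN τ V' P ε m φ :=
  ⟨fun j => (h.1 j).sub hV, fun a ha i j hij => (h.2 a ha i j hij).sub hV⟩

theorem Ctx.sub (c : Ctx τ V P ε) (hV : V' ⊆ V) (hV' : IsOpen V') : Ctx τ V' P ε :=
  ⟨c.hτ, c.hq, c.hqn, c.hε, hV', fun z hz => c.good z (hV hz), fun I => (c.p1 I).sub hV, c.e1.sub hV⟩

/-- The smooth solution. -/
theorem Ctx.smooth (c : Ctx τ V P ε) : ∃ Φ : Fin n → Sm n,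
    Near τ (V ∩ Metric.ball 0 1) Φ ∧ ∀ m, EqN τ (V ∩ Metric.ball 0 1) P ε (m + 2) Φ := by
  obtain ⟨u, h1, h2, h3⟩ := c.formal
  have hb := fun i => borel τ (fun l => u l i) (fun l => h2 l i) (fun l => h1 l i)
  choose F hF using hb
  have c' := c.sub (V' := V ∩ Metric.ball 0 1) Set.inter_subset_left (c.hV.inter Metric.isOpen_ball)
  refine ⟨co + F, ?_, ?_⟩
  · intro i
    rw [Pi.add_apply, add_sub_cancel_left]
    have := (hF i 0).sub (V' := V ∩ Metric.ball 0 1) Set.inter_subset_right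
    simpa using this
  · intro m
    have hn : Near τ (V ∩ Metric.ball 0 1) (co + ∑ l ∈ Finset.range m, u l) :=
      fun i => ((h3 m).1 i).sub Set.inter_subset_left
    have he := (h3 m).2.sub (V' := V ∩ Metric.ball 0 1) Set.inter_subset_left
    set φ := co + ∑ l ∈ Finset.range m, u l with hφ
    have e : co + F = φ + (F - ∑ l ∈ Finset.range m, u l) := by rw [hφ]; abel
    have hw : ∀ i, VO τ (V ∩ Metric.ball 0 1) (m + 2) ((F - ∑ l ∈ Finset.range m, u l) i) := by
      intro i
      rw [Pi.sub_apply, Finset.sum_apply]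
      exact (hF i m).sub Set.inter_subset_right
    rw [e]
    refine ⟨fun j s hs hS => ?_, fun a ha i j hij s hs hS => ?_⟩
    · have := (c'.lin_er hn (by omega) hw hs hS j).dvd
      have h := dvd_add this (he.1 j s hs hS)
      rwa [← map_add, sub_add_cancel] at h
    · have := (c'.lin_ex hn (by omega) hw hs hS hij ha).dvd
      have h := dvd_add this (he.2 a ha i j hij s hs hS)
      rwa [← map_add, sub_add_cancel] at h

end Smooth
end NambuLin

namespace NambuLin

section Inv
variable {n : ℕ}

/-- the map with given components -/
def mp (Φ : Fin n → Sm n) : (Fin n → ℝ) → (Fin n → ℝ) := fun z i => Φ i z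

/-- its Jacobian matrix -/
noncomputable def jm (Φ : Fin n → Sm n) (z : Fin n → ℝ) : Matrix (Fin n) (Fin n) ℝ :=
  Matrix.of fun i j => pd j (Φ i) z

theorem mp_smooth (Φ : Fin n → Sm n) : ContDiff ℝ ∞ (mp Φ) :=
  contDiff_pi.2 fun i => Sm.smooth (Φ i)

theorem mp_diff (Φ : Fin n → Sm n) (z : Fin n → ℝ) : DifferentiableAt ℝ (mp Φ) z :=
  (mp_smooth Φ).differentiable (by simp) z

theorem fderiv_mp (Φ : Fin n → Sm n) (z v : Fin n → ℝ) (i : Fin n) :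
    fderiv ℝ (mp Φ) z v i = fderiv ℝ (Φ i : (Fin n → ℝ) → ℝ) z v := by
  have : fderiv ℝ (mp Φ) z = ContinuousLinearMap.pi fun i => fderiv ℝ (Φ i : (Fin n → ℝ) → ℝ) z :=
    fderiv_pi fun i => Sm.diff (Φ i) z
  rw [this]; rfl

theorem jac_mp (Φ : Fin n → Sm n) (z : Fin n → ℝ) : jac (mp Φ) z = jm Φ z := by
  ext i j
  rw [jac, jm, Matrix.of_apply, Matrix.of_apply, fderiv_mp, pd_apply]

theorem fderiv_mp_mulVec (Φ : Fin n → Sm n) (z v : Fin n → ℝ) :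
    fderiv ℝ (mp Φ) z v = (jm Φ z).mulVec v := by
  funext i
  rw [fderiv_mp, fderiv_eq_sum_pd]
  simp [jm, Matrix.mulVec, dotProduct, mul_comm]

theorem jm_det_cont (Φ : Fin n → Sm n) : Continuous fun z => (jm Φ z).det := by
  refine Continuous.matrix_det ?_
  refine continuous_matrix fun i j => ?_
  exact (Sm.smooth (pd j (Φ i))).continuous

theorem hasFDeriv_mp (Φ : Fin n → Sm n) (p : Fin n → ℝ) (h : (jm Φ p).det ≠ 0) :
    ∃ L : (Fin n → ℝ) ≃L[ℝ] (Fin n → ℝ), HasFDerivAt (mp Φ) (L : (Fin n → ℝ) →L[ℝ] (Fin n → ℝ)) p := by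
  have : Invertible (jm Φ p) := Matrix.invertibleOfIsUnitDet _ (isUnit_iff_ne_zero.2 h)
  refine ⟨(Matrix.toLinearEquiv' (jm Φ p) this).toContinuousLinearEquiv, ?_⟩
  have h2 := (mp_diff Φ p).hasFDerivAt
  convert h2 using 1
  ext1 v
  rw [fderiv_mp_mulVec]
  rfl

theorem ift (Φ : Fin n → Sm n) (p : Fin n → ℝ) (h : (jm Φ p).det ≠ 0) :
    ∃ W0 : Set (Fin n → ℝ), IsOpen W0 ∧ p ∈ W0 ∧ ∃ ψ : (Fin n → ℝ) → (Fin n → ℝ),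
      (∀ W ⊆ W0, IsOpen W → IsOpen (mp Φ '' W)) ∧ (∀ x ∈ W0, ψ (mp Φ x) = x) ∧
      ContDiffOn ℝ ∞ ψ (mp Φ '' W0) := by
  obtain ⟨L, hL⟩ := hasFDeriv_mp Φ p h
  let e := (mp_smooth Φ).contDiffAt.toOpenPartialHomeomorph (mp Φ) hL (by simp)
  have he : (e : (Fin n → ℝ) → (Fin n → ℝ)) = mp Φ := ContDiffAt.toOpenPartialHomeomorph_coe _ hL (by simp)
  have hp : p ∈ e.source := ContDiffAt.mem_toOpenPartialHomeomorph_source _ hL (by simp)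
  refine ⟨e.source ∩ {z | (jm Φ z).det ≠ 0},
    e.open_source.inter (isOpen_ne_fun (jm_det_cont Φ) continuous_const), ⟨hp, h⟩, e.symm, ?_, ?_, ?_⟩
  · intro W hW hWo
    rw [← he]
    exact e.isOpen_image_of_subset_source hWo (hW.trans Set.inter_subset_left)
  · intro x hx
    rw [← he]; exact e.left_inv hx.1
  · rintro _ ⟨x, hx, rfl⟩
    refine ContDiffAt.contDiffWithinAt ?_
    obtain ⟨L', hL'⟩ := hasFDeriv_mp Φ x hx.2
    have hx1 : e.symm (mp Φ x) = x := by rw [← he]; exact e.left_inv hx.1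
    refine e.contDiffAt_symm (f₀' := L') ?_ ?_ ?_
    · rw [← he]; exact e.map_source hx.1
    · rw [hx1, he]; exact hL'
    · rw [he]; exact (mp_smooth Φ).contDiffAt

/-- Normal form property. -/
def NF (n q k : ℕ) (P : Idx n q → Sm n) : Prop :=
  ∀ U : Set (Fin n → ℝ), IsOpen U → (0 : Fin n → ℝ) ∈ U →
    ∃ W : Set (Fin n → ℝ), W ⊆ U ∧ (0 : Fin n → ℝ) ∈ W ∧ IsOpen W ∧
      ∃ φ ψ : (Fin n → ℝ) → (Fin n → ℝ),
        IsOpen (φ '' W) ∧ ContDiffOn ℝ ∞ φ W ∧ ContDiffOn ℝ ∞ ψ (φ '' W) ∧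
        (∀ x ∈ W, ψ (φ x) = x) ∧ (∀ y ∈ φ '' W, φ (ψ y) = y) ∧ φ 0 = 0 ∧
        ∀ y ∈ φ '' W, (∀ j : Fin n, (j : ℕ) < q + 1 → y j = 0) →
          ∀ l : ℕ, iteratedFDerivWithin ℝ l
            (fun z => extPow n q (jac φ (ψ z)) (at' P (ψ z)) - modelPi n q k z) (φ '' W) y = 0

theorem extPow_jm {q : ℕ} (Φ : Fin n → Sm n) (P : Idx n q → Sm n) (z : Fin n → ℝ) (J : Idx n q) :
    extPow n q (jm Φ z) (at' P z) J = ev P (fun a => gr (Φ (J.1.orderEmbOfFin J.2 a))) z := by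
  rw [extPow_apply, ev_z]
  rfl

theorem flat_comp {ι : Type} [Fintype ι] (E : ι → Sm n) (ψ : (Fin n → ℝ) → (Fin n → ℝ))
    (O : Set (Fin n → ℝ)) (hO : IsOpen O) (hψ : ContDiffOn ℝ ∞ ψ O) (y : Fin n → ℝ) (hy : y ∈ O)
    (hE : ∀ i m, FV m (ψ y) (E i)) (l : ℕ) :
    iteratedFDerivWithin ℝ l (fun z i => E i (ψ z)) O y = 0 := by
  let g : (Fin n → ℝ) → (ι → ℝ) := fun z i => E i z
  have hg : ContDiff ℝ ∞ g := contDiff_pi.2 fun i => Sm.smooth (E i)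
  have hg0 : ∀ k, iteratedFDeriv ℝ k g (ψ y) = 0 := by
    intro k
    ext v i
    have h1 := ContinuousLinearMap.iteratedFDeriv_comp_left
      (ContinuousLinearMap.proj i : (ι → ℝ) →L[ℝ] ℝ) (x := ψ y) (n := ∞) hg.contDiffAt (i := k)
      (by exact_mod_cast le_top)
    have h2 : (⇑(ContinuousLinearMap.proj i : (ι → ℝ) →L[ℝ] ℝ) ∘ g) = (E i : (Fin n → ℝ) → ℝ) := rfl
    rw [h2, hE i (k + 1) k (by omega)] at h1
    have := congrArg (fun L => L v) h1
    simpa using this.symm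
  rw [← norm_le_zero_iff]
  have hD : ∀ i, 1 ≤ i → i ≤ l → ‖iteratedFDerivWithin ℝ i ψ O y‖ ≤
      (1 + ∑ j ∈ Finset.range (l + 1), ‖iteratedFDerivWithin ℝ j ψ O y‖) ^ i := by
    intro i hi hil
    have h1 : ‖iteratedFDerivWithin ℝ i ψ O y‖ ≤ ∑ j ∈ Finset.range (l + 1), ‖iteratedFDerivWithin ℝ j ψ O y‖ :=
      Finset.single_le_sum (f := fun j => ‖iteratedFDerivWithin ℝ j ψ O y‖) (fun _ _ => norm_nonneg _) (by simp; omega)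
    have h0 : 0 ≤ ∑ j ∈ Finset.range (l + 1), ‖iteratedFDerivWithin ℝ j ψ O y‖ :=
      Finset.sum_nonneg fun _ _ => norm_nonneg _
    calc _ ≤ 1 + ∑ j ∈ Finset.range (l + 1), ‖iteratedFDerivWithin ℝ j ψ O y‖ := by linarith
      _ ≤ _ := le_self_pow₀ (by linarith) (by omega)
  have := norm_iteratedFDerivWithin_comp_le (n := l) (N := ∞) hg.contDiffOn hψ (by exact_mod_cast le_top)
    uniqueDiffOn_univ hO.uniqueDiffOn (Set.mapsTo_univ _ _) hy (C := 0)
    (fun i _ => by rw [iteratedFDerivWithin_univ, hg0, norm_zero]) hD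
  have h3 : ‖iteratedFDerivWithin ℝ l (g ∘ ψ) O y‖ ≤ 0 := by simpa using this
  exact h3

end Inv

section A
variable {n q : ℕ}

/-- Error of normalization. -/
noncomputable def EE (k : ℕ) (P : Idx n q → Sm n) (Φ : Fin n → Sm n) (J : Idx n q) : Sm n :=
  ev P (fun a => gr (Φ (J.1.orderEmbOfFin J.2 a))) -
    ∑ j : Fin n, if ((j : ℕ) < q + 1 ∧ (J : Finset (Fin n)) = (topIdx n q).erase j)
      then ((-1 : ℝ) ^ (j : ℕ) * eps k j) • Φ j else 0

theorem EE_apply (k : ℕ) (P : Idx n q → Sm n) (Φ : Fin n → Sm n) (z : Fin n → ℝ) (J : Idx n q) :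
    EE k P Φ J z = (extPow n q (jm Φ z) (at' P z) - modelPi n q k (mp Φ z)) J := by
  rw [EE, Pi.sub_apply, extPow_jm, Sm.sub_ap, Sm.sum_ap, modelPi]
  congr 1
  refine Finset.sum_congr rfl fun j _ => ?_
  split_ifs <;> simp [mp]

/-- inclusion of top indices -/
def tau (h : q < n) : Fin (q + 1) → Fin n := Fin.castLE (by omega)

theorem tau_inj (h : q < n) : Function.Injective (tau h) := Fin.castLE_injective _

theorem tau_val (h : q < n) (j) : (tau h j : ℕ) = j := rfl

theorem mem_SS (h : q < n) (y : Fin n → ℝ) : y ∈ SS (tau h) ↔ ∀ j : Fin n, (j : ℕ) < q + 1 → y j = 0 := by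
  refine ⟨fun hy j hj => ?_, fun hy j => hy _ (by rw [tau_val]; exact j.2)⟩
  exact hy ⟨j, hj⟩

theorem EE_vo (h : q < n) {k m : ℕ} {V : Set (Fin n → ℝ)} {P : Idx n q → Sm n} {Φ : Fin n → Sm n}
    (c : Ctx (tau h) V P (fun j => eps k j)) (hΦ : Near (tau h) V Φ)
    (he : EqN (tau h) V P (fun j => eps k j) m Φ) (J : Idx n q) : VO (tau h) V m (EE k P Φ J) := by
  intro s hs hS
  by_cases hJ : ∃ a ∈ J.1, ∀ j, tau h j ≠ a
  · obtain ⟨a, ha, hat⟩ := hJ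
    have haq : ¬ (a : ℕ) < q + 1 := fun hlt => hat ⟨a, hlt⟩ rfl
    have hz : (∑ j : Fin n, if ((j : ℕ) < q + 1 ∧ (J : Finset (Fin n)) = (topIdx n q).erase j)
      then ((-1 : ℝ) ^ (j : ℕ) * eps k j) • Φ j else 0) = 0 := by
      refine Finset.sum_eq_zero fun j _ => if_neg ?_
      rintro ⟨-, h2⟩
      rw [h2] at ha
      have := Finset.mem_of_mem_erase ha
      simp [topIdx] at this
      omega
    rw [EE, hz, sub_zero]
    have hr : a ∈ Set.range (J.1.orderEmbOfFin J.2) := by rw [Finset.range_orderEmbOfFin]; exact ha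
    obtain ⟨t, ht⟩ := hr
    exact c.d3' hΦ he hs hS hat _ t (by rw [ht])
  · push Not at hJ
    have hsub : J.1 ⊆ topIdx n q := by
      intro a ha
      obtain ⟨j, rfl⟩ := hJ a ha
      simp only [topIdx, Finset.mem_filter, Finset.mem_univ, true_and, tau_val]
      exact j.2
    have hcard : (topIdx n q).card = q + 1 := by
      have : topIdx n q = Finset.univ.map ⟨tau h, tau_inj h⟩ := by
        ext a
        simp only [topIdx, Finset.mem_filter, Finset.mem_univ, true_and, Finset.mem_map, Function.Embedding.coeFn_mk]
        exact ⟨fun h1 => ⟨⟨a, h1⟩, rfl⟩, by rintro ⟨j, rfl⟩; exact j.2⟩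
      rw [this, Finset.card_map, Finset.card_univ, Fintype.card_fin]
    have hd : (topIdx n q \ J.1).card = 1 := by
      rw [Finset.card_sdiff_of_subset hsub, hcard, J.2]; omega
    obtain ⟨b, hb⟩ := Finset.card_eq_one.1 hd
    have hbt : b ∈ topIdx n q \ J.1 := by rw [hb]; simp
    have hbt' := Finset.mem_sdiff.1 hbt
    obtain ⟨j0, rfl⟩ : ∃ j, tau h j = b := by
      have : (b : ℕ) < q + 1 := by simpa [topIdx] using hbt'.1
      exact ⟨⟨b, this⟩, rfl⟩
    have hJe : J.1 = (topIdx n q).erase (tau h j0) := by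
      rw [Finset.erase_eq, ← hb, Finset.sdiff_sdiff_eq_self hsub]
    have hemb : ∀ a, J.1.orderEmbOfFin J.2 a = tau h (j0.succAbove a) := by
      have := Finset.orderEmbOfFin_unique J.2 (f := fun a => tau h (j0.succAbove a)) (fun a => by
        rw [hJe, Finset.mem_erase]
        refine ⟨fun e => (Fin.succAbove_ne j0 a) (tau_inj h e), ?_⟩
        simp only [topIdx, Finset.mem_filter, Finset.mem_univ, true_and, tau_val]
        exact (j0.succAbove a).2) (fun a b hab => by
        have := (Fin.strictMono_succAbove j0) hab
        exact this)
      intro a; rw [← this]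
    have hE : EE k P Φ J = (-1) ^ (j0 : ℕ) * er (tau h) P (fun j => eps k j) Φ j0 := by
      rw [EE, Finset.sum_eq_single (tau h j0), if_pos ⟨j0.2, hJe⟩, er, ff]
      · have : (fun a => gr (Φ (J.1.orderEmbOfFin J.2 a))) = j0.removeNth (fam Φ (tau h)) := by
          funext a; rw [hemb]; rfl
        rw [this, mul_sub, ← mul_assoc, ← mul_pow]
        refine Sm.ext' fun z => ?_
        have e1 : ((-1 : Sm n) ^ (j0 : ℕ)) = algebraMap ℝ (Sm n) ((-1) ^ (j0 : ℕ)) := by simp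
        rw [e1]
        have e2 : eps k (tau h j0) = eps k j0 := rfl
        rw [tau_val, e2]
        simp only [Sm.sub_ap, Sm.mul_ap, Sm.smul_ap, Sm.algebraMap_ap, ← mul_pow]
        simp
        ring
      · intro b _ hb2
        refine if_neg ?_
        rintro ⟨h1, h2⟩
        have : b ∈ (topIdx n q) := by simpa [topIdx] using h1
        have hbJ : b ∉ J.1 := by rw [h2]; simp
        have : b ∈ topIdx n q \ J.1 := Finset.mem_sdiff.2 ⟨this, hbJ⟩
        rw [hb] at this
        exact hb2 (Finset.mem_singleton.1 this)
      · simp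
    rw [hE, map_mul]
    exact (he.1 j0 s hs hS).mul_left _

theorem thmA (h : q < n) {k : ℕ} {V : Set (Fin n → ℝ)} {P : Idx n q → Sm n}
    (c : Ctx (tau h) V P (fun j => eps k j)) (h0 : (0 : Fin n → ℝ) ∈ V) : NF n q k P := by
  intro U hU h0U
  obtain ⟨Φ, hN, hE⟩ := c.smooth
  set V' := V ∩ Metric.ball (0 : Fin n → ℝ) 1 with hV'
  have hV'o : IsOpen V' := c.hV.inter Metric.isOpen_ball
  have h0V' : (0 : Fin n → ℝ) ∈ V' := ⟨h0, by simp⟩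
  have c' := c.sub (V' := V') Set.inter_subset_left hV'o
  have hid : ∀ s ∈ V', s ∈ SS (tau h) → mp Φ s = s := by
    intro s hs hS
    funext i
    have := ((hN i).fv hV'o _ _ s hs hS).val
    simp only [Sm.sub_ap, co_apply] at this
    show Φ i s = s i
    linarith
  have h0S : (0 : Fin n → ℝ) ∈ SS (tau h) := fun j => rfl
  have hj : jm Φ 0 = 1 := by
    ext i j
    have h1 := (((hN i).fv hV'o _ _ 0 h0V' h0S).pdv j).val
    rw [map_sub, pd_co, Sm.sub_ap] at h1
    rw [jm, Matrix.of_apply, sub_eq_zero.1 h1, Matrix.one_apply]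
    by_cases hij : i = j
    · subst hij; simp
    · simp [hij, Ne.symm hij]
  obtain ⟨W0, hW0, h0W0, ψ, hop, hinv, hψ⟩ := ift Φ 0 (by rw [hj]; simp)
  set W1 := W0 ∩ (V' ∩ U) with hW1
  have hW1o : IsOpen W1 := hW0.inter (hV'o.inter hU)
  set W := W1 ∩ (mp Φ) ⁻¹' W1 with hW
  have hWo : IsOpen W := hW1o.inter (hW1o.preimage (mp_smooth Φ).continuous)
  have hWW0 : W ⊆ W0 := fun x hx => hx.1.1
  have hΦ0 := hid 0 h0V' h0S
  have h01 : (0 : Fin n → ℝ) ∈ W1 := ⟨h0W0, h0V', h0U⟩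
  refine ⟨W, fun x hx => hx.1.2.2, ⟨h01, by rw [Set.mem_preimage, hΦ0]; exact h01⟩, hWo, mp Φ, ψ,
    hop W hWW0 hWo, (mp_smooth Φ).contDiffOn, hψ.mono (Set.image_mono hWW0), fun x hx => hinv x (hWW0 hx),
    ?_, hΦ0, ?_⟩
  · rintro _ ⟨x, hx, rfl⟩
    rw [hinv x (hWW0 hx)]
  · rintro _ ⟨w, hw, rfl⟩ hy l
    have hyS := (mem_SS h _).2 hy
    have hy1 : mp Φ w ∈ W1 := hw.2
    have hfix := hid _ hy1.2.1 hyS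
    have hwy : mp Φ w = w := by
      have := hinv _ hy1.1
      rw [hfix, hinv w hw.1.1] at this
      exact this.symm
    have hc := flat_comp (EE k P Φ) ψ (mp Φ '' W) (hop W hWW0 hWo) (hψ.mono (Set.image_mono hWW0)) (mp Φ w)
      ⟨w, hw, rfl⟩ (fun J m => by
        rw [hinv w hw.1.1]
        have := ((EE_vo h c' hN (hE m) J).mono (l := m) (by omega))
        exact this.fv hV'o _ _ w hw.1.2.1 (by rw [← hwy]; exact hyS)) l
    rw [← hc]
    refine iteratedFDerivWithin_congr ?_ (Set.mem_image_of_mem _ hw) l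
    rintro _ ⟨x, hx, rfl⟩
    funext J
    simp only []
    rw [EE_apply, jac_mp, hinv x (hWW0 hx)]

end A
end NambuLin

namespace NambuLin

section Push
variable {n q : ℕ}

theorem extPow_zero' (A : Matrix (Fin n) (Fin n) ℝ) : extPow n q A 0 = 0 := by
  funext J
  simp [extPow]

/-- composition -/
noncomputable def cm (F : Sm n) (φ : Fin n → Sm n) : Sm n :=
  mkSm (fun z => F (mp φ z)) ((Sm.smooth F).comp (mp_smooth φ))

theorem cm_ap (F : Sm n) (φ : Fin n → Sm n) (z : Fin n → ℝ) : cm F φ z = F (mp φ z) := rfl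

theorem pd_cm (F : Sm n) (φ : Fin n → Sm n) (k : Fin n) (z : Fin n → ℝ) :
    pd k (cm F φ) z = ∑ m, pd m F (mp φ z) * pd k (φ m) z := by
  have h1 : fderiv ℝ (cm F φ : (Fin n → ℝ) → ℝ) z =
      (fderiv ℝ (F : (Fin n → ℝ) → ℝ) (mp φ z)).comp (fderiv ℝ (mp φ) z) :=
    fderiv_comp z (Sm.diff F _) (mp_diff φ z)
  rw [pd_apply, h1, ContinuousLinearMap.comp_apply, fderiv_eq_sum_pd]
  refine Finset.sum_congr rfl fun m _ => ?_
  rw [fderiv_mp, pd_apply k (φ m), mul_comm]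

theorem jac_comp (f : (Fin n → ℝ) → (Fin n → ℝ)) (φ : Fin n → Sm n) (z : Fin n → ℝ)
    (hf : DifferentiableAt ℝ f (mp φ z)) : jac (fun x => f (mp φ x)) z = jac f (mp φ z) * jm φ z := by
  have h1 : fderiv ℝ (fun x => f (mp φ x)) z = (fderiv ℝ f (mp φ z)).comp (fderiv ℝ (mp φ) z) :=
    fderiv_comp z hf (mp_diff φ z)
  ext i j
  rw [jac, Matrix.of_apply, h1, ContinuousLinearMap.comp_apply, Matrix.mul_apply]
  have h2 : fderiv ℝ (mp φ) z (Pi.single j 1) = ∑ m, (jm φ z m j) • (Pi.single m 1 : Fin n → ℝ) := by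
    funext m
    rw [fderiv_mp]
    simp [Finset.sum_apply, Pi.single_apply, jm, pd_apply]
  rw [h2, map_sum, Finset.sum_apply]
  refine Finset.sum_congr rfl fun m _ => ?_
  rw [map_smul, Pi.smul_apply, smul_eq_mul, mul_comm]; rfl

theorem thmB (k : ℕ) (φ : Fin n → Sm n) (hφ0 : mp φ 0 = 0) (hdet : (jm φ 0).det ≠ 0)
    (P : Idx n q → Sm n) (hP : ∀ᶠ z in nhds 0, GoodAt P z) :
    ∃ P' : Idx n q → Sm n, (∀ᶠ z in nhds 0, at' P' (mp φ z) = extPow n q (jm φ z) (at' P z)) ∧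
      (nhds 0 ≤ Filter.map (mp φ) (nhds 0)) ∧ (∀ᶠ z in nhds 0, GoodAt P' z) ∧
      (NF n q k P' → NF n q k P) := by
  obtain ⟨W0, hW0, h0W0, ψ, hop, hinv, hψ⟩ := ift φ 0 hdet
  have hOo : IsOpen (mp φ '' W0) := hop W0 le_rfl hW0
  have hnh : ∀ z ∈ W0, nhds (mp φ z) ≤ Filter.map (mp φ) (nhds z) := by
    intro z hz s hs
    rw [Filter.mem_map] at hs
    obtain ⟨t, ht, hto, hzt⟩ := mem_nhds_iff.1 hs
    have := hop (t ∩ W0) Set.inter_subset_right (hto.inter hW0)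
    refine Filter.mem_of_superset (this.mem_nhds ⟨z, ⟨hzt, hz⟩, rfl⟩) ?_
    rintro _ ⟨x, hx, rfl⟩
    exact ht hx.1
  have hψat : ∀ y ∈ mp φ '' W0, ContDiffAt ℝ ∞ ψ y := fun y hy => hψ.contDiffAt (hOo.mem_nhds hy)
  have h0O : (0 : Fin n → ℝ) ∈ mp φ '' W0 := ⟨0, h0W0, hφ0⟩
  have hglob : ∀ J : Idx n q, ∃ F : Sm n, (F : (Fin n → ℝ) → ℝ) =ᶠ[nhds 0]
      fun y => (ev P (fun a => gr (φ (J.1.orderEmbOfFin J.2 a))) : Sm n) (ψ y) := by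
    intro J
    refine globalize ?_
    filter_upwards [hOo.mem_nhds h0O] with y hy
    exact (Sm.smooth _).contDiffAt.comp y (hψat y hy)
  choose P' hP' using hglob
  have hcont : ∀ z, Filter.Tendsto (mp φ) (nhds z) (nhds (mp φ z)) :=
    fun z => (mp_smooth φ).continuous.continuousAt
  have hcont0 : Filter.Tendsto (mp φ) (nhds 0) (nhds 0) := by
    have := hcont 0; rwa [hφ0] at this
  have key : ∀ᶠ z in nhds 0, at' P' (mp φ z) = extPow n q (jm φ z) (at' P z) := by
    have h1 : ∀ᶠ y in nhds (0 : Fin n → ℝ), ∀ J, P' J y =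
      (ev P (fun a => gr (φ (J.1.orderEmbOfFin J.2 a))) : Sm n) (ψ y) := Filter.eventually_all.2 hP'
    filter_upwards [hcont0.eventually h1, hW0.mem_nhds h0W0] with z hz hzW
    funext J
    rw [extPow_jm, at', hz J, hinv z hzW]
  have hn0 := hnh 0 h0W0
  rw [hφ0] at hn0
  refine ⟨P', key, hn0, hn0 ?_, ?_⟩
  · show ∀ᶠ z in nhds 0, GoodAt P' (mp φ z)
    filter_upwards [eventually_eventually_nhds.2 key, hP, hW0.mem_nhds h0W0] with z hz hPz hzW hne
    have hPne : at' P z ≠ 0 := by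
      intro h
      rw [hz.self_of_nhds, h, extPow_zero'] at hne
      exact hne rfl
    obtain ⟨χ, hu, hχ⟩ := hPz hPne
    have hg2 : ∀ i, ∃ F : Sm n, (F : (Fin n → ℝ) → ℝ) =ᶠ[nhds (mp φ z)] fun y => χ i (ψ y) := by
      intro i
      refine globalize ?_
      filter_upwards [hOo.mem_nhds ⟨z, hzW, rfl⟩] with y hy
      exact (Sm.smooth (χ i)).contDiffAt.comp y (hψat y hy)
    choose χ' hχ' using hg2
    have hch : ∀ᶠ z' in nhds z, jm χ' (mp φ z') * jm φ z' = jm χ z' := by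
      have h1 : ∀ᶠ z' in nhds z, ∀ i, cm (χ' i) φ z' = χ i z' := by
        filter_upwards [(hcont z).eventually (Filter.eventually_all.2 hχ'), hW0.mem_nhds hzW] with z' h1 h2 i
        rw [cm_ap, h1 i, hinv z' h2]
      filter_upwards [eventually_eventually_nhds.2 h1] with z' h2
      ext i j
      have h3 : (cm (χ' i) φ : (Fin n → ℝ) → ℝ) =ᶠ[nhds z'] χ i := h2.mono fun w hw => hw i
      have h4 := pd_congr j h3
      rw [pd_cm] at h4
      rw [Matrix.mul_apply]
      exact h4
    refine ⟨χ', ?_, hnh z hzW ?_⟩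
    · have := hch.self_of_nhds
      have hu' : IsUnit (jm χ z).det := hu
      rw [← this, Matrix.det_mul] at hu'
      exact isUnit_of_mul_isUnit_left hu'
    · show ∀ᶠ z' in nhds z, extPow n q (jm χ' (mp φ z')) (at' P' (mp φ z')) = stdVec n q
      filter_upwards [hz, hχ, hch] with z' h1 h2 h3
      rw [h1, ← extPow_mul, h3]
      exact h2
  · intro hNF U hU h0U
    obtain ⟨K, hK, hKo, h0K⟩ := mem_nhds_iff.1 key
    set U1 := U ∩ (W0 ∩ K) with hU1
    have hU1o : IsOpen U1 := hU.inter (hW0.inter hKo)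
    have hU1W : U1 ⊆ W0 := fun x hx => hx.2.1
    obtain ⟨W', hW'U, h0W', hW'o, φ', ψ', a1, a2, a3, a4, a5, a6, a7⟩ :=
      hNF (mp φ '' U1) (hop U1 hU1W hU1o) ⟨0, ⟨h0U, h0W0, h0K⟩, hφ0⟩
    set W := U1 ∩ (mp φ) ⁻¹' W' with hWd
    have hWo : IsOpen W := hU1o.inter (hW'o.preimage (mp_smooth φ).continuous)
    have him : mp φ '' W = W' := by
      ext y
      constructor
      · rintro ⟨x, hx, rfl⟩; exact hx.2
      · intro hy
        obtain ⟨x, hx, rfl⟩ := hW'U hy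
        exact ⟨x, ⟨hx, hy⟩, rfl⟩
    have him2 : (fun x => φ' (mp φ x)) '' W = Set.image φ' W' := by
      rw [← him, Set.image_image]
    have hψ' : ∀ x ∈ W, ψ' (φ' (mp φ x)) = mp φ x := fun x hx => a4 _ hx.2
    refine ⟨W, fun x hx => hx.1.1, ⟨⟨h0U, h0W0, h0K⟩, by rw [Set.mem_preimage, hφ0]; exact h0W'⟩, hWo,
      fun x => φ' (mp φ x), fun y => ψ (ψ' y), ?_, ?_, ?_, ?_, ?_, ?_, ?_⟩
    · rw [him2]; exact a1
    · exact a2.comp (mp_smooth φ).contDiffOn fun x hx => hx.2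
    · rw [him2]
      refine hψ.comp a3 ?_
      rintro _ ⟨y, hy, rfl⟩
      rw [a4 y hy]
      exact Set.image_mono hU1W (hW'U hy)
    · intro x hx
      show ψ (ψ' (φ' (mp φ x))) = x
      rw [hψ' x hx, hinv x hx.1.2.1]
    · rintro _ ⟨x, hx, rfl⟩
      show φ' (mp φ (ψ (ψ' (φ' (mp φ x))))) = φ' (mp φ x)
      rw [hψ' x hx, hinv x hx.1.2.1]
    · show φ' (mp φ 0) = 0
      rw [hφ0, a6]
    · rw [him2]
      intro y hy hyS l
      rw [← a7 y hy hyS l]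
      refine iteratedFDerivWithin_congr ?_ hy l
      rw [← him2]
      rintro _ ⟨x, hx, rfl⟩
      have hd : DifferentiableAt ℝ φ' (mp φ x) :=
        (a2.contDiffAt (hW'o.mem_nhds hx.2)).differentiableAt (by simp)
      have hkx : at' P' (mp φ x) = extPow n q (jm φ x) (at' P x) := hK hx.1.2.2
      simp only []
      rw [hψ' x hx, hinv x hx.1.2.1, hkx, ← extPow_mul, jac_comp _ _ _ hd]

end Push
end NambuLin

namespace NambuLin

section Alg
variable {n q : ℕ}

theorem idx_succ (J : Idx (q + 1) q) : ∃ k : Fin (q + 1), ∀ a, J.1.orderEmbOfFin J.2 a = k.succAbove a := by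
  have hc : (J.1)ᶜ.card = 1 := by rw [Finset.card_compl, J.2, Fintype.card_fin]; omega
  obtain ⟨k, hk⟩ := Finset.card_eq_one.1 hc
  have hJ : J.1 = {k}ᶜ := by rw [← hk, compl_compl]
  refine ⟨k, fun a => ?_⟩
  have := Finset.orderEmbOfFin_unique J.2 (f := fun a => k.succAbove a)
    (fun a => by rw [hJ]; simp [Fin.succAbove_ne]) (Fin.strictMono_succAbove k)
  rw [← this]

/-- inclusion of covectors -/
noncomputable def emb (τ : Fin (q + 1) → Fin n) : (Fin (q + 1) → ℝ) →ₗ[ℝ] (Fin n → ℝ) :=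
  Fintype.linearCombination ℝ (fun k => (Pi.single (τ k) 1 : Fin n → ℝ))

theorem emb_single (τ : Fin (q + 1) → Fin n) (k : Fin (q + 1)) :
    emb τ (Pi.single k 1) = Pi.single (τ k) 1 := by
  simp [emb]

/-- standard covectors -/
noncomputable def eR (τ : Fin (q + 1) → Fin n) : Fin (q + 1) → Fin n → ℝ := fun l => Pi.single (τ l) 1

theorem ev_det (τ : Fin (q + 1) → Fin n) (w : Idx n q → ℝ) (α : Fin q → Fin (q + 1) → ℝ) :
    ev w (fun a => emb τ (α a)) =
      Matrix.det (Matrix.of (Matrix.vecCons (fun k => ff w (eR τ) k) α)) := by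
  have h : (ev w).compLinearMap (emb τ) = ((Matrix.detRowAlternating (n := Fin (q + 1)) (R := ℝ)).curryLeft
      (fun k => ff w (eR τ) k)) := by
    apply alt_ext
    intro J
    obtain ⟨k, hk⟩ := idx_succ J
    simp only [hk]
    rw [AlternatingMap.compLinearMap_apply, AlternatingMap.curryLeft_apply_apply]
    have e1 : (fun a : Fin q => emb τ (Pi.single (k.succAbove a) 1)) = k.removeNth (eR τ) := by
      funext a; rw [emb_single]; rfl
    have e2 : (⇑(emb τ) ∘ fun a : Fin q => (Pi.single (k.succAbove a) 1 : Fin (q + 1) → ℝ)) = k.removeNth (eR τ) := e1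
    first | rw [e1] | rw [e2]
    show _ = Matrix.det (Matrix.of (Matrix.vecCons (fun k => ff w (eR τ) k) fun a : Fin q =>
          (Pi.single (k.succAbove a) 1 : Fin (q + 1) → ℝ)))
    rw [Matrix.det_succ_row_zero, Finset.sum_eq_single k]
    · have : Matrix.submatrix (Matrix.of (Matrix.vecCons (fun k => ff w (eR τ) k) fun a : Fin q =>
          (Pi.single (k.succAbove a) 1 : Fin (q + 1) → ℝ))) Fin.succ k.succAbove = (1 : Matrix (Fin q) (Fin q) ℝ) := by
        ext a b
        simp [Matrix.submatrix_apply, Pi.single_apply, Matrix.one_apply, Fin.succAbove_right_inj, eq_comm]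
      rw [this, Matrix.det_one]
      simp [ff, ← mul_assoc, ← mul_pow]
    · intro l _ hl
      obtain ⟨b, hb⟩ := Fin.exists_succAbove_eq (Ne.symm hl)
      rw [Matrix.det_eq_zero_of_column_eq_zero b, mul_zero]
      intro a
      simp [Matrix.submatrix_apply, hb, Pi.single_apply, Fin.ne_succAbove]
    · simp
  have := congrArg (fun f => f α) h
  exact this

theorem ff_T (τ : Fin (q + 1) → Fin n) (w : Idx n q → ℝ) (T : Matrix (Fin (q + 1)) (Fin (q + 1)) ℝ) :
    T.transpose.mulVec (fun j => ff w (fun l => emb τ (T l)) j) = T.det • (fun k => ff w (eR τ) k) := by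
  have h : (fun j => ff w (fun l => emb τ (T l)) j) = Matrix.cramer T.transpose (fun k => ff w (eR τ) k) := by
    funext j
    rw [Matrix.cramer_transpose_apply, ff]
    have : (j.removeNth fun l => emb τ (T l)) = fun a => emb τ ((j.removeNth (α := fun _ => Fin (q + 1) → ℝ) T) a) := rfl
    rw [this, ev_det, Matrix.det_succ_row_zero, Matrix.det_succ_row _ j, Finset.mul_sum]
    refine Finset.sum_congr rfl fun l _ => ?_
    have e1 : (Matrix.of (Matrix.vecCons (fun k => ff w (eR τ) k) (j.removeNth (α := fun _ => Fin (q + 1) → ℝ) T))).submatrix Fin.succ l.succAbove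
        = (T.updateRow j fun k => ff w (eR τ) k).submatrix j.succAbove l.succAbove := by
      ext a b
      simp [Fin.removeNth, Matrix.updateRow_ne (Fin.succAbove_ne j a)]
    rw [e1]
    simp [pow_add]
    ring
  rw [h, Matrix.mulVec_cramer, Matrix.det_transpose]

theorem ev_top_zero (τ : Fin (q + 1) → Fin n) (w : Idx n q → ℝ) (hw : ∀ k, ff w (eR τ) k = 0)
    (α : Fin q → Fin (q + 1) → ℝ) : ev w (fun a => emb τ (α a)) = 0 := by
  rw [ev_det]
  exact Matrix.det_eq_zero_of_row_eq_zero 0 fun j => hw j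

end Alg

section Der
variable {n q : ℕ}

theorem vo1_iff {N : ℕ} {τ : Fin N → Fin n} {V : Set (Fin n → ℝ)} {F : Sm n} :
    VO τ V 1 F ↔ ∀ s ∈ V, s ∈ SS τ → F s = 0 := by
  refine forall_congr' fun s => forall_congr' fun hs => forall_congr' fun hS => ?_
  rw [PowerSeries.X_pow_dvd_iff]
  refine ⟨fun h => ?_, fun h l hl => ?_⟩
  · have h2 := h 0 (by omega)
    rw [coeff_TT, sy_zero] at h2
    simpa using h2
  · obtain rfl : l = 0 := by omega
    rw [coeff_TT, sy_zero, h, map_zero]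

theorem pd_y {N : ℕ} {τ : Fin N → Fin n} {F : Sm n} {s : Fin n → ℝ} (hS : s ∈ SS τ)
    (h : ∀ᶠ z in nhds s, z ∈ SS τ → F z = 0) {a : Fin n} (ha : ∀ j, τ j ≠ a) : pd a F s = 0 := by
  obtain ⟨V, hV, hVo, hs⟩ := mem_nhds_iff.1 h
  have h1 : VO τ V 1 F := vo1_iff.2 fun s hs hS => hV hs hS
  exact vo1_iff.1 (h1.pd_other τ hVo a ha) s hs hS

theorem ev_pd0 {P : Idx n q → Sm n} {z : Fin n → ℝ} (h : at' P z = 0) (k : Fin n)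
    (α : Fin q → Fin n → Sm n) :
    pd k (ev P α) z = ev (fun I => pd k (P I) z) (fun a m => α a m z) := by
  rw [ev_apply, pd_sum, Sm.sum_ap, ev_apply]
  refine Finset.sum_congr rfl fun I _ => ?_
  have h1 : P I z = 0 := congrFun h I
  rw [pd_mul, Sm.add_ap, Sm.mul_ap, Sm.mul_ap, h1, mul_zero, zero_add]
  congr 1
  exact (evz z).toRingHom.map_det _

theorem pd_sgn (k : Fin n) (j : ℕ) (F : Sm n) : pd k ((-1) ^ j * F) = (-1) ^ j * pd k F := by
  have e : ((-1 : Sm n) ^ j) = algebraMap ℝ (Sm n) ((-1) ^ j) := by simp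
  rw [pd_mul, e, pd_algebraMap, zero_mul, zero_add]

theorem sgn_ap (j : ℕ) (z : Fin n → ℝ) : ((-1 : Sm n) ^ j : Sm n) z = (-1) ^ j := by
  have e : ((-1 : Sm n) ^ j) = algebraMap ℝ (Sm n) ((-1) ^ j) := by simp
  rw [e]; rfl

theorem ff_pd0 {P : Idx n q → Sm n} {z : Fin n → ℝ} (h : at' P z = 0) (k : Fin n)
    (A : Fin (q + 1) → Fin n → Sm n) (j : Fin (q + 1)) :
    pd k (ff P A j) z = ff (fun I => pd k (P I) z) (fun a m => A a m z) j := by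
  rw [ff, pd_sgn, Sm.mul_ap, sgn_ap, ev_pd0 h, ff]; rfl

theorem XX_pd0 {P : Idx n q → Sm n} {z : Fin n → ℝ} (h : at' P z = 0) (k : Fin n)
    (A : Fin (q + 1) → Fin n → Sm n) (i j : Fin (q + 1)) (β : Fin n → Sm n) :
    pd k (XX P A i j β) z = XX (fun I => pd k (P I) z) (fun a m => A a m z) i j (fun m => β m z) := by
  rw [XX_eq_ff, map_neg, Sm.neg_ap, ff_pd0 h, XX_eq_ff]
  congr 2
  funext l m
  by_cases hl : l = i
  · subst hl; simp
  · simp [hl]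

theorem ff_v0 {P : Idx n q → Sm n} {z : Fin n → ℝ} (h : at' P z = 0)
    (A : Fin (q + 1) → Fin n → Sm n) (j : Fin (q + 1)) : ff P A j z = 0 := by
  rw [ff_z, h, ff, ev_zero_w, mul_zero]

theorem XX_v0 {P : Idx n q → Sm n} {z : Fin n → ℝ} (h : at' P z = 0)
    (A : Fin (q + 1) → Fin n → Sm n) (i j : Fin (q + 1)) (β : Fin n → Sm n) : XX P A i j β z = 0 := by
  rw [XX_eq_ff, Sm.neg_ap, ff_v0 h, neg_zero]

theorem dd_mul0 {F G : Sm n} {z : Fin n → ℝ} (v : Fin n → ℝ) (hF : F z = 0) :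
    dd v (F * G) z = dd v F z * G z := by
  rw [dd_mul]; simp [hF]

theorem dd_mul2 {F G : Sm n} {z : Fin n → ℝ} (v : Fin n → ℝ) (hF : F z = 0) (hG : G z = 0) :
    dd v (dd v (F * G)) z = 2 * (dd v F z * dd v G z) := by
  rw [dd_mul, map_add, dd_mul, dd_mul]; simp [hF, hG]; ring

theorem dd_congr_ev {F G : Sm n} {z : Fin n → ℝ} (v : Fin n → ℝ)
    (h : ∀ᶠ z' in nhds z, F z' = G z') : dd v F =ᶠ[nhds z] dd v G := by
  filter_upwards [eventually_eventually_nhds.2 h] with z' hz'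
  exact dd_congr v hz'

end Der

section Pt
variable {n q : ℕ} {τ : Fin (q + 1) → Fin n} {P : Idx n q → Sm n}

/-- the functions `f_j` -/
noncomputable def fS (τ : Fin (q + 1) → Fin n) (P : Idx n q → Sm n) (j : Fin (q + 1)) : Sm n :=
  ff P (fam co τ) j

theorem fam_co (τ : Fin (q + 1) → Fin n) (z : Fin n → ℝ) : (fun a m => fam co τ a m z) = eR τ := by
  funext a m
  simp only [fam, gr_co, eR, Pi.single_apply]
  split_ifs <;> rfl

theorem single_z (a : Fin n) (z : Fin n → ℝ) :
    (fun m => (Pi.single a 1 : Fin n → Sm n) m z) = Pi.single a 1 := by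
  funext m
  simp only [Pi.single_apply]
  split_ifs <;> rfl

theorem fS_z (z : Fin n → ℝ) (j : Fin (q + 1)) : fS τ P j z = ff (at' P z) (eR τ) j := by
  rw [fS, ff_z, fam_co]

/-- derivative matrix -/
noncomputable def Bm (τ : Fin (q + 1) → Fin n) (P : Idx n q → Sm n) (z : Fin n → ℝ) :
    Matrix (Fin (q + 1)) (Fin (q + 1)) ℝ := Matrix.of fun i j => pd (τ i) (fS τ P j) z

theorem exists_v {z : Fin n → ℝ} (hB : (Bm τ P z).det ≠ 0) (i : Fin (q + 1)) :
    ∃ v : Fin n → ℝ, ∀ j, dd v (fS τ P j) z = if j = i then 1 else 0 := by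
  refine ⟨emb τ ((Bm τ P z)⁻¹ i), fun j => ?_⟩
  have h1 := Matrix.nonsing_inv_mul (Bm τ P z) (isUnit_iff_ne_zero.2 hB)
  have h2 := congrFun (congrFun h1 i) j
  rw [Matrix.mul_apply, Matrix.one_apply] at h2
  simp only [eq_comm (a := j)]
  rw [← h2, dd_apply]
  have : ∀ m, emb τ ((Bm τ P z)⁻¹ i) m = ∑ k, (Bm τ P z)⁻¹ i k * (Pi.single (τ k) 1 : Fin n → ℝ) m := by
    intro m
    simp [emb, Fintype.linearCombination_apply]
  simp only [this, Finset.sum_mul]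
  rw [Finset.sum_comm]
  refine Finset.sum_congr rfl fun k _ => ?_
  rw [Finset.sum_eq_single (τ k)]
  · simp [Bm]
  · intro b _ hb; simp [hb]
  · simp

theorem third (hq : 2 ≤ q) (j k : Fin (q + 1)) : ∃ i, i ≠ j ∧ i ≠ k :=
  Fin.exists_ne_and_ne_of_two_lt j k (by omega)

theorem vanish_pt (hq : 2 ≤ q) (hqn : q ≤ n) {p : Fin n → ℝ} (hP : ∀ᶠ z in nhds p, GoodAt P z)
    (hf : ∀ j, fS τ P j p = 0) (hB : (Bm τ P p).det ≠ 0) : at' P p = 0 := by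
  have hX : ∀ (j k : Fin (q + 1)), j ≠ k → ∀ β, XX P (fam co τ) j k β p = 0 := by
    intro j k hjk β
    obtain ⟨i, hij, hik⟩ := third hq j k
    obtain ⟨v, hv⟩ := exists_v hB i
    have h1 := dd_congr (F := fS τ P i * XX P (fam co τ) j k β)
      (G := fS τ P j * XX P (fam co τ) i k β - fS τ P k * XX P (fam co τ) i j β) (z := p) v
      (hP.mono fun z hz => pl_at hqn hz (fam co τ) hij hik hjk β)
    rw [map_sub, Sm.sub_ap, dd_mul0 v (hf i), dd_mul0 v (hf j), dd_mul0 v (hf k), hv, hv, hv,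
      if_pos rfl, if_neg hij.symm, if_neg hik.symm] at h1
    linarith
  have hr : ∀ (γ : Fin q → Fin n → Sm n) (s : Fin q) (β : Fin n → Sm n),
      (∀ l, ev P (Function.update γ s (fam co τ l)) p = 0) → ev P (Function.update γ s β) p = 0 := by
    intro γ s β hl
    obtain ⟨v, hv⟩ := exists_v hB 0
    have h1 := dd_congr (F := fS τ P 0 * ev P (Function.update γ s β))
      (G := ∑ l ∈ Finset.univ.erase 0, XX P (fam co τ) 0 l β * ev P (Function.update γ s (fam co τ l))) (z := p) v
      (hP.mono fun z hz => d3_at hqn hz (fam co τ) 0 β γ s)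
    rw [dd_mul0 v (hf 0), hv, if_pos rfl, one_mul] at h1
    rw [h1, map_sum, Sm.sum_ap]
    refine Finset.sum_eq_zero fun l hl' => ?_
    rw [dd_mul0 v (hX 0 l (Finset.ne_of_mem_erase hl').symm β), hl, mul_zero]
  have hall : ∀ (S : Finset (Fin q)) (γ : Fin q → Fin n → Sm n), (∀ a ∉ S, ∃ l, γ a = fam co τ l) →
      ev P γ p = 0 := by
    intro S
    induction S using Finset.induction_on with
    | empty =>
      intro γ hγ
      choose l hl using fun a => hγ a (by simp)
      have : ev P γ p = ev (at' P p) (fun a => emb τ (Pi.single (l a) 1)) := by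
        rw [ev_z]
        congr 1
        funext a
        rw [emb_single, hl a]
        exact congrFun (fam_co τ p) (l a)
      rw [this]
      exact ev_top_zero τ _ (fun k => by rw [← fS_z, hf]) _
    | insert a S ha ih =>
      intro γ hγ
      rw [← Function.update_eq_self a γ]
      refine hr γ a (γ a) fun l => ih _ fun b hb => ?_
      by_cases hba : b = a
      · subst hba; exact ⟨l, by simp⟩
      · rw [Function.update_of_ne hba]
        exact hγ b (by simp [hba, hb])
  funext J
  have := hall Finset.univ (fun a => Pi.single (J.1.orderEmbOfFin J.2 a) 1) (by simp)
  rw [ev_single] at this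
  exact this

/-- components -/
noncomputable def Xm (τ : Fin (q + 1) → Fin n) (P : Idx n q → Sm n) (i j : Fin (q + 1)) (m : Fin n) : Sm n :=
  XX P (fam co τ) i j (Pi.single m 1)

theorem Xm_top {i j : Fin (q + 1)} (hij : i ≠ j) (t : Fin (q + 1)) :
    Xm τ P i j (τ t) = (if t = j then fS τ P i else 0) - if t = i then fS τ P j else 0 := by
  have e : (Pi.single (τ t) 1 : Fin n → Sm n) = fam co τ t := by rw [fam, gr_co]
  rw [Xm, e]
  by_cases h1 : t = i
  · subst h1; rw [XX_self_left, if_neg hij, if_pos rfl, zero_sub]; rfl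
  · by_cases h2 : t = j
    · subst h2; rw [XX_self_right _ _ hij, if_pos rfl, if_neg h1, sub_zero]; rfl
    · rw [XX_other _ _ hij h1 h2, if_neg h1, if_neg h2, sub_zero]

theorem sum_top {τ : Fin (q + 1) → Fin n} (hτ : Function.Injective τ) (g : Fin n → ℝ)
    (hg : ∀ a, (∀ j, τ j ≠ a) → g a = 0) : ∑ m, g m = ∑ j, g (τ j) := by
  rw [← Finset.sum_image (f := g) (s := Finset.univ) (g := τ) (fun a _ b _ h => hτ h)]
  symm
  refine Finset.sum_subset (Finset.subset_univ _) fun a _ ha => hg a fun j hj => ha ?_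
  rw [← hj]; exact Finset.mem_image_of_mem _ (Finset.mem_univ j)

theorem symm_pt (hτ : Function.Injective τ) (hq : 2 ≤ q) (hqn : q ≤ n) {s : Fin n → ℝ}
    (hP : ∀ᶠ z in nhds s, GoodAt P z)
    (h0 : ∀ᶠ z in nhds s, z ∈ SS τ → at' P z = 0) (hS : s ∈ SS τ) (hB : (Bm τ P s).det ≠ 0)
    (j l : Fin (q + 1)) : Bm τ P s j l = Bm τ P s l j := by
  by_cases hjl : j = l
  · rw [hjl]
  obtain ⟨i, hij, hil⟩ := third hq j l
  obtain ⟨v, hv⟩ := exists_v hB i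
  have hs0 := h0.self_of_nhds hS
  have hE : ∀ᶠ z in nhds s, (∑ t, ((∑ m, Xm τ P i j m * pd m (fS τ P t)) * Xm τ P i l (τ t) -
      (∑ m, Xm τ P i l m * pd m (fS τ P t)) * Xm τ P i j (τ t)) : Sm n) z = (0 : Sm n) z := by
    filter_upwards [hP] with z hz
    have := inv_at hqn hz (fun l => co (τ l)) (eR τ) (eR τ) hij hil _ _ rfl rfl
    rw [Sm.sum_ap]
    refine Eq.trans (Finset.sum_congr rfl fun t _ => ?_) this
    have hXm : ∀ i j m, Xm τ P i j m z = XX (at' P z) (eR τ) i j (Pi.single m 1) := by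
      intro i j m
      rw [Xm, XX_z, fam_co, single_z]
    have hdc : ∀ X : Fin n → ℝ, dd X (co (τ t)) z = X (τ t) := by
      intro X
      rw [dd_apply, Finset.sum_eq_single (τ t)]
      · simp [pd_co]
      · intro b _ hb; simp [pd_co, hb]
      · simp
    rw [hdc, hdc, dd_apply, dd_apply]
    simp only [Sm.sub_ap, Sm.mul_ap, Sm.sum_ap, hXm]
    rfl
  have h2 := dd_congr v (dd_congr_ev v hE)
  rw [map_zero, map_zero, map_sum, map_sum, Sm.sum_ap] at h2
  have hXv0 : ∀ i j m, Xm τ P i j m s = 0 := fun i j m => XX_v0 hs0 _ _ _ _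
  have hsum0 : ∀ i j t, (∑ m, Xm τ P i j m * pd m (fS τ P t)) s = 0 := by
    intro i j t
    rw [Sm.sum_ap]
    exact Finset.sum_eq_zero fun m _ => by rw [Sm.mul_ap, hXv0, zero_mul]
  have hXt : ∀ j, i ≠ j → ∀ t, dd v (Xm τ P i j (τ t)) s = if t = j then 1 else 0 := by
    intro j hij t
    rw [Xm_top hij]
    split_ifs with h1 h2 h2
    · exact absurd (h2.symm.trans h1) hij
    · rw [sub_zero, hv, if_pos rfl]
    · rw [zero_sub, map_neg, Sm.neg_ap, hv, if_neg hij.symm, neg_zero]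
    · simp
  have hsd : ∀ j, i ≠ j → ∀ t, dd v (∑ m, Xm τ P i j m * pd m (fS τ P t)) s = Bm τ P s j t := by
    intro j hij t
    rw [map_sum, Sm.sum_ap]
    simp only [dd_mul0 v (hXv0 _ _ _)]
    rw [sum_top hτ]
    · rw [Finset.sum_eq_single j]
      · rw [hXt j hij, if_pos rfl, one_mul]; rfl
      · intro b _ hb; rw [hXt j hij, if_neg hb, zero_mul]
      · simp
    · intro a ha
      have h9 : pd a (fS τ P t) s = 0 := pd_y hS (h0.mono fun z hz hzS => ff_v0 (hz hzS) _ _) ha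
      rw [h9, mul_zero]
  have h3 : ∀ t, dd v (dd v ((∑ m, Xm τ P i j m * pd m (fS τ P t)) * Xm τ P i l (τ t) -
      (∑ m, Xm τ P i l m * pd m (fS τ P t)) * Xm τ P i j (τ t))) s =
      2 * (Bm τ P s j t * (if t = l then 1 else 0) - Bm τ P s l t * (if t = j then 1 else 0)) := by
    intro t
    rw [map_sub, map_sub, Sm.sub_ap, dd_mul2 v (hsum0 _ _ _) (hXv0 _ _ _), dd_mul2 v (hsum0 _ _ _) (hXv0 _ _ _),
      hsd j hij, hsd l hil, hXt j hij, hXt l hil]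
    ring
  rw [Finset.sum_congr rfl fun t _ => h3 t, ← Finset.mul_sum, Finset.sum_sub_distrib] at h2
  simp at h2
  linarith

end Pt
end NambuLin

namespace NambuLin

section Sqrt

theorem sqrt_loc {E : Type*} [NormedRing E] [NormedAlgebra ℝ E] [CompleteSpace E] :
    ∃ g : E → E, g 1 = 1 ∧ ContDiffAt ℝ ω g 1 ∧ (∀ᶠ y in nhds (1 : E), g y * g y = y) ∧
      ∀ᶠ x in nhds (1 : E), g (x * x) = x := by
  have hf : ContDiffAt ℝ ω (fun x : E => x * x) 1 := (contDiff_id.mul contDiff_id).contDiffAt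
  let e : E ≃L[ℝ] E := ContinuousLinearEquiv.smulLeft (Units.mk0 (2 : ℝ) two_ne_zero)
  have hf' : HasFDerivAt (fun x : E => x * x) (e : E →L[ℝ] E) 1 := by
    have h := (hasStrictFDerivAt_id (𝕜 := ℝ) (1 : E)).mul' (hasStrictFDerivAt_id (𝕜 := ℝ) (1 : E))
    refine HasFDerivAt.congr_fderiv h.hasFDerivAt ?_
    ext x
    simp [e, two_smul, Units.smul_def]
  have h11 : (1 : E) * 1 = 1 := one_mul 1
  have hn : (ω : WithTop ℕ∞) ≠ 0 := by simp
  refine ⟨hf.localInverse hf' hn, ?_, ?_, ?_, ?_⟩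
  · have := hf.localInverse_apply_image hf' hn
    rwa [h11] at this
  · have := hf.to_localInverse hf' hn
    rwa [h11] at this
  · have := (hf.hasStrictFDerivAt' hf' hn).eventually_right_inverse
    rwa [h11] at this
  · exact (hf.hasStrictFDerivAt' hf' hn).eventually_left_inverse

open scoped Matrix.Norms.Operator in
theorem exists_T {n N : ℕ} (hN : 3 ≤ N) (ε : Fin N → ℝ) (hε : ∀ i, ε i * ε i = 1)
    (B : Fin N → Fin N → Sm n) (hB : ∀ i j, B i j 0 = if i = j then ε i else 0) :
    ∃ T : Fin N → Fin N → Sm n, (∀ i j, T i j 0 = if i = j then 1 else 0) ∧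
      ∀ᶠ z in nhds (0 : Fin n → ℝ), (∀ i j, B i j z = B j i z) →
        (Matrix.of fun i j => T i j z).transpose * Matrix.diagonal ε * (Matrix.of fun i j => T i j z) =
          (Matrix.of fun i j => T i j z).det • (Matrix.of fun i j => B i j z) := by
  obtain ⟨g, g1, gs, gr', gl⟩ := sqrt_loc (E := Matrix (Fin N) (Fin N) ℝ)
  let C : (Fin n → ℝ) → Matrix (Fin N) (Fin N) ℝ := fun z => Matrix.diagonal ε * Matrix.of fun i j => B i j z
  have hdd : Matrix.diagonal ε * Matrix.diagonal ε = (1 : Matrix (Fin N) (Fin N) ℝ) := by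
    rw [Matrix.diagonal_mul_diagonal]
    simp [hε]
  have hC0 : C 0 = 1 := by
    show Matrix.diagonal ε * Matrix.of (fun i j => B i j 0) = 1
    rw [← hdd]; congr 1
    ext i j
    simp [hB, Matrix.diagonal_apply]
  have hCs : ContDiff ℝ ∞ C := by
    have : C = fun z => ∑ i, ∑ j, (ε i * B i j z) • Matrix.single i j (1 : ℝ) := by
      funext z
      rw [Matrix.matrix_eq_sum_single (C z)]
      refine Finset.sum_congr rfl fun i _ => Finset.sum_congr rfl fun j _ => ?_
      simp [C, Matrix.diagonal_mul]
    rw [this]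
    refine ContDiff.sum fun i _ => ContDiff.sum fun j _ => ?_
    exact (contDiff_const.mul (Sm.smooth (B i j))).smul contDiff_const
  have hCt : Filter.Tendsto C (nhds 0) (nhds 1) := by
    have := hCs.continuous.tendsto 0
    rwa [hC0] at this
  have hgt : Filter.Tendsto (fun z => g (C z)) (nhds 0) (nhds 1) := by
    have := gs.continuousAt.tendsto
    rw [g1] at this
    exact this.comp hCt
  have hRs : ∀ᶠ z in nhds (0 : Fin n → ℝ), ContDiffAt ℝ ∞ (fun z => g (C z)) z := by
    filter_upwards [hCt.eventually (gs.eventually (by simp))] with z hz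
    exact (hz.of_le le_top).comp z hCs.contDiffAt
  have hent : ∀ i j, ContDiff ℝ ∞ (fun M : Matrix (Fin N) (Fin N) ℝ => M i j) := fun i j =>
    (LinearMap.toContinuousLinearMap (Matrix.entryLinearMap ℝ ℝ i j)).contDiff
  have hdet : ContDiff ℝ ∞ (fun M : Matrix (Fin N) (Fin N) ℝ => M.det) := by
    simp only [Matrix.det_apply]
    refine ContDiff.sum fun σ _ => ContDiff.const_smul _ ?_
    exact contDiff_prod fun i _ => hent _ _
  have hdetR : Filter.Tendsto (fun z => (g (C z)).det) (nhds 0) (nhds 1) := by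
    have := (hdet.continuous.tendsto (1 : Matrix (Fin N) (Fin N) ℝ)).comp hgt
    rwa [Matrix.det_one] at this
  have hpos : ∀ᶠ z in nhds (0 : Fin n → ℝ), 0 < (g (C z)).det := hdetR.eventually (lt_mem_nhds one_pos)
  set p : ℝ := -1 / ((N - 2 : ℕ) : ℝ) with hp
  have hTs : ∀ i j, ∀ᶠ z in nhds (0 : Fin n → ℝ), ContDiffAt ℝ ∞ (fun z => (g (C z)).det ^ p * g (C z) i j) z := by
    intro i j
    filter_upwards [hRs, hpos] with z hz hzp
    refine ContDiffAt.mul ?_ ((hent i j).contDiffAt.comp z hz)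
    exact ContDiffAt.rpow_const_of_ne (hdet.contDiffAt.comp z hz) hzp.ne'
  choose T hT using fun i j => globalize (hTs i j)
  refine ⟨T, fun i j => ?_, ?_⟩
  · refine (hT i j).self_of_nhds.trans ?_
    show (g (C 0)).det ^ p * g (C 0) i j = _
    rw [hC0, g1]
    simp [Matrix.one_apply]
  have hall : ∀ᶠ z in nhds (0 : Fin n → ℝ), ∀ i j, T i j z = (g (C z)).det ^ p * g (C z) i j :=
    Filter.eventually_all.2 fun i => Filter.eventually_all.2 fun j => hT i j
  have hR't : Filter.Tendsto (fun z => Matrix.diagonal ε * (g (C z)).transpose * Matrix.diagonal ε) (nhds 0) (nhds 1) := by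
    have h1 : Continuous (fun M : Matrix (Fin N) (Fin N) ℝ => Matrix.diagonal ε * M.transpose * Matrix.diagonal ε) := by
      have : Continuous (fun M : Matrix (Fin N) (Fin N) ℝ => M.transpose) :=
        LinearMap.continuous_of_finiteDimensional (Matrix.transposeLinearEquiv (Fin N) (Fin N) ℝ ℝ).toLinearMap
      exact (continuous_const.mul this).mul continuous_const
    have h2 := (h1.tendsto 1).comp hgt
    simp only [Matrix.transpose_one, mul_one, hdd] at h2
    exact h2
  filter_upwards [hall, hpos, hCt.eventually gr', hR't.eventually gl] with z h1 h2 h3 h4 hsym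
  have hBt : (Matrix.of fun i j => B i j z).transpose = Matrix.of fun i j => B i j z := by
    ext i j; exact hsym j i
  set R := g (C z) with hR
  have hCd : Matrix.diagonal ε * C z = Matrix.of fun i j => B i j z := by
    show Matrix.diagonal ε * (Matrix.diagonal ε * _) = _
    rw [← mul_assoc, hdd, one_mul]
  have e1 : Matrix.diagonal ε * R.transpose * Matrix.diagonal ε *
      (Matrix.diagonal ε * R.transpose * Matrix.diagonal ε) = C z := by
    calc _ = Matrix.diagonal ε * R.transpose * (Matrix.diagonal ε * Matrix.diagonal ε) * R.transpose * Matrix.diagonal ε := by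
          simp only [mul_assoc]
      _ = Matrix.diagonal ε * (R * R).transpose * Matrix.diagonal ε := by
          rw [hdd, mul_one, Matrix.transpose_mul]; simp only [mul_assoc]
      _ = C z := by
          rw [h3]
          show Matrix.diagonal ε * (Matrix.diagonal ε * _).transpose * Matrix.diagonal ε = Matrix.diagonal ε * _
          rw [Matrix.transpose_mul, Matrix.diagonal_transpose, mul_assoc, mul_assoc, hdd, mul_one, hBt]
  rw [e1] at h4
  have h5 : R = Matrix.diagonal ε * R.transpose * Matrix.diagonal ε := hR.trans h4
  have e2 : R.transpose * Matrix.diagonal ε * R = Matrix.of fun i j => B i j z := by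
    rw [← hCd, ← h3]
    conv_rhs => enter [2, 1]; rw [h5]
    simp only [← mul_assoc]
    rw [hdd, one_mul]
  have eT : (Matrix.of fun i j => T i j z) = R.det ^ p • R := by
    ext i j; simp [h1]
  rw [eT, Matrix.transpose_smul, Matrix.det_smul, Matrix.smul_mul, Matrix.smul_mul, Matrix.mul_smul, e2, smul_smul]
  congr 1
  rw [Fintype.card_fin]
  obtain ⟨M, rfl⟩ : ∃ M, N = M + 3 := ⟨N - 3, by omega⟩
  have e3 : (R.det ^ p) ^ (M + 1) * R.det = 1 := by
    rw [← Real.rpow_natCast, ← Real.rpow_mul h2.le]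
    have : p * ((M + 1 : ℕ) : ℝ) = -1 := by
      rw [hp]
      have : ((M + 3 - 2 : ℕ) : ℝ) = ((M + 1 : ℕ) : ℝ) := by congr 1
      rw [this]
      have : ((M + 1 : ℕ) : ℝ) ≠ 0 := by positivity
      field_simp
    rw [this, Real.rpow_neg_one]
    exact inv_mul_cancel₀ h2.ne'
  calc _ = R.det ^ p * R.det ^ p * 1 := by ring
    _ = _ := by rw [← e3]; ring

end Sqrt
end NambuLin

namespace NambuLin

section Xpt
variable {n q : ℕ} {τ : Fin (q + 1) → Fin n} {P : Idx n q → Sm n}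

theorem pp_mul2 {F G : Sm n} {z : Fin n → ℝ} (l m : Fin n) (hF : F z = 0) (hG : G z = 0) :
    pd l (pd m (F * G)) z = pd l F z * pd m G z + pd m F z * pd l G z := by
  rw [pd_mul, map_add, pd_mul, pd_mul]; simp [hF, hG]; ring

theorem pp_congr {F G : Sm n} {z : Fin n → ℝ} (l m : Fin n) (h : ∀ᶠ z' in nhds z, F z' = G z') :
    pd l (pd m F) z = pd l (pd m G) z := by
  have : (pd m F : Sm n) =ᶠ[nhds z] (pd m G : Sm n) := by
    filter_upwards [eventually_eventually_nhds.2 h] with z' hz'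
    exact pd_congr m hz'
  exact pd_congr l this

/-- a fixed index different from `k` -/
noncomputable def oth (hq : 2 ≤ q) (k : Fin (q + 1)) : Fin (q + 1) := (third hq k k).choose

theorem oth_ne (hq : 2 ≤ q) (k : Fin (q + 1)) : oth hq k ≠ k := (third hq k k).choose_spec.1

/-- the coefficients of the shear -/
noncomputable def AA (hq : 2 ≤ q) (τ : Fin (q + 1) → Fin n) (ε : Fin (q + 1) → ℝ) (P : Idx n q → Sm n)
    (a : Fin n) (k : Fin (q + 1)) : Sm n :=
  ε (oth hq k) • pd (τ (oth hq k)) (Xm τ P (oth hq k) k a)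

theorem x_pt (hq : 2 ≤ q) (hqn : q ≤ n) {ε : Fin (q + 1) → ℝ} (hε : ∀ i, ε i * ε i = 1) {s : Fin n → ℝ}
    (hP : ∀ᶠ z in nhds s, GoodAt P z) (hs0 : at' P s = 0)
    (hB : ∀ i j, pd (τ i) (fS τ P j) s = if i = j then ε i else 0) (a : Fin n)
    {i j : Fin (q + 1)} (hij : i ≠ j) (k : Fin (q + 1)) :
    pd (τ k) (Xm τ P i j a) s = (if k = i then ε i * AA hq τ ε P a j s else 0) -
      if k = j then ε j * AA hq τ ε P a i s else 0 := by
  have hf0 : ∀ i, fS τ P i s = 0 := fun i => ff_v0 hs0 _ _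
  have hX0 : ∀ i j, Xm τ P i j a s = 0 := fun i j => XX_v0 hs0 _ _ _ _
  have key : ∀ i j k : Fin (q + 1), i ≠ j → i ≠ k → j ≠ k → ∀ l m : Fin (q + 1),
      pd (τ l) (fS τ P i) s * pd (τ m) (Xm τ P j k a) s + pd (τ m) (fS τ P i) s * pd (τ l) (Xm τ P j k a) s =
      (pd (τ l) (fS τ P j) s * pd (τ m) (Xm τ P i k a) s + pd (τ m) (fS τ P j) s * pd (τ l) (Xm τ P i k a) s) -
      (pd (τ l) (fS τ P k) s * pd (τ m) (Xm τ P i j a) s + pd (τ m) (fS τ P k) s * pd (τ l) (Xm τ P i j a) s) := by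
    intro i j k hij hik hjk l m
    have h1 := pp_congr (F := fS τ P i * Xm τ P j k a)
      (G := fS τ P j * Xm τ P i k a - fS τ P k * Xm τ P i j a) (z := s) (τ l) (τ m)
      (hP.mono fun z hz => pl_at hqn hz (fam co τ) hij hik hjk _)
    rwa [map_sub, map_sub, Sm.sub_ap, pp_mul2 _ _ (hf0 _) (hX0 _ _), pp_mul2 _ _ (hf0 _) (hX0 _ _),
      pp_mul2 _ _ (hf0 _) (hX0 _ _)] at h1
  have hεz : ∀ i, ε i ≠ 0 := fun i h => by have := hε i; simp [h] at this
  have hzero : ∀ i j k : Fin (q + 1), i ≠ j → i ≠ k → j ≠ k → pd (τ i) (Xm τ P j k a) s = 0 := by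
    intro i j k hij hik hjk
    have h := key i j k hij hik hjk i i
    simp only [hB, if_neg hij, if_neg hik, if_true, zero_mul, add_zero, sub_zero] at h
    have h2 : ε i * pd (τ i) (Xm τ P j k a) s = 0 := by linarith
    exact (mul_eq_zero.1 h2).resolve_left (hεz i)
  have hswap : ∀ i j k : Fin (q + 1), i ≠ j → i ≠ k → j ≠ k →
      ε j * pd (τ j) (Xm τ P j k a) s = ε i * pd (τ i) (Xm τ P i k a) s := by
    intro i j k hij hik hjk
    have h := key i j k hij hik hjk i j
    simp only [hB, if_neg hij, if_neg hij.symm, if_neg hik, if_neg hjk, if_true, zero_mul, add_zero, sub_zero,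
      zero_add] at h
    have h2 : ε j * (ε i * (ε i * pd (τ j) (Xm τ P j k a) s)) = ε j * (ε i * (ε j * pd (τ i) (Xm τ P i k a) s)) := by
      rw [h]
    have e1 := hε i
    have e2 := hε j
    calc _ = ε j * ((ε i * ε i) * pd (τ j) (Xm τ P j k a) s) := by rw [e1, one_mul]
      _ = ε j * (ε i * (ε i * pd (τ j) (Xm τ P j k a) s)) := by ring
      _ = (ε j * ε j) * (ε i * pd (τ i) (Xm τ P i k a) s) := by rw [h2]; ring
      _ = _ := by rw [e2, one_mul]
  have hdiag : ∀ i j : Fin (q + 1), i ≠ j → pd (τ i) (Xm τ P i j a) s = ε i * AA hq τ ε P a j s := by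
    intro i j hij
    have h1 : ε i * pd (τ i) (Xm τ P i j a) s = AA hq τ ε P a j s := by
      rw [AA, Sm.smul_ap]
      by_cases hc : oth hq j = i
      · rw [hc]
      · exact hswap (oth hq j) i j hc (oth_ne hq j) hij
    rw [← h1, ← mul_assoc, hε, one_mul]
  by_cases h1 : k = i
  · subst h1
    rw [if_pos rfl, if_neg hij, sub_zero, hdiag _ _ hij]
  · by_cases h2 : k = j
    · subst h2
      have : Xm τ P i k a = - Xm τ P k i a := XX_antisymm _ _ hij _
      rw [this, map_neg, Sm.neg_ap, hdiag _ _ hij.symm, if_neg h1, if_pos rfl, zero_sub]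
    · rw [if_neg h1, if_neg h2, sub_zero, hzero k i j h1 h2 hij]

theorem Xm_pd0 {s : Fin n → ℝ} (h : at' P s = 0) (k : Fin n) (i j : Fin (q + 1)) (m : Fin n) :
    pd k (Xm τ P i j m) s = XX (fun I => pd k (P I) s) (eR τ) i j (Pi.single m 1) := by
  rw [Xm, XX_pd0 h, fam_co, single_z]

theorem fS_pd0 {s : Fin n → ℝ} (h : at' P s = 0) (k : Fin n) (j : Fin (q + 1)) :
    pd k (fS τ P j) s = ff (fun I => pd k (P I) s) (eR τ) j := by
  rw [fS, ff_pd0 h, fam_co]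

theorem push_f {P' : Idx n q → Sm n} {φ : Fin n → Sm n} {z : Fin n → ℝ}
    (h : at' P' (mp φ z) = extPow n q (jm φ z) (at' P z)) (j : Fin (q + 1)) :
    cm (fS τ P' j) φ z = ff P (fam φ τ) j z := by
  rw [cm_ap, fS_z, h, ff, ev_extPow, ff_z, ff]
  congr 2
  funext a m
  simp [Fin.removeNth, eR, Matrix.single_one_vecMul, jm, fam, gr]

theorem push_X {P' : Idx n q → Sm n} {φ : Fin n → Sm n} {z : Fin n → ℝ}
    (h : at' P' (mp φ z) = extPow n q (jm φ z) (at' P z)) (i j : Fin (q + 1)) (b : Fin n) :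
    cm (Xm τ P' i j b) φ z = XX P (fam φ τ) i j (gr (φ b)) z := by
  rw [cm_ap, Xm, XX_z, fam_co, single_z, h, XX, ev_extPow, XX_z, XX]
  congr 3
  funext a m
  simp only [Fin.removeNth]
  by_cases hl : j.succAbove a = i
  · rw [hl]; simp [Matrix.single_one_vecMul, jm, gr]
  · simp [hl, eR, Matrix.single_one_vecMul, jm, fam, gr]

theorem pd_push {F' G : Sm n} {φ : Fin n → Sm n} {s : Fin n → ℝ} (hτ : Function.Injective τ)
    (h : ∀ᶠ z in nhds s, cm F' φ z = G z) (hs : mp φ s = s)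
    (hy : ∀ a, (∀ j, τ j ≠ a) → pd a F' s = 0) (k : Fin n) :
    ∑ l, pd (τ l) F' s * pd k (φ (τ l)) s = pd k G s := by
  have h1 := pd_congr k h
  rw [pd_cm, hs, sum_top hτ] at h1
  · exact h1
  · intro a ha; rw [hy a ha, zero_mul]

/-- glueing components -/
noncomputable def glue (τ : Fin (q + 1) → Fin n) (g : Fin (q + 1) → Sm n) (g' : Fin n → Sm n) : Fin n → Sm n :=
  open Classical in fun m => if h : ∃ j, τ j = m then g h.choose else g' m

theorem glue_top (hτ : Function.Injective τ) (g : Fin (q + 1) → Sm n) (g' : Fin n → Sm n) (j : Fin (q + 1)) :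
    glue τ g g' (τ j) = g j := by
  have h : ∃ i, τ i = τ j := ⟨j, rfl⟩
  rw [glue, dif_pos h, hτ h.choose_spec]

theorem glue_other (g : Fin (q + 1) → Sm n) (g' : Fin n → Sm n) {a : Fin n} (ha : ∀ j, τ j ≠ a) :
    glue τ g g' a = g' a := by
  rw [glue, dif_neg (by push Not; exact ha)]

theorem ind_cases (τ : Fin (q + 1) → Fin n) (m : Fin n) : (∃ j, τ j = m) ∨ ∀ j, τ j ≠ m := by
  by_cases h : ∃ j, τ j = m
  · exact Or.inl h
  · exact Or.inr (by push Not at h; exact h)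

end Xpt

end NambuLin

namespace NambuLin

section Steps
variable {n q : ℕ} {τ : Fin (q + 1) → Fin n} {P : Idx n q → Sm n} {ε : Fin (q + 1) → ℝ}

/-- stage 0 -/
def H0 (τ : Fin (q + 1) → Fin n) (ε : Fin (q + 1) → ℝ) (P : Idx n q → Sm n) : Prop :=
  (∀ᶠ z in nhds 0, GoodAt P z) ∧ at' P 0 = 0 ∧ ∀ m j, pd m (fS τ P j) 0 = if m = τ j then ε j else 0

/-- stage 1 -/
def H1 (τ : Fin (q + 1) → Fin n) (ε : Fin (q + 1) → ℝ) (P : Idx n q → Sm n) : Prop :=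
  (∀ᶠ z in nhds 0, GoodAt P z) ∧ (∀ᶠ z in nhds 0, z ∈ SS τ → at' P z = 0) ∧
    ∀ i j, pd (τ i) (fS τ P j) 0 = if i = j then ε i else 0

/-- stage 2 -/
def H2 (τ : Fin (q + 1) → Fin n) (ε : Fin (q + 1) → ℝ) (P : Idx n q → Sm n) : Prop :=
  (∀ᶠ z in nhds 0, GoodAt P z) ∧ (∀ᶠ z in nhds 0, z ∈ SS τ → at' P z = 0) ∧
    ∀ᶠ z in nhds 0, z ∈ SS τ → ∀ i j, pd (τ i) (fS τ P j) z = if i = j then ε i else 0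

/-- stage 3 -/
def H3 (τ : Fin (q + 1) → Fin n) (ε : Fin (q + 1) → ℝ) (P : Idx n q → Sm n) : Prop :=
  H2 τ ε P ∧ ∀ᶠ z in nhds 0, z ∈ SS τ → ∀ a, (∀ j, τ j ≠ a) → ∀ i j, i ≠ j → ∀ k,
    pd (τ k) (Xm τ P i j a) z = 0

theorem zero_SS : (0 : Fin n → ℝ) ∈ SS τ := fun _ => rfl

theorem fv2 {V : Set (Fin n → ℝ)} {F : Sm n} (h0 : ∀ s ∈ V, s ∈ SS τ → F s = 0)
    (hV : IsOpen V) (h1 : ∀ s ∈ V, s ∈ SS τ → ∀ k, pd (τ k) F s = 0) : VO τ V 2 F := by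
  intro s hs hS
  refine FV.dvd (FV.succ' (h0 s hs hS) fun m => FV.succ' ?_ fun _ k hk => absurd hk (by omega))
  rcases ind_cases τ m with ⟨j, rfl⟩ | ha
  · exact h1 s hs hS j
  · exact pd_y hS (Filter.eventually_of_mem (hV.mem_nhds hs) h0) ha

theorem step3 (h : q < n) (hq : 2 ≤ q) (k : ℕ) {P : Idx n q → Sm n}
    (H : H3 (tau h) (fun j => eps k j) P) : NF n q k P := by
  obtain ⟨⟨hg, h0, hB⟩, hX⟩ := H
  obtain ⟨V, hV, hVo, h0V⟩ := mem_nhds_iff.1 (hg.and (h0.and (hB.and hX)))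
  refine thmA h (V := V) ?_ h0V
  have hε : ∀ i : Fin (q + 1), eps k i * eps k i = 1 := by
    intro i; unfold eps; split_ifs <;> norm_num
  refine ⟨tau_inj h, hq, h.le, hε, hVo, fun z hz => (hV hz).1, fun I => vo1_iff.2 fun s hs hS => ?_, ?_, ?_⟩
  · exact congrFun ((hV hs).2.1 hS) I
  · intro j
    refine fv2 (fun s hs hS => ?_) hVo (fun s hs hS l => ?_)
    · rw [er, Sm.sub_ap, Sm.smul_ap, ff_v0 ((hV hs).2.1 hS), co_apply, hS j]; simp
    · have := (hV hs).2.2.1 hS l j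
      rw [er, map_sub, map_smul, Sm.sub_ap, Sm.smul_ap, pd_co]
      rw [fS] at this
      rw [this]
      by_cases hlj : l = j
      · subst hlj; simp
      · simp [hlj, (tau_inj h).eq_iff]
  · intro a ha i j hij
    have e : ex (tau h) P co i j a = Xm (tau h) P i j a := by rw [ex, gr_co, Xm]
    rw [e]
    refine fv2 (fun s hs hS => XX_v0 ((hV hs).2.1 hS) _ _ _ _) hVo (fun s hs hS l => ?_)
    exact (hV hs).2.2.2 hS a ha i j hij l

theorem van_of_id {P' : Idx n q → Sm n} {φ : Fin n → Sm n} (hid : ∀ s ∈ SS τ, mp φ s = s)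
    (hpush : ∀ᶠ z in nhds 0, at' P' (mp φ z) = extPow n q (jm φ z) (at' P z))
    (h0 : ∀ᶠ z in nhds 0, z ∈ SS τ → at' P z = 0) : ∀ᶠ z in nhds 0, z ∈ SS τ → at' P' z = 0 := by
  filter_upwards [hpush, h0] with z h1 h2 hS
  rw [hid z hS, h2 hS, extPow_zero'] at h1
  exact h1

theorem step2 (hτ : Function.Injective τ) (hq : 2 ≤ q) (hqn : q ≤ n) (hε : ∀ i, ε i * ε i = 1) (k : ℕ)
    (H : H2 τ ε P) : ∃ P' : Idx n q → Sm n, H3 τ ε P' ∧ (NF n q k P' → NF n q k P) := by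
  obtain ⟨hg, h0, hB⟩ := H
  let φ : Fin n → Sm n := glue τ (fun j => co (τ j)) (fun a => co a - ∑ l, AA hq τ ε P a l * co (τ l))
  have φt : ∀ j, φ (τ j) = co (τ j) := fun j => glue_top hτ _ _ j
  have φo : ∀ a, (∀ j, τ j ≠ a) → φ a = co a - ∑ l, AA hq τ ε P a l * co (τ l) := fun a ha => glue_other _ _ ha
  have hid : ∀ s ∈ SS τ, mp φ s = s := by
    intro s hS
    funext m
    rw [mp]
    rcases ind_cases τ m with ⟨j, rfl⟩ | ha
    · rw [φt, co_apply]
    · rw [φo m ha, Sm.sub_ap, Sm.sum_ap, co_apply]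
      simp [co_apply, hS _]
  have φpd : ∀ a, (∀ j, τ j ≠ a) → ∀ s ∈ SS τ, ∀ m, pd m (φ a) s =
      ((Pi.single a 1 : Fin n → ℝ) - ∑ l, AA hq τ ε P a l s • (Pi.single (τ l) 1 : Fin n → ℝ)) m := by
    intro a ha s hS m
    have hS' : ∀ l, s (τ l) = 0 := hS
    rw [φo a ha, map_sub, pd_sum, Sm.sub_ap, Sm.sum_ap, Pi.sub_apply, Finset.sum_apply]
    congr 1
    · rw [pd_co, Pi.single_apply]; split_ifs <;> rfl
    · refine Finset.sum_congr rfl fun l _ => ?_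
      rw [pd_mul, Sm.add_ap, Sm.mul_ap, Sm.mul_ap, co_apply, hS', mul_zero, zero_add, pd_co, Pi.smul_apply,
        Pi.single_apply, smul_eq_mul]
      split_ifs <;> rfl
  have φtpd : ∀ j m s, pd m (φ (τ j)) s = (Pi.single (τ j) 1 : Fin n → ℝ) m := by
    intro j m s
    rw [φt, pd_co, Pi.single_apply]; split_ifs <;> rfl
  have hdet : (jm φ 0).det ≠ 0 := by
    let N : Matrix (Fin n) (Fin n) ℝ := 1 - jm φ 0
    have hNt : ∀ j m, N (τ j) m = 0 := by
      intro j m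
      show (1 : Matrix (Fin n) (Fin n) ℝ) (τ j) m - pd m (φ (τ j)) 0 = 0
      rw [φtpd, Matrix.one_apply, Pi.single_apply]
      simp [eq_comm]
    have hNo : ∀ a, (∀ j, τ j ≠ a) → ∀ m, (∀ j, τ j ≠ m) → N a m = 0 := by
      intro a ha m hm
      show (1 : Matrix (Fin n) (Fin n) ℝ) a m - pd m (φ a) 0 = 0
      rw [φpd a ha 0 zero_SS, Matrix.one_apply, Pi.sub_apply, Finset.sum_apply, Finset.sum_eq_zero, Pi.single_apply]
      · simp [eq_comm]
      · intro l _
        rw [Pi.smul_apply, Pi.single_apply, if_neg (hm l).symm, smul_zero]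
    have hNN : N * N = 0 := by
      ext a b
      rw [Matrix.mul_apply]
      refine Finset.sum_eq_zero fun m _ => ?_
      rcases ind_cases τ m with ⟨j, rfl⟩ | hm
      · rw [hNt, mul_zero]
      · rcases ind_cases τ a with ⟨j, rfl⟩ | ha
        · rw [hNt, zero_mul]
        · rw [hNo a ha m hm, zero_mul]
    have e : jm φ 0 * (1 + N) = 1 := by
      have : jm φ 0 = 1 - N := (sub_sub_cancel _ _).symm
      rw [this]
      have : (1 - N) * (1 + N) = 1 - N * N := by noncomm_ring
      rw [this, hNN, sub_zero]
    intro h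
    have := congrArg Matrix.det e
    rw [Matrix.det_mul, h, zero_mul, Matrix.det_one] at this
    exact zero_ne_one this
  obtain ⟨P', hpush, -, hg', hNF⟩ := thmB k φ (hid 0 zero_SS) hdet P hg
  have h0' := van_of_id hid hpush h0
  have hfam : fam φ τ = fam co τ := by funext l; rw [fam, φt]; rfl
  have hBX : ∀ᶠ s in nhds 0, s ∈ SS τ → (∀ i j, pd (τ i) (fS τ P' j) s = if i = j then ε i else 0) ∧
      ∀ a, (∀ j, τ j ≠ a) → ∀ i j, i ≠ j → ∀ k, pd (τ k) (Xm τ P' i j a) s = 0 := by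
    filter_upwards [eventually_eventually_nhds.2 hg, h0, hB, eventually_eventually_nhds.2 hpush,
      eventually_eventually_nhds.2 h0'] with s h1 h2 h3 h4 h5 hS
    have hsum : ∀ (F : Sm n) i, ∑ l, pd (τ l) F s * pd (τ i) (φ (τ l)) s = pd (τ i) F s := by
      intro F i
      rw [Finset.sum_eq_single i]
      · rw [φtpd, Pi.single_eq_same, mul_one]
      · intro b _ hb
        rw [φtpd, Pi.single_eq_of_ne (fun h => hb (hτ h).symm), mul_zero]
      · simp
    refine ⟨fun i j => ?_, fun a ha i j hij l => ?_⟩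
    · have h := pd_push (F' := fS τ P' j) (G := ff P (fam φ τ) j) hτ (h4.mono fun z hz => push_f hz j) (hid s hS)
        (fun a ha => pd_y hS (h5.mono fun z hz hzS => ff_v0 (hz hzS) _ _) ha) (τ i)
      rw [hsum, hfam] at h
      rw [h]
      exact h3 hS i j
    · have h := pd_push (F' := Xm τ P' i j a) (G := XX P (fam φ τ) i j (gr (φ a))) hτ
        (h4.mono fun z hz => push_X hz i j a) (hid s hS)
        (fun a ha => pd_y hS (h5.mono fun z hz hzS => XX_v0 (hz hzS) _ _ _ _) ha) (τ l)
      rw [hsum, hfam, XX_pd0 (h2 hS), fam_co] at h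
      rw [h]
      have e : (fun m => (gr (φ a) m) s) = ((Pi.single a 1 : Fin n → ℝ) - ∑ l, AA hq τ ε P a l s • (Pi.single (τ l) 1 : Fin n → ℝ)) :=
        funext fun m => φpd a ha s hS m
      rw [e]
      have e2 : ∀ β, XX (fun I => pd (τ l) (P I) s) (eR τ) i j β = XXlin (fun I => pd (τ l) (P I) s) (eR τ) hij β :=
        fun _ => rfl
      rw [e2, map_sub, map_sum]
      simp only [map_smul]
      simp only [← e2, ← Xm_pd0 (h2 hS)]
      rw [x_pt hq hqn hε h1 (h2 hS) (h3 hS) a hij]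
      have e3 : ∀ t, pd (τ l) (Xm τ P i j (τ t)) s = (if t = j then (if l = i then ε i else 0) else 0) -
          (if t = i then (if l = j then ε j else 0) else 0) := by
        intro t
        rw [Xm_top hij, map_sub, Sm.sub_ap]
        have h3' := h3 hS
        congr 1
        · split_ifs with q1 q2
          · rw [h3', if_pos q2, q2]
          · rw [h3', if_neg q2]
          · simp
        · split_ifs with q1 q2
          · rw [h3', if_pos q2, q2]
          · rw [h3', if_neg q2]
          · simp
      simp only [e3, smul_eq_mul, mul_sub, Finset.sum_sub_distrib, mul_ite, mul_zero, Finset.sum_ite_eq',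
        Finset.mem_univ, if_true]
      simp only [mul_comm, sub_self]
  refine ⟨P', ⟨⟨hg', h0', hBX.mono fun s hs hS => (hs hS).1⟩, hBX.mono fun s hs hS => (hs hS).2⟩, hNF⟩

theorem step1 (hτ : Function.Injective τ) (hq : 2 ≤ q) (hqn : q ≤ n) (hε : ∀ i, ε i * ε i = 1) (k : ℕ)
    (H : H1 τ ε P) : ∃ P' : Idx n q → Sm n, H2 τ ε P' ∧ (NF n q k P' → NF n q k P) := by
  obtain ⟨hg, h0, hB⟩ := H
  obtain ⟨T, hT0, hT⟩ := exists_T (N := q + 1) (by omega) ε hε (fun i j => pd (τ i) (fS τ P j)) hB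
  let φ : Fin n → Sm n := glue τ (fun j => ∑ l, T j l * co (τ l)) co
  have φt : ∀ j, φ (τ j) = ∑ l, T j l * co (τ l) := fun j => glue_top hτ _ _ j
  have φo : ∀ a, (∀ j, τ j ≠ a) → φ a = co a := fun a ha => glue_other _ _ ha
  have hid : ∀ s ∈ SS τ, mp φ s = s := by
    intro s hS
    have hS' : ∀ l, s (τ l) = 0 := hS
    funext m
    rw [mp]
    rcases ind_cases τ m with ⟨j, rfl⟩ | ha
    · rw [φt, Sm.sum_ap, hS' j]
      exact Finset.sum_eq_zero fun l _ => by rw [Sm.mul_ap, co_apply, hS', mul_zero]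
    · rw [φo m ha, co_apply]
  have φpd : ∀ j, ∀ s ∈ SS τ, (fun m => pd m (φ (τ j)) s) = emb τ (fun l => T j l s) := by
    intro j s hS
    have hS' : ∀ l, s (τ l) = 0 := hS
    funext m
    rw [φt, pd_sum, Sm.sum_ap, emb, Fintype.linearCombination_apply, Finset.sum_apply]
    refine Finset.sum_congr rfl fun l _ => ?_
    rw [pd_mul, Sm.add_ap, Sm.mul_ap, Sm.mul_ap, co_apply, hS', mul_zero, zero_add, pd_co, Pi.smul_apply,
        Pi.single_apply, smul_eq_mul]
    split_ifs <;> rfl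
  have hemb : ∀ (v : Fin (q + 1) → ℝ) l, emb τ v (τ l) = v l := by
    intro v l
    rw [emb, Fintype.linearCombination_apply, Finset.sum_apply, Finset.sum_eq_single l]
    · simp
    · intro b _ hb
      rw [Pi.smul_apply, Pi.single_eq_of_ne (fun h => hb (hτ h).symm), smul_zero]
    · simp
  have hj1 : jm φ 0 = 1 := by
    ext a m
    show pd m (φ a) 0 = _
    rcases ind_cases τ a with ⟨j, rfl⟩ | ha
    · have := congrFun (φpd j 0 zero_SS) m
      refine this.trans ?_
      have e : (fun l => T j l 0) = Pi.single j 1 := by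
        funext l; rw [hT0, Pi.single_apply]; simp [eq_comm]
      rw [e, emb_single, Matrix.one_apply, Pi.single_apply]
      simp [eq_comm]
    · rw [φo a ha, pd_co, Matrix.one_apply]
      by_cases hma : m = a
      · subst hma; simp
      · simp [hma, Ne.symm hma]
  obtain ⟨P', hpush, -, hg', hNF⟩ := thmB k φ (hid 0 zero_SS) (by rw [hj1]; simp) P hg
  have h0' := van_of_id hid hpush h0
  have hTc : ∀ᶠ s in nhds (0 : Fin n → ℝ), (Matrix.of fun i j => T i j s).det ≠ 0 := by
    have hc : Continuous fun s : Fin n → ℝ => (Matrix.of fun i j => T i j s).det := by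
      refine Continuous.matrix_det ?_
      exact continuous_matrix fun i j => (Sm.smooth (T i j)).continuous
    refine hc.continuousAt.eventually_ne ?_
    have : (Matrix.of fun i j => T i j 0) = 1 := by ext i j; rw [Matrix.of_apply, hT0, Matrix.one_apply]
    rw [this]; simp
  have hBc : ∀ᶠ s in nhds (0 : Fin n → ℝ), (Bm τ P s).det ≠ 0 := by
    have hc : Continuous fun s : Fin n → ℝ => (Bm τ P s).det := by
      refine Continuous.matrix_det ?_
      exact continuous_matrix fun i j => (Sm.smooth (pd (τ i) (fS τ P j))).continuous
    refine hc.continuousAt.eventually_ne ?_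
    have : Bm τ P 0 = Matrix.diagonal ε := by
      ext i j; rw [Bm, Matrix.of_apply, hB, Matrix.diagonal_apply]
    rw [this, Matrix.det_diagonal, Finset.prod_ne_zero_iff]
    intro i _ h
    have := hε i
    simp [h] at this
  refine ⟨P', ⟨hg', h0', ?_⟩, hNF⟩
  filter_upwards [eventually_eventually_nhds.2 hg, h0, eventually_eventually_nhds.2 h0, eventually_eventually_nhds.2 hpush,
      eventually_eventually_nhds.2 h0', hT, hTc, hBc] with s h1 h2 h2' h4 h5 h6 h7 h8 hS
  have hsy := symm_pt hτ hq hqn h1 h2' hS h8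
  have h9 := h6 hsy
  set TT' : Matrix (Fin (q + 1)) (Fin (q + 1)) ℝ := Matrix.of fun i j => T i j s with hTT
  let G : Matrix (Fin (q + 1)) (Fin (q + 1)) ℝ := Matrix.of fun i j =>
    ff (fun I => pd (τ i) (P I) s) (fun l => emb τ (TT' l)) j
  have hG1 : TT'.transpose * Bm τ P' s = G := by
    ext i j
    have h := pd_push (F' := fS τ P' j) (G := ff P (fam φ τ) j) hτ (h4.mono fun z hz => push_f hz j) (hid s hS)
        (fun a ha => pd_y hS (h5.mono fun z hz hzS => ff_v0 (hz hzS) _ _) ha) (τ i)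
    rw [ff_pd0 (h2 hS)] at h
    have e : (fun a m => fam φ τ a m s) = fun l => emb τ (TT' l) := by
      funext l; exact φpd l s hS
    rw [e] at h
    show _ = ff (fun I => pd (τ i) (P I) s) (fun l => emb τ (TT' l)) j
    rw [← h, Matrix.mul_apply]
    refine Finset.sum_congr rfl fun l _ => ?_
    have e2 : pd (τ i) (φ (τ l)) s = TT' l i := (congrFun (φpd l s hS) (τ i)).trans (hemb _ _)
    rw [e2, mul_comm]; rfl
  have hG2 : G * TT' = TT'.det • Bm τ P s := by
    ext i l
    have h := congrFun (ff_T τ (fun I => pd (τ i) (P I) s) TT') l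
    rw [Matrix.mul_apply, Matrix.smul_apply, Bm, Matrix.of_apply, fS_pd0 (h2 hS)]
    rw [Matrix.mulVec, dotProduct, Pi.smul_apply] at h
    rw [← h]
    refine Finset.sum_congr rfl fun j _ => ?_
    rw [Matrix.transpose_apply, mul_comm]; rfl
  have hu : IsUnit TT' := (Matrix.isUnit_iff_isUnit_det _).2 (isUnit_iff_ne_zero.2 h7)
  have hut : IsUnit TT'.transpose := (Matrix.isUnit_transpose _).2 hu
  have hfin : TT'.transpose * Bm τ P' s * TT' = TT'.transpose * Matrix.diagonal ε * TT' := by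
    rw [hG1, hG2, h9]; rfl
  have hfin2 := hut.mul_left_cancel (hu.mul_right_cancel hfin)
  intro i j
  have := congrFun (congrFun hfin2 i) j
  rw [Matrix.diagonal_apply] at this
  exact this

theorem step0 (hτ : Function.Injective τ) (hq : 2 ≤ q) (hqn : q ≤ n) (hε : ∀ i, ε i * ε i = 1) (k : ℕ)
    (H : H0 τ ε P) : ∃ P' : Idx n q → Sm n, H1 τ ε P' ∧ (NF n q k P' → NF n q k P) := by
  obtain ⟨hg, h0, hB⟩ := H
  let φ : Fin n → Sm n := glue τ (fun j => ε j • fS τ P j) co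
  have φt : ∀ j, φ (τ j) = ε j • fS τ P j := fun j => glue_top hτ _ _ j
  have φo : ∀ a, (∀ j, τ j ≠ a) → φ a = co a := fun a ha => glue_other _ _ ha
  have hεz : ∀ i, ε i ≠ 0 := fun i h => by have := hε i; simp [h] at this
  have hid : mp φ 0 = 0 := by
    funext m
    rw [mp]
    rcases ind_cases τ m with ⟨j, rfl⟩ | ha
    · rw [φt, Sm.smul_ap, fS, ff_v0 h0, mul_zero]; rfl
    · rw [φo m ha, co_apply]
  have hpd : ∀ a m, pd m (φ a) 0 = (Pi.single a 1 : Fin n → ℝ) m := by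
    intro a m
    rw [Pi.single_apply]
    rcases ind_cases τ a with ⟨j, rfl⟩ | ha
    · rw [φt, map_smul, Sm.smul_ap, hB]
      split_ifs
      · exact hε j
      · simp
    · rw [φo a ha, pd_co]
      split_ifs <;> rfl
  have hj1 : jm φ 0 = 1 := by
    ext a m
    refine (hpd a m).trans ?_
    rw [Matrix.one_apply, Pi.single_apply]; simp [eq_comm]
  obtain ⟨P', hpush, hmap, hg', hNF⟩ := thmB k φ hid (by rw [hj1]; simp) P hg
  refine ⟨P', ⟨hg', ?_, fun i j => ?_⟩, hNF⟩
  · have hBc : ∀ᶠ s in nhds (0 : Fin n → ℝ), (Bm τ P s).det ≠ 0 := by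
      have hc : Continuous fun s : Fin n → ℝ => (Bm τ P s).det := by
        refine Continuous.matrix_det ?_
        exact continuous_matrix fun i j => (Sm.smooth (pd (τ i) (fS τ P j))).continuous
      refine hc.continuousAt.eventually_ne ?_
      have : Bm τ P 0 = Matrix.diagonal ε := by
        ext i j; rw [Bm, Matrix.of_apply, hB, Matrix.diagonal_apply]
        simp only [hτ.eq_iff]
        split_ifs with h <;> simp [h]
      rw [this, Matrix.det_diagonal, Finset.prod_ne_zero_iff]
      exact fun i _ => hεz i
    have : ∀ᶠ z in nhds (0 : Fin n → ℝ), mp φ z ∈ SS τ → at' P' (mp φ z) = 0 := by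
      filter_upwards [hBc, eventually_eventually_nhds.2 hg, hpush] with z h1 h2 h3 hS
      have hf : ∀ j, fS τ P j z = 0 := by
        intro j
        have : φ (τ j) z = 0 := hS j
        rw [φt, Sm.smul_ap] at this
        exact (mul_eq_zero.1 this).resolve_left (hεz j)
      rw [h3, vanish_pt hq hqn h2 hf h1, extPow_zero']
    exact hmap (Filter.mem_map.2 this)
  · have h := pd_congr (F := cm (fS τ P' j) φ) (G := ff P (fam φ τ) j) (τ i) (hpush.mono fun z hz => push_f hz j)
    rw [pd_cm, hid, ff_pd0 h0] at h
    have e : (fun a m => fam φ τ a m 0) = eR τ := by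
      funext l m; exact hpd (τ l) m
    rw [e, ← fS_pd0 h0, hB, Finset.sum_eq_single (τ i)] at h
    · rw [hpd, Pi.single_eq_same, mul_one] at h
      rw [h]
      simp only [hτ.eq_iff]
      split_ifs with h9 <;> simp [h9]
    · intro b _ hb
      rw [hpd, Pi.single_eq_of_ne hb.symm, mul_zero]
    · simp

theorem steps (h : q < n) (hq : 2 ≤ q) (k : ℕ) (H : H0 (tau h) (fun j => eps k j) P) : NF n q k P := by
  have hε : ∀ i : Fin (q + 1), eps k i * eps k i = 1 := by
    intro i; unfold eps; split_ifs <;> norm_num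
  obtain ⟨P1, h1, g1⟩ := step0 (tau_inj h) hq h.le hε k H
  obtain ⟨P2, h2, g2⟩ := step1 (tau_inj h) hq h.le hε k h1
  obtain ⟨P3, h3, g3⟩ := step2 (tau_inj h) hq h.le hε k h2
  exact g1 (g2 (g3 (step3 h hq k h3)))

end Steps
end NambuLin

namespace NambuLin

theorem good_of_nambu {n q : ℕ} {P : (Fin n → ℝ) → MultiVec n q} {U : Set (Fin n → ℝ)} (hN : IsNambu n q P U)
    {Q : Idx n q → Sm n} {z : Fin n → ℝ} (hz : z ∈ U) (hQ : ∀ᶠ z' in nhds z, at' Q z' = P z') : GoodAt Q z := by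
  intro hne
  rw [hQ.self_of_nhds] at hne
  obtain ⟨W, hzW, hWU, φ, ⟨hWo, hφWo, hφ, ψ, hψ, hψφ, -⟩, hstd⟩ := hN.2 z hz hne
  have hsm : ∀ z' ∈ W, ContDiffAt ℝ ∞ φ z' := fun z' hz' => hφ.contDiffAt (hWo.mem_nhds hz')
  choose χ hχ using fun i : Fin n => globalize (f := fun x => φ x i) (p := z)
    (Filter.eventually_of_mem (hWo.mem_nhds hzW) fun z' hz' => contDiffAt_pi.1 (hsm z' hz') i)
  have hχφ : mp χ =ᶠ[nhds z] φ := by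
    filter_upwards [Filter.eventually_all.2 hχ] with z' hz'
    funext i; exact hz' i
  refine ⟨χ, ?_, ?_⟩
  · rw [isUnit_iff_ne_zero]
    intro h0
    obtain ⟨v, hv, hv0⟩ := Matrix.exists_mulVec_eq_zero_iff.2 h0
    apply hv
    have h1 : fderiv ℝ φ z v = 0 := by
      rw [← hχφ.fderiv_eq, fderiv_mp_mulVec]; exact hv0
    have hψd : DifferentiableAt ℝ ψ (φ z) :=
      (hψ.contDiffAt (hφWo.mem_nhds (Set.mem_image_of_mem _ hzW))).differentiableAt (by simp)
    have hφd : DifferentiableAt ℝ φ z := (hsm z hzW).differentiableAt (by simp)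
    have h2 : fderiv ℝ (ψ ∘ φ) z = fderiv ℝ id z :=
      Filter.EventuallyEq.fderiv_eq (Filter.eventually_of_mem (hWo.mem_nhds hzW) fun z' hz' => hψφ z' hz')
    rw [fderiv_comp z hψd hφd, fderiv_id] at h2
    have h3 := congrArg (fun L => L v) h2
    simp only [ContinuousLinearMap.comp_apply, h1, map_zero, ContinuousLinearMap.id_apply] at h3
    exact h3.symm
  · filter_upwards [hQ, hWo.mem_nhds hzW, hχφ.eventuallyEq_nhds] with z' h1 h2 h3
    have e : (Matrix.of fun i j => pd j (χ i) z') = jac φ z' := by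
      have := jac_mp χ z'
      rw [jm] at this
      rw [← this, jac, jac, h3.fderiv_eq]
    rw [e, h1]
    exact hstd z' h2

theorem ff_model {n q : ℕ} (h : q < n) (k : ℕ) (m : Fin n) (j : Fin (q + 1)) :
    ff (modelPi n q k (Pi.single m 1)) (eR (tau h)) j = if m = tau h j then eps k j else 0 := by
  have htop : ∀ j : Fin (q + 1), tau h j ∈ topIdx n q := fun j => by
    simp only [topIdx, Finset.mem_filter, Finset.mem_univ, true_and, tau_val]; exact j.2
  have hcard : (topIdx n q).card = q + 1 := by
    have : topIdx n q = Finset.univ.map ⟨tau h, tau_inj h⟩ := by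
      ext a
      simp only [topIdx, Finset.mem_filter, Finset.mem_univ, true_and, Finset.mem_map, Function.Embedding.coeFn_mk]
      exact ⟨fun h1 => ⟨⟨a, h1⟩, rfl⟩, by rintro ⟨j, rfl⟩; exact j.2⟩
    rw [this, Finset.card_map, Finset.card_univ, Fintype.card_fin]
  let J : Idx n q := ⟨(topIdx n q).erase (tau h j), by rw [Finset.card_erase_of_mem (htop j), hcard]; omega⟩
  have hemb : ∀ a, J.1.orderEmbOfFin J.2 a = tau h (j.succAbove a) := by
    have := Finset.orderEmbOfFin_unique J.2 (f := fun a => tau h (j.succAbove a)) (fun a => by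
      show _ ∈ (topIdx n q).erase (tau h j)
      rw [Finset.mem_erase]
      exact ⟨fun e => (Fin.succAbove_ne j a) (tau_inj h e), htop _⟩) (fun a b hab => by
      have := (Fin.strictMono_succAbove j) hab
      exact this)
    intro a; rw [← this]
  have e : j.removeNth (eR (tau h)) = fun a => Pi.single (J.1.orderEmbOfFin J.2 a) 1 := by
    funext a; rw [hemb]; rfl
  rw [ff, e, ev_single, modelPi, Finset.sum_eq_single (tau h j), if_pos ⟨j.2, rfl⟩]
  · have e2 : eps k (tau h j) = eps k j := rfl
    rw [tau_val, e2, Pi.single_apply]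
    have : ((-1 : ℝ) ^ (j : ℕ)) * (-1) ^ (j : ℕ) = 1 := by rw [← mul_pow]; simp
    by_cases hm : m = tau h j
    · rw [if_pos hm, if_pos hm.symm, mul_one, ← mul_assoc, this, one_mul]
    · rw [if_neg hm, if_neg (Ne.symm hm)]; simp
  · intro b _ hb
    refine if_neg ?_
    rintro ⟨h1, h2⟩
    have hbt : b ∈ topIdx n q := by simpa [topIdx] using h1
    have : b ∈ J.1 := Finset.mem_erase.2 ⟨hb, hbt⟩
    rw [h2] at this
    simp at this
  · simp

theorem flat_normalization (n q k : ℕ) (hq : 2 ≤ q) (hn : q < n) (hk : k ≤ q + 1)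
    (U : Set (Fin n → ℝ)) (hU : IsOpen U) (h0U : (0 : Fin n → ℝ) ∈ U)
    (P : (Fin n → ℝ) → MultiVec n q) (hN : IsNambu n q P U)
    (hP0 : P 0 = 0) (hlin : ∀ v : Fin n → ℝ, fderiv ℝ P 0 v = modelPi n q k v) :
    ∃ W : Set (Fin n → ℝ), W ⊆ U ∧ (0 : Fin n → ℝ) ∈ W ∧ IsOpen W ∧
      ∃ φ ψ : (Fin n → ℝ) → (Fin n → ℝ),
        IsOpen (φ '' W) ∧ ContDiffOn ℝ ∞ φ W ∧ ContDiffOn ℝ ∞ ψ (φ '' W) ∧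
        (∀ x ∈ W, ψ (φ x) = x) ∧ (∀ y ∈ φ '' W, φ (ψ y) = y) ∧ φ 0 = 0 ∧
        ∀ y ∈ φ '' W, (∀ j : Fin n, (j : ℕ) < q + 1 → y j = 0) →
          ∀ l : ℕ, iteratedFDerivWithin ℝ l
            (fun z => extPow n q (jac φ (ψ z)) (P (ψ z)) - modelPi n q k z) (φ '' W) y = 0 := by
  have hsm : ∀ z ∈ U, ContDiffAt ℝ ∞ P z := fun z hz => hN.1.contDiffAt (hU.mem_nhds hz)
  choose Q hQ using fun I : Idx n q => globalize (f := fun x => P x I) (p := 0)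
    (Filter.eventually_of_mem (hU.mem_nhds h0U) fun z' hz' => contDiffAt_pi.1 (hsm z' hz') I)
  have hQP : ∀ᶠ z in nhds (0 : Fin n → ℝ), at' Q z = P z := by
    filter_upwards [Filter.eventually_all.2 hQ] with z hz
    funext I; exact hz I
  have hQ0 : at' Q 0 = 0 := by rw [hQP.self_of_nhds, hP0]
  have hPd : DifferentiableAt ℝ P 0 := (hsm 0 h0U).differentiableAt (by simp)
  have hpd : ∀ m I, pd m (Q I) 0 = modelPi n q k (Pi.single m 1) I := by
    intro m I
    rw [pd_apply, (hQ I).fderiv_eq, ← hlin]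
    have := (hasFDerivAt_pi'.1 hPd.hasFDerivAt I).fderiv
    rw [this]; rfl
  have hNF : NF n q k Q := by
    refine steps hn hq k ⟨?_, hQ0, fun m j => ?_⟩
    · filter_upwards [eventually_eventually_nhds.2 hQP, hU.mem_nhds h0U] with z h1 h2
      exact good_of_nambu hN h2 h1
    · rw [fS_pd0 hQ0]
      have : (fun I => pd m (Q I) 0) = modelPi n q k (Pi.single m 1) := funext (hpd m)
      rw [this, ff_model]
  obtain ⟨V, hV, hVo, h0V⟩ := mem_nhds_iff.1 hQP
  obtain ⟨W, hWU, h0W, hWo, φ, ψ, h1, h2, h3, h4, h5, h6, h7⟩ := hNF (U ∩ V) (hU.inter hVo) ⟨h0U, h0V⟩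
  refine ⟨W, fun x hx => (hWU hx).1, h0W, hWo, φ, ψ, h1, h2, h3, h4, h5, h6, fun y hy hyj l => ?_⟩
  rw [← h7 y hy hyj l]
  refine iteratedFDerivWithin_congr ?_ hy l
  rintro _ ⟨x, hx, rfl⟩
  have : at' Q x = P x := hV (hWU hx).2
  simp only [h4 x hx, this]

end NambuLin
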